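/- arXiv:0905.0270 — 2 statements merged into one kernel-verified Lean document; each statement's English description precedes it below -/
import Mathlib

section
/- Let d ≥ 3 and q > d/2. Let W : ℤ^d → (0,∞) be such that 𝒥W is a normalized Hardy weight on ℝ^d, i.e. ∫_{ℝ^d} (𝒥W)(ξ)|U(ξ)|² dξ ≤ ∫_{ℝ^d} |∇U(ξ)|² dξ for every compactly supported Lipschitz function U : ℝ^d → ℂ. Then there is a constant C = C(d,q) such that for every V : ℤ^d → [0,∞): (i) for all s > 0, n(s,V) ≤ C · s^{−q} · sup_{t>0} ( t^q · Σ_{x : V(x) > t·W(x)} W(x)^{d/2} ), the supremum taken in [0,∞]; equivalently N₋(−Δ − αV) ≤ C α^q ‖V/W‖^q_{ℓ_{q,w}(W^{d/2})}; and (ii) if moreover t^q · Σ_{x : V(x) > t·W(x)} W(x)^{d/2} → 0 both as t → 0⁺ and as t → ∞, then s^q n(s,V) → 0 as s → 0⁺, i.e. N₋(−Δ − αV) = o(α^q) as α → ∞. -/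
open scoped ENNReal NNReal Topology
open Filter MeasureTheory

noncomputable section

/-- The lattice point `1_j` in `ℤ^d`: `j`-th coordinate `1`, all others `0`. -/
def latUnit (d : ℕ) (j : Fin d) : Fin d → ℤ := fun i => if i = j then 1 else 0

/-- The discrete Dirichlet form `Q_0[u] = Σ_x Σ_j |u(x+1_j) − u(x)|²`, valued in `[0,∞]`. -/
def Q0 {d : ℕ} (u : (Fin d → ℤ) → ℂ) : ℝ≥0∞ :=
  ∑' x : Fin d → ℤ, ∑ j : Fin d, ((‖u (x + latUnit d j) - u x‖₊ : ℝ≥0∞)) ^ 2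

/-- `b_V[u] = Σ_x V(x)|u(x)|²`, valued in `[0,∞]`. -/
def bV {d : ℕ} (V : (Fin d → ℤ) → ℝ) (u : (Fin d → ℤ) → ℂ) : ℝ≥0∞ :=
  ∑' x : Fin d → ℤ, ENNReal.ofReal (V x) * ((‖u x‖₊ : ℝ≥0∞)) ^ 2

/-- The Euclidean norm `|x|` of a lattice point. -/
def znorm {d : ℕ} (x : Fin d → ℤ) : ℝ := Real.sqrt (∑ i, ((x i : ℝ)) ^ 2)

/-- The counting function `n(s,V)`: the supremum, in `ℕ∞`, of `dim L` over all
finite-dimensional subspaces `L` of the space of finitely supported functions with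
`b_V[u] > s·Q_0[u]` for all nonzero `u ∈ L` (the `s`-admissible subspaces). -/
def nCount (d : ℕ) (V : (Fin d → ℤ) → ℝ) (s : ℝ) : ℕ∞ :=
  ⨆ L : {L : Submodule ℂ ((Fin d → ℤ) → ℂ) //
      (∀ u ∈ L, (Function.support u).Finite) ∧ FiniteDimensional ℂ L ∧
      ∀ u ∈ L, u ≠ 0 → ENNReal.ofReal s * Q0 u < bV V u},
    (Module.finrank ℂ L.1 : ℕ∞)

/-- `ν(s,V)`: the number (in `ℕ∞`) of lattice points with `V(x) > s`. -/
def nuCount (d : ℕ) (V : (Fin d → ℤ) → ℝ) (s : ℝ) : ℕ∞ :=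
  {x : Fin d → ℤ | s < V x}.encard

section

open ComplexConjugate AddMonoidAlgebra

section LatticeAlgebra

variable {G : Type*} [AddCommGroup G]

/-- The involution `a ↦ a*` of the group algebra `ℂ[G]`, `a*(x) = conj (a (-x))`. -/
def adj : AddMonoidAlgebra ℂ G →+* AddMonoidAlgebra ℂ G :=
  (AddMonoidAlgebra.mapRingHom G (starRingEnd ℂ)).comp
    (AddMonoidAlgebra.mapDomainRingHom ℂ (negAddMonoidHom : G →+ G))

theorem adj_single (x : G) (r : ℂ) : adj (single x r) = single (-x) (conj r) := by
  simp [adj]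

theorem adj_adj (a : AddMonoidAlgebra ℂ G) : adj (adj a) = a := by
  induction a using AddMonoidAlgebra.induction_linear with
  | zero => simp
  | add a b ha hb => simp [ha, hb]
  | single x r => simp [adj_single]

theorem coeff_adj_zero (a : AddMonoidAlgebra ℂ G) : (adj a).coeff 0 = conj (a.coeff 0) := by
  classical
  induction a using AddMonoidAlgebra.induction_linear with
  | zero => simp
  | add a b ha hb => simp [ha, hb]
  | single x r => by_cases h : x = 0 <;> simp [adj_single, h]

theorem coeff_adj_mul_zero (a b : AddMonoidAlgebra ℂ G) (S : Finset G)
    (hS : ∀ x, a.coeff x ≠ 0 → x ∈ S) :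
    (adj a * b).coeff 0 = ∑ x ∈ S, conj (a.coeff x) * b.coeff x := by
  classical
  have h : (adj a * b).coeff 0 = a.coeff.sum (fun x r => conj r * b.coeff x) := by
    clear hS
    induction a using AddMonoidAlgebra.induction_linear with
    | zero => simp
    | add a c ha hc =>
      rw [map_add, add_mul, coeff_add, Finsupp.add_apply, ha, hc, coeff_add,
        Finsupp.sum_add_index']
      · simp
      · intro x r s; simp [add_mul]
    | single x r =>
      rw [adj_single, coeff_single_mul_apply, coeff_single, Finsupp.sum_single_index]
      · simp
      · simp
  rw [h, Finsupp.sum_of_support_subset _ (s := S)]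
  · intro x hx; exact hS x (by simpa using hx)
  · simp

/-- The squared `ℓ²` norm on the group algebra. -/
def nsq (a : AddMonoidAlgebra ℂ G) : ℝ := ((adj a * a).coeff 0).re

theorem nsq_eq_sum (a : AddMonoidAlgebra ℂ G) (S : Finset G)
    (hS : ∀ x, a.coeff x ≠ 0 → x ∈ S) : nsq a = ∑ x ∈ S, ‖a.coeff x‖ ^ 2 := by
  rw [nsq, coeff_adj_mul_zero a a S hS, Complex.re_sum]
  refine Finset.sum_congr rfl fun x _ => ?_
  rw [← Complex.normSq_eq_conj_mul_self, Complex.ofReal_re, Complex.normSq_eq_norm_sq]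

theorem nsq_nonneg (a : AddMonoidAlgebra ℂ G) : 0 ≤ nsq a := by
  rw [nsq_eq_sum a a.coeff.support (by simp)]
  positivity

theorem sum_norm_sq_le_nsq (a : AddMonoidAlgebra ℂ G) (S : Finset G) :
    ∑ x ∈ S, ‖a.coeff x‖ ^ 2 ≤ nsq a := by
  classical
  rw [nsq_eq_sum a (a.coeff.support ∪ S) (by simp +contextual)]
  exact Finset.sum_le_sum_of_subset_of_nonneg Finset.subset_union_right fun _ _ _ => by positivity

theorem tsum_nnnorm_sq_eq_nsq (a : AddMonoidAlgebra ℂ G) :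
    ∑' x, ((‖a.coeff x‖₊ : ℝ≥0∞)) ^ 2 = ENNReal.ofReal (nsq a) := by
  rw [tsum_eq_sum (s := a.coeff.support), nsq_eq_sum a a.coeff.support (by simp),
    ENNReal.ofReal_sum_of_nonneg (fun _ _ => by positivity)]
  · refine Finset.sum_congr rfl fun x _ => ?_
    rw [ENNReal.ofReal_pow (norm_nonneg _), ofReal_norm, enorm_eq_nnnorm]
  · intro x hx
    simp at hx
    simp [hx]

/-- Cauchy–Schwarz for the form `(a, b) ↦ (a* b w)(0)` with `w` symmetric and positive. -/
theorem norm_sq_form_le (w : AddMonoidAlgebra ℂ G) (hw : adj w = w)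
    (hpos : ∀ a, 0 ≤ ((adj a * a * w).coeff 0).re) (a b : AddMonoidAlgebra ℂ G) :
    ‖(adj a * b * w).coeff 0‖ ^ 2 ≤
      ((adj a * a * w).coeff 0).re * ((adj b * b * w).coeff 0).re := by
  let c : PreInnerProductSpace.Core ℂ (AddMonoidAlgebra ℂ G) :=
    { inner := fun a b => (adj a * b * w).coeff 0
      conj_inner_symm := fun a b => by
        rw [← coeff_adj_zero, map_mul, map_mul, adj_adj, hw, mul_comm b]
      re_inner_nonneg := fun a => hpos a
      add_left := fun a b c => by simp [add_mul]
      smul_left := fun a b r => by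
        have h : r • a = single 0 r * a := by
          ext x; simp
        change (adj (r • a) * b * w).coeff 0 = conj r * (adj a * b * w).coeff 0
        rw [h, map_mul, adj_single, mul_assoc, mul_assoc, coeff_single_mul_apply]
        simp [mul_assoc] }
  have := @InnerProductSpace.Core.inner_mul_inner_self_le ℂ _ _ _ _ c a b
  have hs : ‖(adj b * a * w).coeff 0‖ = ‖(adj a * b * w).coeff 0‖ := by
    rw [← RCLike.norm_conj, ← coeff_adj_zero, map_mul, map_mul, adj_adj, hw, mul_comm b]
  rw [sq]
  nth_rw 2 [← hs]
  exact this

theorem norm_sq_ip_le (a b : AddMonoidAlgebra ℂ G) :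
    ‖(adj a * b).coeff 0‖ ^ 2 ≤ nsq a * nsq b := by
  simpa [nsq] using norm_sq_form_le (1 : AddMonoidAlgebra ℂ G) (map_one _)
    (fun a => by simpa [nsq] using nsq_nonneg a) a b

theorem coeff_eq_ip (a : AddMonoidAlgebra ℂ G) (x : G) :
    a.coeff x = (adj (single x 1) * a).coeff 0 := by
  rw [adj_single, coeff_single_mul_apply]
  simp

theorem adj_single_one_mul_self (x : G) :
    adj (single x (1 : ℂ)) * single x 1 = 1 := by
  rw [adj_single, single_mul_single]
  simp [one_def]

end LatticeAlgebra

section LazyWalk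

variable {d : ℕ}

/-- The group algebra element acting as the shift `u ↦ u(· + 1_j)`. -/
def shiftElt (j : Fin d) : AddMonoidAlgebra ℂ (Fin d → ℤ) := single (-latUnit d j) 1

/-- The group algebra element acting as `u ↦ (u + u(· + 1_j)) / 2`. -/
def avgElt (j : Fin d) : AddMonoidAlgebra ℂ (Fin d → ℤ) := single 0 (1 / 2) * (1 + shiftElt j)

/-- The product of the averages over all coordinate directions. -/
def cubeAvg (d : ℕ) : AddMonoidAlgebra ℂ (Fin d → ℤ) := ∏ j, avgElt j

/-- The symmetrised average, a lazy random walk in every coordinate. -/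
def walkElt (d : ℕ) : AddMonoidAlgebra ℂ (Fin d → ℤ) := adj (cubeAvg d) * cubeAvg d

theorem adj_walkElt : adj (walkElt d) = walkElt d := by
  rw [walkElt, map_mul, adj_adj, mul_comm]

theorem nsq_avgElt_mul (j : Fin d) (a : AddMonoidAlgebra ℂ (Fin d → ℤ)) :
    nsq (avgElt j * a) = nsq a - 1 / 4 * nsq ((1 - shiftElt j) * a) := by
  have h1 : adj (shiftElt j) * shiftElt j = 1 := adj_single_one_mul_self _
  have h2 : (4 : AddMonoidAlgebra ℂ (Fin d → ℤ)) * (single 0 (1 / 2) * single 0 (1 / 2)) = 1 := by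
    rw [single_mul_single, ofNat_def, single_mul_single, one_def]; norm_num
  have h3 : adj (single (0 : Fin d → ℤ) (1 / 2 : ℂ)) = single 0 (1 / 2) := by
    rw [adj_single]; simp [Complex.conj_ofNat]
  have key : adj (avgElt j * a) * (avgElt j * a) = adj a * a -
      single 0 (1 / 4) * (adj ((1 - shiftElt j) * a) * ((1 - shiftElt j) * a)) := by
    have h4 : (single (0 : Fin d → ℤ) (1 / 4 : ℂ)) = single 0 (1 / 2) * single 0 (1 / 2) := by
      rw [single_mul_single]; norm_num
    rw [h4, avgElt]
    simp only [map_mul, map_add, map_sub, map_one, h3]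
    linear_combination (adj a * a * single 0 (1 / 2) * single 0 (1 / 2) * 2) * h1 +
      adj a * a * h2
  rw [nsq, key, coeff_sub, Finsupp.sub_apply, coeff_single_mul_apply, Complex.sub_re, nsq, nsq]
  simp

theorem nsq_avgElt_mul_le (j : Fin d) (a : AddMonoidAlgebra ℂ (Fin d → ℤ)) :
    nsq (avgElt j * a) ≤ nsq a := by
  rw [nsq_avgElt_mul]; linarith [nsq_nonneg ((1 - shiftElt j) * a)]

theorem nsq_prod_avgElt_mul_le (s : Finset (Fin d)) (a : AddMonoidAlgebra ℂ (Fin d → ℤ)) :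
    nsq ((∏ j ∈ s, avgElt j) * a) ≤ nsq a := by
  classical
  induction s using Finset.induction_on with
  | empty => simp
  | insert j s hj ih =>
    rw [Finset.prod_insert hj, mul_assoc]
    exact (nsq_avgElt_mul_le _ _).trans ih

theorem nsq_sub_nsq_prod_avgElt_mul_le (s : Finset (Fin d))
    (a : AddMonoidAlgebra ℂ (Fin d → ℤ)) :
    nsq a - nsq ((∏ j ∈ s, avgElt j) * a) ≤ 1 / 4 * ∑ j ∈ s, nsq ((1 - shiftElt j) * a) := by
  classical
  induction s using Finset.induction_on with
  | empty => simp
  | insert j s hj ih =>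
    rw [Finset.prod_insert hj, mul_assoc, nsq_avgElt_mul, Finset.sum_insert hj]
    have := nsq_prod_avgElt_mul_le s ((1 - shiftElt j) * a)
    rw [mul_left_comm] at this
    linarith

/-- The Dirichlet form of the lazy walk. -/
def walkForm (a : AddMonoidAlgebra ℂ (Fin d → ℤ)) : ℝ :=
  ((adj a * a * (1 - walkElt d)).coeff 0).re

theorem walkForm_eq (a : AddMonoidAlgebra ℂ (Fin d → ℤ)) :
    walkForm a = nsq a - nsq (cubeAvg d * a) := by
  rw [walkForm, walkElt, nsq, nsq, map_mul, ← Complex.sub_re, ← Finsupp.sub_apply, ← coeff_sub]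
  congr 3
  ring

theorem walkForm_nonneg (a : AddMonoidAlgebra ℂ (Fin d → ℤ)) : 0 ≤ walkForm a := by
  rw [walkForm_eq, cubeAvg]
  linarith [nsq_prod_avgElt_mul_le Finset.univ a]

theorem walkForm_le (a : AddMonoidAlgebra ℂ (Fin d → ℤ)) :
    walkForm a ≤ ∑ j, nsq ((1 - shiftElt j) * a) := by
  rw [walkForm_eq, cubeAvg]
  have h := nsq_sub_nsq_prod_avgElt_mul_le Finset.univ a
  have : 0 ≤ ∑ j, nsq ((1 - shiftElt j) * a) := Finset.sum_nonneg fun _ _ => nsq_nonneg _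
  linarith

theorem Q0_eq (a : AddMonoidAlgebra ℂ (Fin d → ℤ)) :
    Q0 (fun x => a.coeff x) = ENNReal.ofReal (∑ j, nsq ((1 - shiftElt j) * a)) := by
  rw [Q0, ENNReal.ofReal_sum_of_nonneg (fun _ _ => nsq_nonneg _),
    Summable.tsum_finsetSum fun _ _ => ENNReal.summable]
  refine Finset.sum_congr rfl fun j _ => ?_
  rw [← tsum_nnnorm_sq_eq_nsq]
  refine tsum_congr fun x => ?_
  rw [sub_mul, one_mul, coeff_sub, Finsupp.sub_apply, shiftElt, coeff_single_mul_apply,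
    ← nnnorm_neg]
  simp [add_comm]

/-- Telescoping square function bound for powers of the walk. -/
theorem sum_nsq_one_sub_walkElt_pow_le (a : AddMonoidAlgebra ℂ (Fin d → ℤ)) (J : ℕ) :
    ∑ j ∈ Finset.range J, (1 / 2 : ℝ) ^ j * nsq ((1 - walkElt d ^ 2 ^ j) * a) ≤
      2 * walkForm a := by
  set f : ℕ → ℝ := fun n => nsq a - ((adj a * a * walkElt d ^ n).coeff 0).re with hf
  have h1 : ∀ n, nsq ((1 - walkElt d ^ n) * a) = 2 * f n - f (2 * n) := by
    intro n
    have : adj ((1 - walkElt d ^ n) * a) * ((1 - walkElt d ^ n) * a) =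
        adj a * a - adj a * a * walkElt d ^ n - adj a * a * walkElt d ^ n +
          adj a * a * walkElt d ^ (2 * n) := by
      rw [map_mul, map_sub, map_one, map_pow, adj_walkElt, two_mul, pow_add]; ring
    rw [nsq, this]
    simp only [hf, coeff_sub, coeff_add, Finsupp.sub_apply, Finsupp.add_apply, Complex.sub_re,
      Complex.add_re, nsq]
    ring
  have h2 : ∀ n, nsq (cubeAvg d ^ n * a) ≤ nsq a := by
    intro n
    induction n with
    | zero => simp
    | succ n ih =>
      rw [pow_succ', mul_assoc]
      exact (nsq_prod_avgElt_mul_le _ _).trans ih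
  have h3 : ∀ n, 0 ≤ f n := by
    intro n
    have : adj a * a * walkElt d ^ n = adj (cubeAvg d ^ n * a) * (cubeAvg d ^ n * a) := by
      rw [map_mul, map_pow, walkElt, mul_pow]; ring
    simp only [hf, this]
    have := h2 n
    rw [nsq] at this
    linarith
  have h4 : ∑ j ∈ Finset.range J, (1 / 2 : ℝ) ^ j * nsq ((1 - walkElt d ^ 2 ^ j) * a) =
      2 * f 1 - 2 * (1 / 2) ^ J * f (2 ^ J) := by
    induction J with
    | zero => simp
    | succ J ih =>
      rw [Finset.sum_range_succ, ih, h1, ← pow_succ', pow_succ]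
      ring
  have h5 : f 1 = walkForm a := by
    simp only [hf, walkForm, mul_sub, coeff_sub, Finsupp.sub_apply, Complex.sub_re, nsq, mul_one,
      pow_one]
  rw [h4, h5]
  have := h3 (2 ^ J)
  have : 0 ≤ 2 * (1 / 2 : ℝ) ^ J * f (2 ^ J) := by positivity
  linarith

end LazyWalk

section HeatKernel

variable {d : ℕ}

/-- The return probability of the lazy walk after `m` steps. -/
def walkReturn (d m : ℕ) : ℝ := ((walkElt d ^ m).coeff 0).re

theorem nsq_sum_single {ι G : Type*} [AddCommGroup G] (s : Finset ι) (g : ι → G)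
    (hg : Function.Injective g) (r : ι → ℂ) :
    nsq (∑ i ∈ s, single (g i) (r i)) = ∑ i ∈ s, ‖r i‖ ^ 2 := by
  classical
  have h : ∀ i ∈ s, (∑ i ∈ s, single (g i) (r i)).coeff (g i) = r i := by
    intro i hi
    rw [coeff_sum, Finsupp.finsetSum_apply, Finset.sum_eq_single_of_mem i hi]
    · simp
    · intro j _ hj
      simp [hg.ne hj]
  rw [nsq_eq_sum _ (s.image g), Finset.sum_image fun _ _ _ _ h => hg h]
  · exact Finset.sum_congr rfl fun i hi => by rw [h i hi]
  · intro x hx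
    by_contra hxs
    apply hx
    rw [coeff_sum, Finsupp.finsetSum_apply]
    refine Finset.sum_eq_zero fun i hi => ?_
    have : g i ≠ x := fun h => hxs (h ▸ Finset.mem_image_of_mem g hi)
    simp [this]

theorem avgElt_pow (j : Fin d) (m : ℕ) :
    avgElt j ^ m = ∑ k ∈ Finset.range (m + 1),
      single (-(k • latUnit d j)) ((m.choose k : ℂ) / 2 ^ m) := by
  rw [avgElt, mul_pow, add_comm, add_pow, Finset.mul_sum]
  refine Finset.sum_congr rfl fun k _ => ?_
  rw [shiftElt, single_pow, single_pow, natCast_def, one_pow, one_pow, mul_one, single_mul_single,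
    single_mul_single]
  congr 1
  · simp
  · simp [div_eq_mul_inv, mul_comm]

theorem cubeAvg_pow (m : ℕ) :
    cubeAvg d ^ m = ∑ κ ∈ Fintype.piFinset fun _ : Fin d => Finset.range (m + 1),
      single (-(fun i => (κ i : ℤ))) (∏ i, ((m.choose (κ i) : ℂ) / 2 ^ m)) := by
  rw [cubeAvg, ← Finset.prod_pow]
  simp_rw [avgElt_pow]
  rw [Finset.prod_univ_sum]
  refine Finset.sum_congr rfl fun κ _ => ?_
  rw [AddMonoidAlgebra.prod_single, Finset.sum_neg_distrib]
  congr 2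
  ext i
  simp [latUnit, Finset.sum_apply]

theorem walkReturn_eq_nsq (m : ℕ) : walkReturn d m = nsq (cubeAvg d ^ m) := by
  rw [walkReturn, nsq, walkElt, mul_pow, map_pow]

theorem walkReturn_eq (m : ℕ) : walkReturn d m = ((m.centralBinom : ℝ) / 4 ^ m) ^ d := by
  rw [walkReturn_eq_nsq, cubeAvg_pow, nsq_sum_single _
    (fun κ : Fin d → ℕ => -(fun i => (κ i : ℤ)))]
  · simp_rw [norm_prod, ← Finset.prod_pow]
    rw [← Finset.prod_univ_sum (fun _ : Fin d => Finset.range (m + 1))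
      (fun _ k => ‖(m.choose k : ℂ) / 2 ^ m‖ ^ 2)]
    rw [Finset.prod_const, Finset.card_univ, Fintype.card_fin]
    congr 1
    rw [Nat.centralBinom, ← Nat.sum_range_choose_sq]
    push_cast
    rw [Finset.sum_div]
    refine Finset.sum_congr rfl fun k _ => ?_
    rw [norm_div, norm_pow, div_pow, Complex.norm_natCast, ← pow_mul, mul_comm m, pow_mul]
    norm_num
  · intro a b h
    ext i
    have := congrFun (neg_injective h) i
    exact_mod_cast this

theorem centralBinom_sq_mul_le (m : ℕ) : m.centralBinom ^ 2 * (2 * m + 1) ≤ 16 ^ m := by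
  induction m with
  | zero => simp
  | succ m ih =>
    have h := Nat.succ_mul_centralBinom_succ m
    have h2 : (m + 1) ^ 2 * ((m + 1).centralBinom ^ 2 * (2 * (m + 1) + 1)) ≤
        (m + 1) ^ 2 * 16 ^ (m + 1) := by
      calc (m + 1) ^ 2 * ((m + 1).centralBinom ^ 2 * (2 * (m + 1) + 1))
          = ((m + 1) * (m + 1).centralBinom) ^ 2 * (2 * (m + 1) + 1) := by ring
        _ = (m.centralBinom ^ 2 * (2 * m + 1)) * (4 * ((2 * m + 1) * (2 * m + 3))) := by
            rw [h]; ring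
        _ ≤ 16 ^ m * (4 * (4 * (m + 1) ^ 2)) :=
            Nat.mul_le_mul ih (Nat.mul_le_mul_left _ (by nlinarith))
        _ = _ := by ring
    exact Nat.le_of_mul_le_mul_left h2 (by positivity)

theorem walkReturn_le (m : ℕ) : walkReturn d m ≤ ((2 * m + 1 : ℝ)) ^ (-((d : ℝ) / 2)) := by
  rw [walkReturn_eq]
  have h1 : ((m.centralBinom : ℝ) / 4 ^ m) ^ 2 ≤ (2 * m + 1 : ℝ)⁻¹ := by
    rw [div_pow, ← pow_mul, mul_comm m, pow_mul, ← one_div, div_le_div_iff₀ (by positivity)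
      (by positivity)]
    have := centralBinom_sq_mul_le m
    rw [one_mul]
    norm_num
    exact_mod_cast this
  have h2 : (m.centralBinom : ℝ) / 4 ^ m ≤ (2 * m + 1 : ℝ) ^ (-(1 / 2) : ℝ) := by
    rw [Real.rpow_neg (by positivity), ← Real.inv_rpow (by positivity), ← Real.sqrt_eq_rpow]
    exact Real.le_sqrt_of_sq_le h1
  calc ((m.centralBinom : ℝ) / 4 ^ m) ^ d ≤ ((2 * m + 1 : ℝ) ^ (-(1 / 2) : ℝ)) ^ d := by gcongr
    _ = _ := by
      rw [← Real.rpow_natCast, ← Real.rpow_mul (by positivity)]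
      congr 1
      ring

theorem walkReturn_nonneg (m : ℕ) : 0 ≤ walkReturn d m := by
  rw [walkReturn_eq]; positivity

theorem sum_Ico_rpow_le (hd : 3 ≤ d) {n : ℕ} (hn : 1 ≤ n) (N : ℕ) :
    ∑ m ∈ Finset.Ico n N, ((m + 1 : ℕ) : ℝ) ^ (-((d : ℝ) / 2)) ≤
      2 * (n : ℝ) ^ (-(((d : ℝ) - 2) / 2)) := by
  rcases le_or_gt N n with h | h
  · rw [Finset.Ico_eq_empty_of_le h, Finset.sum_empty]; positivity
  have hn' : (0 : ℝ) < n := by exact_mod_cast hn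
  have hd' : (3 : ℝ) ≤ d := by exact_mod_cast hd
  have hnN : (n : ℝ) ≤ N := by exact_mod_cast h.le
  have ha : AntitoneOn (fun x : ℝ => x ^ (-((d : ℝ) / 2))) (Set.Icc n N) := by
    intro x hx y hy hxy
    exact Real.rpow_le_rpow_of_nonpos (hn'.trans_le hx.1) hxy (by linarith)
  refine (ha.sum_le_integral_Ico h.le).trans ?_
  rw [integral_rpow (Or.inr ⟨by linarith, by
    rw [Set.uIcc_of_le hnN]; intro h0; exact absurd h0.1 (by linarith)⟩)]
  have e : -((d : ℝ) / 2) + 1 = -(((d : ℝ) - 2) / 2) := by ring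
  rw [e, div_neg, ← neg_div, div_le_iff₀ (by linarith)]
  have h1 : (0 : ℝ) ≤ (N : ℝ) ^ (-(((d : ℝ) - 2) / 2)) := by positivity
  have h2 : (0 : ℝ) ≤ (n : ℝ) ^ (-(((d : ℝ) - 2) / 2)) := by positivity
  nlinarith

/-- Pointwise bound of the walk averages by the Dirichlet form. -/
theorem norm_sq_coeff_walkElt_pow_mul_le (hd : 3 ≤ d) (n : ℕ) (K : ℝ)
    (hK : ∀ N, ∑ m ∈ Finset.Ico n N, walkReturn d (m + n) ≤ K)
    (a : AddMonoidAlgebra ℂ (Fin d → ℤ)) (x : Fin d → ℤ) :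
    ‖(walkElt d ^ n * a).coeff x‖ ^ 2 ≤ K * walkForm a := by
  have hd' : (3 : ℝ) ≤ d := by exact_mod_cast hd
  set e : AddMonoidAlgebra ℂ (Fin d → ℤ) := single x 1 with he
  have hee : adj e * e = 1 := adj_single_one_mul_self x
  have hbound : ∀ N, n ≤ N →
      ‖(walkElt d ^ n * a).coeff x - (walkElt d ^ N * a).coeff x‖ ^ 2 ≤ K * walkForm a := by
    intro N hN
    set g := ∑ m ∈ Finset.Ico n N, walkElt d ^ m with hg
    have hgt : g * (1 - walkElt d) = walkElt d ^ n - walkElt d ^ N :=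
      geom_sum_Ico_mul_neg (walkElt d) hN
    have hadjg : adj g = g := by simp [hg, map_sum, map_pow, adj_walkElt]
    have h := norm_sq_form_le (1 - walkElt d) (by simp [adj_walkElt]) walkForm_nonneg (g * e) a
    have h1 : adj (g * e) * a * (1 - walkElt d) =
        adj e * (walkElt d ^ n * a) - adj e * (walkElt d ^ N * a) := by
      rw [map_mul, hadjg]
      linear_combination adj e * a * hgt
    have h2 : adj (g * e) * (g * e) * (1 - walkElt d) =
        ∑ m ∈ Finset.Ico n N, (walkElt d ^ (m + n) - walkElt d ^ (m + N)) := by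
      rw [map_mul, hadjg]
      have : adj e * g * (g * e) * (1 - walkElt d) = g * (walkElt d ^ n - walkElt d ^ N) := by
        linear_combination g * g * (1 - walkElt d) * hee + g * hgt
      rw [mul_comm g (adj e), this, hg, Finset.sum_mul]
      exact Finset.sum_congr rfl fun m _ => by ring
    rw [h1, h2, coeff_sub, Finsupp.sub_apply, ← coeff_eq_ip, ← coeff_eq_ip] at h
    refine h.trans (mul_le_mul_of_nonneg_right ?_ (walkForm_nonneg a))
    refine le_trans ?_ (hK N)
    rw [coeff_sum, Finsupp.finsetSum_apply, Complex.re_sum]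
    refine Finset.sum_le_sum fun m _ => ?_
    rw [coeff_sub, Finsupp.sub_apply, Complex.sub_re]
    have := walkReturn_nonneg (d := d) (m + N)
    rw [walkReturn] at this ⊢
    linarith
  have hlim : Tendsto (fun N => (walkElt d ^ N * a).coeff x) atTop (𝓝 0) := by
    have h1 : ∀ N, ‖(walkElt d ^ N * a).coeff x‖ ^ 2 ≤ walkReturn d (2 * N) * nsq a := by
      intro N
      have h2 : adj e * (walkElt d ^ N * a) = adj (walkElt d ^ N * e) * a := by
        rw [map_mul, map_pow, adj_walkElt]; ring
      have h3 : nsq (walkElt d ^ N * e) = walkReturn d (2 * N) := by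
        rw [nsq, walkReturn, map_mul, map_pow, adj_walkElt]
        congr 3
        linear_combination (walkElt d ^ (2 * N)) * hee
      rw [coeff_eq_ip, h2, ← h3]
      exact norm_sq_ip_le _ _
    have h4 : Tendsto (fun N : ℕ => walkReturn d (2 * N) * nsq a) atTop (𝓝 0) := by
      have h5 : Tendsto (fun N : ℕ => (2 * (2 * N : ℕ) + 1 : ℝ) ^ (-((d : ℝ) / 2)))
          atTop (𝓝 0) := by
        refine (tendsto_rpow_neg_atTop (by linarith)).comp ?_
        refine tendsto_atTop_mono (fun N => ?_) tendsto_natCast_atTop_atTop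
        push_cast
        have : (0 : ℝ) ≤ N := by positivity
        linarith
      have h6 := squeeze_zero (fun N => walkReturn_nonneg (d := d) (2 * N))
        (fun N => walkReturn_le (d := d) (2 * N)) h5
      simpa using h6.mul_const (nsq a)
    have h7 := squeeze_zero (fun N => by positivity) h1 h4
    rw [tendsto_zero_iff_norm_tendsto_zero]
    have h8 := h7.sqrt
    simpa using h8
  have h9 := ((tendsto_const_nhds (x := (walkElt d ^ n * a).coeff x)).sub hlim).norm.pow 2
  rw [sub_zero] at h9
  exact le_of_tendsto h9 (eventually_atTop.2 ⟨n, hbound⟩)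

theorem norm_sq_coeff_walkElt_pow_mul_le_rpow (hd : 3 ≤ d) {n : ℕ} (hn : 1 ≤ n)
    (a : AddMonoidAlgebra ℂ (Fin d → ℤ)) (x : Fin d → ℤ) :
    ‖(walkElt d ^ n * a).coeff x‖ ^ 2 ≤ 2 * (n : ℝ) ^ (-(((d : ℝ) - 2) / 2)) * walkForm a := by
  refine norm_sq_coeff_walkElt_pow_mul_le hd n _ (fun N => ?_) a x
  refine le_trans (Finset.sum_le_sum fun m _ => ?_) (sum_Ico_rpow_le hd hn N)
  refine (walkReturn_le _).trans ?_
  refine Real.rpow_le_rpow_of_nonpos (by positivity) ?_ (by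
    rw [neg_nonpos]; positivity)
  push_cast
  have : (0 : ℝ) ≤ m := by positivity
  have : (0 : ℝ) ≤ n := by positivity
  linarith

theorem norm_sq_coeff_le (hd : 3 ≤ d)
    (a : AddMonoidAlgebra ℂ (Fin d → ℤ)) (x : Fin d → ℤ) :
    ‖a.coeff x‖ ^ 2 ≤ 3 * walkForm a := by
  have := norm_sq_coeff_walkElt_pow_mul_le hd 0 3 (fun N => ?_) a x
  · simpa using this
  rcases Nat.eq_zero_or_pos N with rfl | hN
  · simp
  rw [Finset.sum_eq_sum_Ico_succ_bot hN]
  have h0 : walkReturn d (0 + 0) ≤ 1 := by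
    refine (walkReturn_le _).trans ?_
    simp
  have h1 : ∑ m ∈ Finset.Ico (0 + 1) N, walkReturn d (m + 0) ≤ 2 := by
    refine le_trans (Finset.sum_le_sum fun m _ => ?_)
      ((sum_Ico_rpow_le hd le_rfl N).trans (by simp))
    refine (walkReturn_le _).trans ?_
    refine Real.rpow_le_rpow_of_nonpos (by positivity) ?_ (by
      rw [neg_nonpos]; positivity)
    push_cast
    have : (0 : ℝ) ≤ m := by positivity
    linarith
  linarith

end HeatKernel

section DensityBound

variable {d : ℕ}

/-- The discrete Laplacian as an element of the group algebra. -/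
def laplElt (d : ℕ) : AddMonoidAlgebra ℂ (Fin d → ℤ) :=
  ∑ j, adj (1 - shiftElt j) * (1 - shiftElt j)

/-- The Dirichlet form on the group algebra. -/
def dirForm (a : AddMonoidAlgebra ℂ (Fin d → ℤ)) : ℝ := ∑ j, nsq ((1 - shiftElt j) * a)

theorem dirForm_eq (a : AddMonoidAlgebra ℂ (Fin d → ℤ)) :
    dirForm a = ((adj a * a * laplElt d).coeff 0).re := by
  rw [dirForm, laplElt, Finset.mul_sum, coeff_sum, Finsupp.finsetSum_apply, Complex.re_sum]
  refine Finset.sum_congr rfl fun j _ => ?_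
  have : adj ((1 - shiftElt j) * a) * ((1 - shiftElt j) * a) =
      adj a * a * (adj (1 - shiftElt j) * (1 - shiftElt j)) := by
    rw [map_mul]; ring
  rw [nsq, this]

theorem dirForm_nonneg (a : AddMonoidAlgebra ℂ (Fin d → ℤ)) : 0 ≤ dirForm a :=
  Finset.sum_nonneg fun _ _ => nsq_nonneg _

theorem eq_zero_of_dirForm_nonpos (hd : 3 ≤ d) (a : AddMonoidAlgebra ℂ (Fin d → ℤ))
    (ha : dirForm a ≤ 0) : a = 0 := by
  ext x
  have h := (norm_sq_coeff_le hd a x).trans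
    (mul_le_mul_of_nonneg_left ((walkForm_le a).trans ha) (by norm_num))
  rw [mul_zero] at h
  simpa using pow_eq_zero_iff two_ne_zero |>.1 (le_antisymm h (by positivity))

theorem single_zero_mul_eq_smul (r : ℂ) (a : AddMonoidAlgebra ℂ (Fin d → ℤ)) :
    single 0 r * a = r • a := by
  ext x; simp

/-- Finite-dimensional subspaces have bases that are orthonormal for the Dirichlet form. -/
theorem exists_orthonormal_dirForm (hd : 3 ≤ d)
    (L : Submodule ℂ (AddMonoidAlgebra ℂ (Fin d → ℤ))) [FiniteDimensional ℂ L] :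
    ∃ u : Fin (Module.finrank ℂ L) → AddMonoidAlgebra ℂ (Fin d → ℤ), (∀ i, u i ∈ L) ∧
      ∀ i j, (adj (u i) * u j * laplElt d).coeff 0 = if i = j then 1 else 0 := by
  let c : InnerProductSpace.Core ℂ (AddMonoidAlgebra ℂ (Fin d → ℤ)) :=
    { inner := fun a b => (adj a * b * laplElt d).coeff 0
      conj_inner_symm := fun a b => by
        rw [← coeff_adj_zero, map_mul, map_mul, adj_adj, mul_comm b]
        congr 3
        simp [laplElt, adj_adj, mul_comm, map_sum]
      re_inner_nonneg := fun a => by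
        change 0 ≤ ((adj a * a * laplElt d).coeff 0).re
        rw [← dirForm_eq]; exact dirForm_nonneg a
      add_left := fun a b c => by simp [add_mul]
      smul_left := fun a b r => by
        change (adj (r • a) * b * laplElt d).coeff 0 = conj r * (adj a * b * laplElt d).coeff 0
        rw [← single_zero_mul_eq_smul, map_mul, adj_single, mul_assoc, mul_assoc,
          coeff_single_mul_apply]
        simp [mul_assoc]
      definite := fun a h => by
        refine eq_zero_of_dirForm_nonpos hd a ?_
        rw [dirForm_eq]
        exact le_of_eq (congrArg Complex.re h) }
  let _ : NormedAddCommGroup (AddMonoidAlgebra ℂ (Fin d → ℤ)) := c.toNormedAddCommGroup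
  let _ : InnerProductSpace ℂ (AddMonoidAlgebra ℂ (Fin d → ℤ)) := InnerProductSpace.ofCore c.toCore
  let b := stdOrthonormalBasis ℂ L
  refine ⟨fun i => (b i : AddMonoidAlgebra ℂ (Fin d → ℤ)), fun i => (b i).2, fun i j => ?_⟩
  exact orthonormal_iff_ite.1 b.orthonormal i j

variable {N : ℕ} {u : Fin N → AddMonoidAlgebra ℂ (Fin d → ℤ)}

theorem dirForm_eq_one
    (hu : ∀ i j, (adj (u i) * u j * laplElt d).coeff 0 = if i = j then 1 else 0) (i : Fin N) :
    dirForm (u i) = 1 := by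
  rw [dirForm_eq, hu]; simp

theorem dirForm_sum_smul
    (hu : ∀ i j, (adj (u i) * u j * laplElt d).coeff 0 = if i = j then 1 else 0)
    (c : Fin N → ℂ) : dirForm (∑ i, c i • u i) = ∑ i, ‖c i‖ ^ 2 := by
  have h : (adj (∑ i, c i • u i) * (∑ i, c i • u i) * laplElt d).coeff 0 =
      ∑ i, ∑ j, conj (c i) * c j * (adj (u i) * u j * laplElt d).coeff 0 := by
    simp_rw [← single_zero_mul_eq_smul, map_sum, Finset.sum_mul_sum, Finset.sum_mul, coeff_sum,
      Finsupp.finsetSum_apply]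
    refine Finset.sum_congr rfl fun i _ => Finset.sum_congr rfl fun j _ => ?_
    have : adj (single 0 (c i) * u i) * (single 0 (c j) * u j) * laplElt d =
        single 0 (conj (c i) * c j) * (adj (u i) * u j * laplElt d) := by
      have h1 : single (0 : Fin d → ℤ) (conj (c i) * c j) =
          single 0 (conj (c i)) * single 0 (c j) := by
        rw [single_mul_single, add_zero]
      rw [map_mul, adj_single, neg_zero, h1]; ring
    rw [this, coeff_single_mul_apply]
    simp
  rw [dirForm_eq, h, Complex.re_sum]
  refine Finset.sum_congr rfl fun i _ => ?_
  simp only [hu, mul_ite, mul_one, mul_zero, Finset.sum_ite_eq, Finset.mem_univ, if_true]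
  rw [← Complex.normSq_eq_conj_mul_self, Complex.ofReal_re, Complex.normSq_eq_norm_sq]

theorem sum_norm_sq_coeff_mul_le
    (hu : ∀ i j, (adj (u i) * u j * laplElt d).coeff 0 = if i = j then 1 else 0)
    (p : AddMonoidAlgebra ℂ (Fin d → ℤ)) (x : Fin d → ℤ) {K : ℝ} (hK : 0 ≤ K)
    (h : ∀ a, ‖(p * a).coeff x‖ ^ 2 ≤ K * dirForm a) :
    ∑ i, ‖(p * u i).coeff x‖ ^ 2 ≤ K := by
  set S := ∑ i, ‖(p * u i).coeff x‖ ^ 2 with hS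
  have hS0 : 0 ≤ S := by positivity
  have h1 := h (∑ i, conj ((p * u i).coeff x) • u i)
  rw [dirForm_sum_smul hu] at h1
  have h2 : (p * ∑ i, conj ((p * u i).coeff x) • u i).coeff x = (S : ℂ) := by
    rw [Finset.mul_sum, coeff_sum, Finsupp.finsetSum_apply, hS, Complex.ofReal_sum]
    refine Finset.sum_congr rfl fun i _ => ?_
    rw [mul_smul_comm, coeff_smul_apply, smul_eq_mul, ← Complex.normSq_eq_conj_mul_self,
      Complex.normSq_eq_norm_sq]
  rw [h2] at h1
  simp only [RCLike.norm_conj, Complex.norm_real, Real.norm_eq_abs, sq_abs] at h1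
  rw [← hS] at h1
  rcases hS0.eq_or_lt with h0 | h0
  · rw [← h0]; exact hK
  · nlinarith

theorem exists_rpow_le_of_forall_le {κ ρ : ℝ} (hκ : 0 < κ) (h0 : 0 ≤ ρ) (h3 : ρ ≤ 3)
    {σ : ℕ → ℝ} (hσ : ∀ j, 0 ≤ σ j)
    (h : ∀ j, ρ ≤ 4 * ((2 ^ j : ℕ) : ℝ) ^ (-κ) + 2 * σ j) :
    ∃ j, ρ ^ (1 + 1 / κ) ≤ 8 * 8 ^ (1 / κ) * ((1 / 2) ^ j * σ j) := by
  rcases h0.eq_or_lt with rfl | hpos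
  · refine ⟨0, ?_⟩
    rw [Real.zero_rpow (by positivity)]
    have := hσ 0
    positivity
  have hlim : Tendsto (fun j : ℕ => 8 * ((2 ^ j : ℕ) : ℝ) ^ (-κ)) atTop (𝓝 0) := by
    have h1 : Tendsto (fun j : ℕ => ((2 ^ j : ℕ) : ℝ)) atTop atTop :=
      tendsto_natCast_atTop_atTop.comp (tendsto_pow_atTop_atTop_of_one_lt one_lt_two)
    simpa using ((tendsto_rpow_neg_atTop hκ).comp h1).const_mul 8
  have hex : ∃ j : ℕ, 8 * ((2 ^ j : ℕ) : ℝ) ^ (-κ) ≤ ρ :=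
    ((hlim.eventually (gt_mem_nhds hpos)).exists).imp fun _ h => h.le
  classical
  obtain ⟨j, hj⟩ : ∃ j, j = Nat.find hex := ⟨_, rfl⟩
  have hj1 : 8 * ((2 ^ j : ℕ) : ℝ) ^ (-κ) ≤ ρ := hj ▸ Nat.find_spec hex
  obtain ⟨i, rfl⟩ : ∃ i, j = i + 1 := by
    refine Nat.exists_eq_succ_of_ne_zero fun h0 => ?_
    rw [h0] at hj1
    norm_num at hj1
    linarith
  have hj2 : ρ < 8 * ((2 ^ i : ℕ) : ℝ) ^ (-κ) := by
    have := Nat.find_min hex (m := i) (by omega)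
    exact not_le.1 this
  refine ⟨i + 1, ?_⟩
  have hσρ : ρ ≤ 4 * σ (i + 1) := by linarith [h (i + 1)]
  have h4 : (ρ / 8) ^ (1 / κ) ≤ (1 / 2) ^ i := by
    have h5 : ρ / 8 ≤ ((1 / 2 : ℝ) ^ i) ^ κ := by
      have : ((2 ^ i : ℕ) : ℝ) ^ (-κ) = ((1 / 2 : ℝ) ^ i) ^ κ := by
        rw [Real.rpow_neg (by positivity), ← Real.inv_rpow (by positivity)]
        congr 1
        push_cast
        rw [one_div, inv_pow]
      rw [← this]; linarith
    calc (ρ / 8) ^ (1 / κ) ≤ (((1 / 2 : ℝ) ^ i) ^ κ) ^ (1 / κ) := by gcongr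
      _ = _ := by rw [← Real.rpow_mul (by positivity), mul_one_div_cancel hκ.ne', Real.rpow_one]
  have h6 : ρ ^ (1 + 1 / κ) = ρ * (8 ^ (1 / κ) * (ρ / 8) ^ (1 / κ)) := by
    rw [← Real.mul_rpow (by norm_num) (by positivity), mul_div_cancel₀ _ (by norm_num),
      Real.rpow_add hpos, Real.rpow_one]
  rw [h6]
  calc ρ * (8 ^ (1 / κ) * (ρ / 8) ^ (1 / κ))
      ≤ (4 * σ (i + 1)) * (8 ^ (1 / κ) * (1 / 2) ^ i) := by
        have := hσ (i + 1)
        gcongr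
    _ = _ := by rw [pow_succ]; ring

/-- Dual form of the CLR bound: the density of a system that is orthonormal for the Dirichlet
form is bounded in `ℓ^{d/(d-2)}`. -/
theorem sum_density_rpow_le (hd : 3 ≤ d)
    (hu : ∀ i j, (adj (u i) * u j * laplElt d).coeff 0 = if i = j then 1 else 0)
    (S : Finset (Fin d → ℤ)) :
    ∑ x ∈ S, (∑ i, ‖(u i).coeff x‖ ^ 2) ^ (1 + 1 / (((d : ℝ) - 2) / 2)) ≤
      16 * 8 ^ (1 / (((d : ℝ) - 2) / 2)) * N := by
  have hd' : (3 : ℝ) ≤ d := by exact_mod_cast hd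
  set κ : ℝ := ((d : ℝ) - 2) / 2 with hκ
  have hκ0 : 0 < κ := by rw [hκ]; linarith
  set σ : (Fin d → ℤ) → ℕ → ℝ :=
    fun x j => ∑ i, ‖((1 - walkElt d ^ 2 ^ j) * u i).coeff x‖ ^ 2 with hσ
  have hσ0 : ∀ x j, 0 ≤ σ x j := fun x j => by simp only [hσ]; positivity
  have hpt : ∀ x, ∃ j, (∑ i, ‖(u i).coeff x‖ ^ 2) ^ (1 + 1 / κ) ≤
      8 * 8 ^ (1 / κ) * ((1 / 2) ^ j * σ x j) := by
    intro x
    refine exists_rpow_le_of_forall_le hκ0 (by positivity) ?_ (hσ0 x) fun j => ?_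
    · have := sum_norm_sq_coeff_mul_le hu 1 x (K := 3) (by norm_num) fun a => by
        rw [one_mul]
        exact (norm_sq_coeff_le hd a x).trans
          (mul_le_mul_of_nonneg_left (walkForm_le a) (by norm_num))
      simpa using this
    · have h1 := sum_norm_sq_coeff_mul_le hu (walkElt d ^ 2 ^ j) x
        (K := 2 * ((2 ^ j : ℕ) : ℝ) ^ (-κ)) (by positivity) fun a =>
          (norm_sq_coeff_walkElt_pow_mul_le_rpow hd Nat.one_le_two_pow a x).trans
            (mul_le_mul_of_nonneg_left (walkForm_le a) (by positivity))
      have h2 : ∑ i, ‖(u i).coeff x‖ ^ 2 ≤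
          2 * ∑ i, ‖(walkElt d ^ 2 ^ j * u i).coeff x‖ ^ 2 + 2 * σ x j := by
        simp only [hσ]
        rw [Finset.mul_sum, Finset.mul_sum, ← Finset.sum_add_distrib]
        refine Finset.sum_le_sum fun i _ => ?_
        have h3 : (u i).coeff x = (walkElt d ^ 2 ^ j * u i).coeff x +
            ((1 - walkElt d ^ 2 ^ j) * u i).coeff x := by
          rw [← Finsupp.add_apply, ← coeff_add]
          congr 2
          ring
        have h4 := norm_add_le ((walkElt d ^ 2 ^ j * u i).coeff x)
          (((1 - walkElt d ^ 2 ^ j) * u i).coeff x)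
        rw [← h3] at h4
        have h5 := pow_le_pow_left₀ (norm_nonneg _) h4 2
        nlinarith [sq_nonneg (‖(walkElt d ^ 2 ^ j * u i).coeff x‖ -
          ‖((1 - walkElt d ^ 2 ^ j) * u i).coeff x‖)]
      linarith
  choose j hj using hpt
  set J := S.sup j + 1 with hJ
  calc ∑ x ∈ S, (∑ i, ‖(u i).coeff x‖ ^ 2) ^ (1 + 1 / κ)
      ≤ ∑ x ∈ S, 8 * 8 ^ (1 / κ) * ∑ k ∈ Finset.range J, ((1 / 2) ^ k * σ x k) := by
        refine Finset.sum_le_sum fun x hx => (hj x).trans ?_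
        refine mul_le_mul_of_nonneg_left ?_ (by positivity)
        refine Finset.single_le_sum (f := fun k => (1 / 2 : ℝ) ^ k * σ x k)
          (fun k _ => by have := hσ0 x k; positivity) ?_
        rw [Finset.mem_range, hJ, Nat.lt_succ_iff]
        exact Finset.le_sup hx
    _ = 8 * 8 ^ (1 / κ) * ∑ i, ∑ k ∈ Finset.range J, (1 / 2) ^ k *
          ∑ x ∈ S, ‖((1 - walkElt d ^ 2 ^ k) * u i).coeff x‖ ^ 2 := by
        rw [← Finset.mul_sum]
        congr 1
        simp only [hσ, Finset.mul_sum]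
        rw [Finset.sum_comm, Finset.sum_comm (s := Finset.univ)]
        refine Finset.sum_congr rfl fun k _ => ?_
        rw [Finset.sum_comm]
    _ ≤ 8 * 8 ^ (1 / κ) * ∑ i : Fin N, (2 : ℝ) := by
        refine mul_le_mul_of_nonneg_left (Finset.sum_le_sum fun i _ => ?_) (by positivity)
        calc _ ≤ ∑ k ∈ Finset.range J, (1 / 2 : ℝ) ^ k * nsq ((1 - walkElt d ^ 2 ^ k) * u i) := by
              refine Finset.sum_le_sum fun k _ => ?_
              exact mul_le_mul_of_nonneg_left (sum_norm_sq_le_nsq _ _) (by positivity)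
          _ ≤ 2 * walkForm (u i) := sum_nsq_one_sub_walkElt_pow_le _ _
          _ ≤ 2 * dirForm (u i) := mul_le_mul_of_nonneg_left (walkForm_le _) (by norm_num)
          _ = 2 := by rw [dirForm_eq_one hu, mul_one]
    _ = _ := by simp; ring

/-- CLR-type bound after removing the part of `V` that is dominated by a Hardy weight. -/
theorem card_le_of_orthonormal (hd : 3 ≤ d)
    (hu : ∀ i j, (adj (u i) * u j * laplElt d).coeff 0 = if i = j then 1 else 0)
    (S : Finset (Fin d → ℤ)) {s H : ℝ} (hs : 0 < s) (hH : 0 < H) {V W : (Fin d → ℤ) → ℝ}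
    (hV : ∀ x, 0 ≤ V x) (hW0 : ∀ x, 0 ≤ W x)
    (hW : ∀ i, ∑ x ∈ S, W x * ‖(u i).coeff x‖ ^ 2 ≤ H)
    (hsV : ∀ i, s ≤ ∑ x ∈ S, V x * ‖(u i).coeff x‖ ^ 2) :
    (N : ℝ) ≤ (16 * 8 ^ (1 / (((d : ℝ) - 2) / 2))) ^ ((d : ℝ) / 2 - 1) * (2 / s) ^ ((d : ℝ) / 2) *
      ∑ x ∈ S with s / (2 * H) * W x < V x, V x ^ ((d : ℝ) / 2) := by
  have hd' : (3 : ℝ) ≤ d := by exact_mod_cast hd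
  rcases Nat.eq_zero_or_pos N with h0 | hN
  · have : 0 ≤ ∑ x ∈ S with s / (2 * H) * W x < V x, V x ^ ((d : ℝ) / 2) :=
      Finset.sum_nonneg fun x _ => Real.rpow_nonneg (hV x) _
    rw [h0]
    push_cast
    positivity
  have hN' : (0 : ℝ) < N := by exact_mod_cast hN
  set S' := S.filter fun x => s / (2 * H) * W x < V x with hS'
  set ρ : (Fin d → ℤ) → ℝ := fun x => ∑ i, ‖(u i).coeff x‖ ^ 2 with hρ
  have hρ0 : ∀ x, 0 ≤ ρ x := fun x => by simp only [hρ]; positivity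
  have h1 : s * N ≤ ∑ x ∈ S, V x * ρ x := by
    calc s * N = ∑ i : Fin N, s := by simp [mul_comm]
      _ ≤ ∑ i, ∑ x ∈ S, V x * ‖(u i).coeff x‖ ^ 2 := Finset.sum_le_sum fun i _ => hsV i
      _ = _ := by simp only [hρ, Finset.mul_sum]; rw [Finset.sum_comm]
  have h2 : ∑ x ∈ S, W x * ρ x ≤ H * N := by
    calc ∑ x ∈ S, W x * ρ x = ∑ i, ∑ x ∈ S, W x * ‖(u i).coeff x‖ ^ 2 := by
          simp only [hρ, Finset.mul_sum]; rw [Finset.sum_comm]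
      _ ≤ ∑ i : Fin N, H := Finset.sum_le_sum fun i _ => hW i
      _ = _ := by simp [mul_comm]
  have h3 : ∑ x ∈ S, V x * ρ x ≤ ∑ x ∈ S, s / (2 * H) * (W x * ρ x) + ∑ x ∈ S', V x * ρ x := by
    have h4 : ∑ x ∈ S', V x * ρ x = ∑ x ∈ S, if s / (2 * H) * W x < V x then V x * ρ x else 0 :=
      Finset.sum_filter _ _
    rw [h4, ← Finset.sum_add_distrib]
    refine Finset.sum_le_sum fun x _ => ?_
    have := hρ0 x
    have := hW0 x
    split_ifs with hx
    · have : 0 ≤ s / (2 * H) * (W x * ρ x) := by positivity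
      linarith
    · rw [add_zero, ← mul_assoc]
      exact mul_le_mul_of_nonneg_right (not_lt.1 hx) (hρ0 x)
  have h6 : s / 2 * N ≤ ∑ x ∈ S', V x * ρ x := by
    rw [← Finset.mul_sum] at h3
    have : s / (2 * H) * ∑ x ∈ S, W x * ρ x ≤ s / (2 * H) * (H * N) :=
      mul_le_mul_of_nonneg_left h2 (by positivity)
    have h7 : s / (2 * H) * (H * N) = s / 2 * N := by field_simp
    linarith
  set p : ℝ := (d : ℝ) / 2 with hp
  have hκ : ((d : ℝ) - 2) / 2 = p - 1 := by rw [hp]; ring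
  have hp1 : 1 < p := by rw [hp]; linarith
  have hp1' : p - 1 ≠ 0 := by linarith
  have h7 := sum_density_rpow_le hd hu S'
  rw [hκ] at h7 ⊢
  set C₀ : ℝ := 16 * 8 ^ (1 / (p - 1)) with hC₀
  have hC₀pos : 0 < C₀ := by positivity
  set A := ∑ x ∈ S', V x ^ p with hA
  have hA0 : 0 ≤ A := Finset.sum_nonneg fun x _ => Real.rpow_nonneg (hV x) _
  have hpq : p.HolderConjugate (1 + 1 / (p - 1)) := by
    have := Real.HolderConjugate.conjExponent hp1
    have e : p.conjExponent = 1 + 1 / (p - 1) := by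
      rw [Real.conjExponent]; field_simp; ring
    rwa [e] at this
  have h8 := Real.inner_le_Lp_mul_Lq_of_nonneg S' hpq (fun x _ => hV x) (fun x _ => hρ0 x)
  have h9 : s / 2 * N ≤ A ^ (1 / p) * (C₀ * N) ^ (1 / (1 + 1 / (p - 1))) := by
    refine h6.trans (h8.trans ?_)
    refine mul_le_mul_of_nonneg_left ?_ (by positivity)
    exact Real.rpow_le_rpow (Finset.sum_nonneg fun x _ => Real.rpow_nonneg (hρ0 x) _) h7
      (by have : 0 < p - 1 := by linarith
          positivity)
  have h10 : (s / 2 * N) ^ p ≤ A * (C₀ * N) ^ (p - 1) := by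
    calc (s / 2 * N) ^ p ≤ (A ^ (1 / p) * (C₀ * N) ^ (1 / (1 + 1 / (p - 1)))) ^ p := by gcongr
      _ = _ := by
        rw [Real.mul_rpow (by positivity) (by positivity), ← Real.rpow_mul hA0,
          ← Real.rpow_mul (by positivity), one_div_mul_cancel (by linarith), Real.rpow_one]
        have e : 1 + 1 / (p - 1) = p / (p - 1) := by field_simp; ring
        have hp0 : p ≠ 0 := by linarith
        rw [e, one_div_div, div_mul_cancel₀ _ hp0]
  rw [Real.mul_rpow (by positivity) hN'.le, Real.mul_rpow hC₀pos.le hN'.le] at h10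
  have h11 : (N : ℝ) ^ p = N ^ (p - 1) * N := by
    rw [← Real.rpow_add_one hN'.ne', sub_add_cancel]
  have h12 : (2 / s) ^ p * (s / 2) ^ p = 1 := by
    rw [← Real.mul_rpow (by positivity) (by positivity)]
    have : 2 / s * (s / 2) = 1 := by field_simp
    rw [this, Real.one_rpow]
  have hNp : (0 : ℝ) < (N : ℝ) ^ (p - 1) := Real.rpow_pos_of_pos hN' _
  refine le_of_mul_le_mul_left ?_ hNp
  calc (N : ℝ) ^ (p - 1) * N = (2 / s) ^ p * ((s / 2) ^ p * (N : ℝ) ^ p) := by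
        rw [← mul_assoc, h12, h11, one_mul]
    _ ≤ (2 / s) ^ p * (A * (C₀ ^ (p - 1) * (N : ℝ) ^ (p - 1))) := by gcongr
    _ = _ := by ring

end DensityBound

section Interpolation

variable {d : ℕ}

theorem nsq_add_le {G : Type*} [AddCommGroup G] (a b : AddMonoidAlgebra ℂ G) :
    nsq (a + b) ≤ 2 * nsq a + 2 * nsq b := by
  classical
  have hS : ∀ x, x ∈ a.coeff.support ∪ b.coeff.support ↔ a.coeff x ≠ 0 ∨ b.coeff x ≠ 0 := by
    simp
  rw [nsq_eq_sum a (a.coeff.support ∪ b.coeff.support) fun x hx => (hS x).2 (Or.inl hx),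
    nsq_eq_sum b (a.coeff.support ∪ b.coeff.support) fun x hx => (hS x).2 (Or.inr hx),
    nsq_eq_sum (a + b) (a.coeff.support ∪ b.coeff.support) fun x hx => (hS x).2 (by
      by_contra! h
      exact hx (by simp [h.1, h.2])), Finset.mul_sum, Finset.mul_sum, ← Finset.sum_add_distrib]
  refine Finset.sum_le_sum fun x _ => ?_
  have h5 := pow_le_pow_left₀ (norm_nonneg _) (norm_add_le (a.coeff x) (b.coeff x)) 2
  rw [coeff_add, Finsupp.add_apply]
  nlinarith [sq_nonneg (‖a.coeff x‖ - ‖b.coeff x‖)]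

theorem nsq_single_one_mul {G : Type*} [AddCommGroup G] (z : G) (a : AddMonoidAlgebra ℂ G) :
    nsq (single z 1 * a) = nsq a := by
  have h : adj (single z 1 * a) * (single z 1 * a) = adj a * a := by
    rw [map_mul]
    linear_combination adj a * a * adj_single_one_mul_self z
  rw [nsq, h, nsq]

/-- The translations whose increments are controlled by the Dirichlet form. -/
def controlledShifts (d : ℕ) : AddSubgroup (Fin d → ℤ) where
  carrier := {z | ∃ C : ℝ, 0 ≤ C ∧ ∀ a : AddMonoidAlgebra ℂ (Fin d → ℤ),
    nsq ((1 - single z 1) * a) ≤ C * dirForm a}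
  zero_mem' := ⟨0, le_rfl, fun a => by simp [← one_def, nsq]⟩
  add_mem' := by
    rintro z w ⟨C, hC, h⟩ ⟨C', hC', h'⟩
    refine ⟨2 * C + 2 * C', by positivity, fun a => ?_⟩
    have e : (1 - single (z + w) 1) * a =
        (1 - single z 1) * a + single z 1 * ((1 - single w 1) * a) := by
      have : single (z + w) (1 : ℂ) = single z 1 * single w 1 := by
        rw [single_mul_single, one_mul]
      rw [this]; ring
    have h1 := nsq_add_le ((1 - single z 1) * a) (single z 1 * ((1 - single w 1) * a))
    rw [nsq_single_one_mul] at h1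
    rw [e]
    linarith [h a, h' a]
  neg_mem' := by
    rintro z ⟨C, hC, h⟩
    refine ⟨C, hC, fun a => ?_⟩
    have e : (1 - single z 1) * a = single z 1 * ((single (-z) 1 - 1) * a) := by
      have : single z (1 : ℂ) * single (-z) 1 = 1 := by
        rw [single_mul_single, one_mul, add_neg_cancel, one_def]
      linear_combination - a * this
    have e' : nsq ((single (-z) 1 - 1) * a) = nsq ((1 - single (-z) 1) * a) := by
      have : (single (-z) 1 - 1) * a = -((1 - single (-z) 1) * a) := by ring
      rw [this, nsq, nsq, map_neg, neg_mul_neg]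
    rw [← e', ← nsq_single_one_mul z, ← e]
    exact h a

theorem mem_controlledShifts (z : Fin d → ℤ) : z ∈ controlledShifts d := by
  have hz : z = ∑ j, (-z j) • (-latUnit d j) := by
    ext i
    simp [latUnit, Finset.sum_apply]
  rw [hz]
  refine AddSubgroup.sum_mem _ fun j _ => AddSubgroup.zsmul_mem _ ?_ _
  refine ⟨1, zero_le_one, fun a => ?_⟩
  rw [one_mul]
  exact Finset.single_le_sum (f := fun j => nsq ((1 - shiftElt j) * a))
    (fun _ _ => nsq_nonneg _) (Finset.mem_univ j)

/-- The offsets of lattice points near the unit cube. -/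
def nearOffsets (d : ℕ) : Finset (Fin d → ℤ) := Fintype.piFinset fun _ => Finset.Icc (-1) 2

/-- The oscillation of a lattice function near a point. -/
def localOsc (a : AddMonoidAlgebra ℂ (Fin d → ℤ)) (x : Fin d → ℤ) : ℝ :=
  ∑ w ∈ nearOffsets d, ‖a.coeff (x + w) - a.coeff x‖

theorem localOsc_nonneg (a : AddMonoidAlgebra ℂ (Fin d → ℤ)) (x : Fin d → ℤ) :
    0 ≤ localOsc a x := Finset.sum_nonneg fun _ _ => norm_nonneg _

theorem exists_tsum_localOsc_sq_le (d : ℕ) : ∃ C : ℝ, 0 ≤ C ∧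
    ∀ a : AddMonoidAlgebra ℂ (Fin d → ℤ),
      ∑' x, ENNReal.ofReal (localOsc a x ^ 2) ≤ ENNReal.ofReal (C * dirForm a) := by
  choose C hC h using fun z : Fin d → ℤ => mem_controlledShifts (-z)
  refine ⟨(nearOffsets d).card * ∑ w ∈ nearOffsets d, C w,
    mul_nonneg (by positivity) (Finset.sum_nonneg fun w _ => hC w), fun a => ?_⟩
  have h1 : ∀ x, ENNReal.ofReal (localOsc a x ^ 2) ≤ (nearOffsets d).card *
      ∑ w ∈ nearOffsets d, ((‖((1 - single (-w) 1) * a).coeff x‖₊ : ℝ≥0∞)) ^ 2 := by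
    intro x
    have h2 : localOsc a x ^ 2 ≤ (nearOffsets d).card *
        ∑ w ∈ nearOffsets d, ‖((1 - single (-w) 1) * a).coeff x‖ ^ 2 := by
      refine sq_sum_le_card_mul_sum_sq.trans (le_of_eq ?_)
      congr 1
      refine Finset.sum_congr rfl fun w _ => ?_
      rw [sub_mul, one_mul, coeff_sub, Finsupp.sub_apply, coeff_single_mul_apply, norm_sub_rev]
      simp [add_comm]
    refine (ENNReal.ofReal_le_ofReal h2).trans (le_of_eq ?_)
    rw [ENNReal.ofReal_mul (by positivity), ENNReal.ofReal_natCast,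
      ENNReal.ofReal_sum_of_nonneg fun _ _ => by positivity]
    congr 1
    refine Finset.sum_congr rfl fun w _ => ?_
    rw [ENNReal.ofReal_pow (norm_nonneg _), ofReal_norm, enorm_eq_nnnorm]
  refine (ENNReal.tsum_le_tsum h1).trans ?_
  rw [ENNReal.tsum_mul_left, Summable.tsum_finsetSum fun _ _ => ENNReal.summable, mul_assoc,
    ENNReal.ofReal_mul (by positivity), ENNReal.ofReal_natCast, Finset.sum_mul,
    ENNReal.ofReal_sum_of_nonneg fun w _ => mul_nonneg (hC w) (dirForm_nonneg a)]
  gcongr with w _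
  rw [tsum_nnnorm_sq_eq_nsq]
  exact ENNReal.ofReal_le_ofReal (h w a)

/-- The one-dimensional hat function. -/
def hat (t : ℝ) : ℝ := max 0 (1 - |t|)

theorem hat_nonneg (t : ℝ) : 0 ≤ hat t := le_max_left _ _

theorem hat_le_one (t : ℝ) : hat t ≤ 1 := max_le zero_le_one (by linarith [abs_nonneg t])

theorem hat_eq_zero {t : ℝ} (h : 1 ≤ |t|) : hat t = 0 := max_eq_left (by linarith)

theorem abs_hat_sub_hat_le (s t : ℝ) : |hat s - hat t| ≤ |s - t| := by
  refine (abs_max_sub_max_le_max 0 (1 - |s|) 0 (1 - |t|)).trans ?_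
  refine max_le (by simp) ?_
  rw [sub_sub_sub_cancel_left, abs_sub_comm s t]
  exact abs_abs_sub_abs_le _ _

theorem sum_hat_sub_eq_one (r : ℝ) (F : Finset ℤ) (h0 : ⌊r⌋ ∈ F) (h1 : ⌊r⌋ + 1 ∈ F) :
    ∑ m ∈ F, hat (r - m) = 1 := by
  have hl := Int.floor_le r
  have hu := Int.lt_floor_add_one r
  rw [← Finset.sum_subset (s₁ := {⌊r⌋, ⌊r⌋ + 1})]
  · rw [Finset.sum_pair (by simp), hat, hat, abs_of_nonneg (by linarith), abs_of_nonpos (by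
      push_cast; linarith), max_eq_right (by linarith), max_eq_right (by push_cast; linarith)]
    push_cast
    ring
  · intro m hm
    rw [Finset.mem_insert, Finset.mem_singleton] at hm
    rcases hm with rfl | rfl <;> assumption
  · intro m _ hm
    rw [Finset.mem_insert, Finset.mem_singleton, not_or] at hm
    refine hat_eq_zero ?_
    rcases lt_or_gt_of_ne hm.1 with h | h
    · have : (m : ℝ) ≤ ⌊r⌋ - 1 := by exact_mod_cast (by omega : m ≤ ⌊r⌋ - 1)
      rw [le_abs]; left; linarith
    · have h' : ⌊r⌋ + 2 ≤ m := by have := hm.2; omega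
      have : (⌊r⌋ : ℝ) + 2 ≤ m := by exact_mod_cast h'
      rw [le_abs]; right; linarith

/-- The tensor product hat function centred at the lattice point `y`. -/
def hatBump (y : Fin d → ℤ) (ξ : EuclideanSpace ℝ (Fin d)) : ℝ := ∏ i, hat (ξ i - y i)

theorem hatBump_nonneg (y : Fin d → ℤ) (ξ : EuclideanSpace ℝ (Fin d)) : 0 ≤ hatBump y ξ :=
  Finset.prod_nonneg fun _ _ => hat_nonneg _

theorem hatBump_le_one (y : Fin d → ℤ) (ξ : EuclideanSpace ℝ (Fin d)) : hatBump y ξ ≤ 1 :=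
  Finset.prod_le_one (fun _ _ => hat_nonneg _) fun _ _ => hat_le_one _

theorem abs_prod_sub_prod_le_sum {ι : Type*} (s : Finset ι) (f g : ι → ℝ)
    (hf : ∀ i, |f i| ≤ 1) (hg : ∀ i, |g i| ≤ 1) :
    |∏ i ∈ s, f i - ∏ i ∈ s, g i| ≤ ∑ i ∈ s, |f i - g i| := by
  classical
  induction s using Finset.induction_on with
  | empty => simp
  | insert i s hi ih =>
    rw [Finset.prod_insert hi, Finset.prod_insert hi, Finset.sum_insert hi]
    have e : f i * ∏ j ∈ s, f j - g i * ∏ j ∈ s, g j =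
        (f i - g i) * ∏ j ∈ s, f j + g i * (∏ j ∈ s, f j - ∏ j ∈ s, g j) := by ring
    have hp : |∏ j ∈ s, f j| ≤ 1 := by
      rw [Finset.abs_prod]
      exact Finset.prod_le_one (fun _ _ => abs_nonneg _) fun j _ => hf j
    rw [e]
    refine (abs_add_le _ _).trans ?_
    rw [abs_mul, abs_mul]
    have h1 := mul_le_of_le_one_right (abs_nonneg (f i - g i)) hp
    have h2 := mul_le_of_le_one_left (abs_nonneg (∏ j ∈ s, f j - ∏ j ∈ s, g j)) (hg i)
    linarith

theorem abs_hatBump_sub_le (y : Fin d → ℤ) (ξ η : EuclideanSpace ℝ (Fin d)) :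
    |hatBump y ξ - hatBump y η| ≤ d * ‖ξ - η‖ := by
  refine (abs_prod_sub_prod_le_sum Finset.univ _ _ (fun i => ?_) fun i => ?_).trans ?_
  · rw [abs_of_nonneg (hat_nonneg _)]; exact hat_le_one _
  · rw [abs_of_nonneg (hat_nonneg _)]; exact hat_le_one _
  · calc _ ≤ ∑ i : Fin d, ‖ξ - η‖ := by
          refine Finset.sum_le_sum fun i _ => (abs_hat_sub_hat_le _ _).trans ?_
          rw [sub_sub_sub_cancel_right]
          exact PiLp.norm_apply_le (ξ - η) i
      _ = _ := by simp

theorem hatBump_eq_zero {y : Fin d → ℤ} {ξ : EuclideanSpace ℝ (Fin d)} (i : Fin d)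
    (h : 1 ≤ |ξ i - y i|) : hatBump y ξ = 0 :=
  Finset.prod_eq_zero (Finset.mem_univ i) (hat_eq_zero h)

/-- The componentwise floor. -/
def latFloor (ξ : EuclideanSpace ℝ (Fin d)) : Fin d → ℤ := fun i => ⌊ξ i⌋

/-- The multilinear interpolation of a finitely supported lattice function. -/
def interp (a : AddMonoidAlgebra ℂ (Fin d → ℤ)) (ξ : EuclideanSpace ℝ (Fin d)) : ℂ :=
  ∑ y ∈ a.coeff.support, (hatBump y ξ : ℂ) * a.coeff y

theorem interp_eq (a : AddMonoidAlgebra ℂ (Fin d → ℤ)) {ξ η : EuclideanSpace ℝ (Fin d)}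
    (h : ‖η - ξ‖ < 1) :
    interp a η = a.coeff (latFloor ξ) + ∑ w ∈ nearOffsets d,
      (hatBump (latFloor ξ + w) η : ℂ) * (a.coeff (latFloor ξ + w) - a.coeff (latFloor ξ)) := by
  classical
  set x := latFloor ξ with hx
  have hη : ∀ i, -1 < η i - x i ∧ η i - x i < 2 := by
    intro i
    have h1 : |η i - ξ i| < 1 := lt_of_le_of_lt (PiLp.norm_apply_le (η - ξ) i) h
    have h2 := Int.floor_le (ξ i)
    have h3 := Int.lt_floor_add_one (ξ i)
    rw [abs_lt] at h1
    have h4 : (x i : ℝ) = ⌊ξ i⌋ := rfl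
    constructor <;> linarith
  have hone : ∑ w ∈ nearOffsets d, hatBump (x + w) η = 1 := by
    have h1 : ∀ w : Fin d → ℤ, hatBump (x + w) η = ∏ i, hat (η i - x i - w i) := by
      intro w
      refine Finset.prod_congr rfl fun i _ => ?_
      rw [Pi.add_apply]; push_cast; congr 1; ring
    simp_rw [h1]
    rw [nearOffsets, ← Finset.prod_univ_sum (fun _ : Fin d => Finset.Icc (-1 : ℤ) 2)
      (fun i m => hat (η i - x i - m))]
    refine Finset.prod_eq_one fun i _ => sum_hat_sub_eq_one _ _ ?_ ?_
    · have h2 : -1 ≤ ⌊η i - x i⌋ := Int.le_floor.2 (by push_cast; linarith [(hη i).1])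
      have h3 : ⌊η i - x i⌋ < 2 := Int.floor_lt.2 (by push_cast; linarith [(hη i).2])
      rw [Finset.mem_Icc]; omega
    · have h2 : -1 ≤ ⌊η i - x i⌋ := Int.le_floor.2 (by push_cast; linarith [(hη i).1])
      have h3 : ⌊η i - x i⌋ < 2 := Int.floor_lt.2 (by push_cast; linarith [(hη i).2])
      rw [Finset.mem_Icc]; omega
  have hsum : interp a η = ∑ w ∈ nearOffsets d, (hatBump (x + w) η : ℂ) * a.coeff (x + w) := by
    have h1 : ∑ w ∈ nearOffsets d, (hatBump (x + w) η : ℂ) * a.coeff (x + w) =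
        ∑ y ∈ (nearOffsets d).image (x + ·), (hatBump y η : ℂ) * a.coeff y :=
      (Finset.sum_image (f := fun y => (hatBump y η : ℂ) * a.coeff y) (g := (x + ·))
        fun _ _ _ _ h => add_left_cancel h).symm
    rw [h1, interp]
    rw [Finset.sum_subset (Finset.subset_union_left
        (s₁ := a.coeff.support) (s₂ := (nearOffsets d).image (x + ·))),
      Finset.sum_subset (Finset.subset_union_right
        (s₁ := a.coeff.support) (s₂ := (nearOffsets d).image (x + ·)))]
    · intro y _ hy
      have : ∃ i, y i - x i ∉ Finset.Icc (-1 : ℤ) 2 := by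
        by_contra! hc
        refine hy (Finset.mem_image.2 ⟨y - x, Fintype.mem_piFinset.2 hc, ?_⟩)
        simp
      obtain ⟨i, hi⟩ := this
      rw [hatBump_eq_zero i, Complex.ofReal_zero, zero_mul]
      have := hη i
      rw [Finset.mem_Icc, not_and_or, not_le, not_le] at hi
      rcases hi with hi | hi
      · have : (y i : ℝ) - x i ≤ -2 := by exact_mod_cast (by omega : y i - x i ≤ -2)
        rw [le_abs]; left; linarith
      · have : (3 : ℝ) ≤ (y i : ℝ) - x i := by exact_mod_cast (by omega : 3 ≤ y i - x i)
        rw [le_abs]; right; linarith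
    · intro y _ hy
      rw [Finsupp.notMem_support_iff.1 hy, mul_zero]
  have hone' : ∑ w ∈ nearOffsets d, (hatBump (x + w) η : ℂ) = 1 := by exact_mod_cast hone
  rw [hsum]
  simp_rw [mul_sub]
  rw [Finset.sum_sub_distrib, ← Finset.sum_mul, hone', one_mul]
  ring

theorem norm_interp_sub_le (a : AddMonoidAlgebra ℂ (Fin d → ℤ)) (ξ : EuclideanSpace ℝ (Fin d)) :
    ‖interp a ξ - a.coeff (latFloor ξ)‖ ≤ localOsc a (latFloor ξ) := by
  rw [interp_eq a (ξ := ξ) (η := ξ) (by simp), add_sub_cancel_left]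
  refine (norm_sum_le _ _).trans (Finset.sum_le_sum fun w _ => ?_)
  rw [norm_mul, Complex.norm_real, Real.norm_of_nonneg (hatBump_nonneg _ _)]
  exact mul_le_of_le_one_left (norm_nonneg _) (hatBump_le_one _ _)

theorem norm_fderiv_interp_le (a : AddMonoidAlgebra ℂ (Fin d → ℤ))
    (ξ : EuclideanSpace ℝ (Fin d)) :
    ‖fderiv ℝ (interp a) ξ‖ ≤ d * localOsc a (latFloor ξ) := by
  have h0 : 0 ≤ d * localOsc a (latFloor ξ) := mul_nonneg (by positivity) (localOsc_nonneg _ _)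
  refine norm_fderiv_le_of_lip' ℝ h0 ?_
  filter_upwards [Metric.ball_mem_nhds ξ one_pos] with η hη
  rw [interp_eq a (mem_ball_iff_norm.1 hη), interp_eq a (ξ := ξ) (η := ξ) (by simp),
    add_sub_add_left_eq_sub, ← Finset.sum_sub_distrib, localOsc, Finset.mul_sum, Finset.sum_mul]
  refine (norm_sum_le _ _).trans (Finset.sum_le_sum fun w _ => ?_)
  rw [← sub_mul, norm_mul, ← Complex.ofReal_sub, Complex.norm_real, Real.norm_eq_abs]
  have := mul_le_mul_of_nonneg_right (abs_hatBump_sub_le (latFloor ξ + w) η ξ)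
    (norm_nonneg (a.coeff (latFloor ξ + w) - a.coeff (latFloor ξ)))
  linarith

theorem exists_lipschitzWith_interp (a : AddMonoidAlgebra ℂ (Fin d → ℤ)) :
    ∃ K : ℝ≥0, LipschitzWith K (interp a) := by
  refine ⟨∑ y ∈ a.coeff.support, d * ‖a.coeff y‖₊, LipschitzWith.of_dist_le_mul fun ξ η => ?_⟩
  rw [dist_eq_norm, dist_eq_norm, interp, interp, ← Finset.sum_sub_distrib]
  push_cast
  rw [Finset.sum_mul]
  refine (norm_sum_le _ _).trans (Finset.sum_le_sum fun y _ => ?_)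
  rw [← sub_mul, norm_mul, ← Complex.ofReal_sub, Complex.norm_real, Real.norm_eq_abs]
  have := mul_le_mul_of_nonneg_right (abs_hatBump_sub_le y ξ η) (norm_nonneg (a.coeff y))
  linarith

theorem hasCompactSupport_interp (a : AddMonoidAlgebra ℂ (Fin d → ℤ)) :
    HasCompactSupport (interp a) := by
  refine HasCompactSupport.intro (K := ⋃ y ∈ a.coeff.support,
    (EuclideanSpace.equiv (Fin d) ℝ).toHomeomorph ⁻¹'
      (Set.univ.pi fun i => Set.Icc ((y i : ℝ) - 1) (y i + 1))) ?_ fun ξ hξ => ?_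
  · refine a.coeff.support.finite_toSet.isCompact_biUnion fun y _ => ?_
    rw [Homeomorph.isCompact_preimage]
    exact isCompact_univ_pi fun _ => isCompact_Icc
  · refine Finset.sum_eq_zero fun y hy => ?_
    have h1 : ∃ i, ξ i ∉ Set.Icc ((y i : ℝ) - 1) (y i + 1) := by
      by_contra! hc
      exact hξ (Set.mem_biUnion hy fun i _ => hc i)
    obtain ⟨i, hi⟩ := h1
    rw [hatBump_eq_zero i, Complex.ofReal_zero, zero_mul]
    rw [Set.mem_Icc, not_and_or, not_le, not_le] at hi
    rw [le_abs]
    rcases hi with hi | hi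
    · right; linarith
    · left; linarith

end Interpolation

section Hardy

variable {d : ℕ}

theorem measurable_latFloor : Measurable (latFloor (d := d)) := by
  refine measurable_pi_iff.2 fun i => Int.measurable_floor.comp ?_
  exact (PiLp.continuous_apply 2 (fun _ : Fin d => ℝ) i).measurable

theorem volume_latFloor_preimage (x : Fin d → ℤ) :
    volume (latFloor (d := d) ⁻¹' {x}) = 1 := by
  have h : latFloor (d := d) ⁻¹' {x} =
      WithLp.ofLp ⁻¹' (Set.univ.pi fun i => Set.Ico ((x i : ℤ) : ℝ) (x i + 1)) := by
    ext ξ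
    simp [latFloor, funext_iff, Int.floor_eq_iff]
  rw [h, (PiLp.volume_preserving_ofLp (Fin d)).measure_preimage
    (MeasurableSet.univ_pi fun _ => measurableSet_Ico).nullMeasurableSet, Real.volume_pi_Ico]
  simp

theorem lintegral_comp_latFloor (f : (Fin d → ℤ) → ℝ≥0∞) :
    ∫⁻ ξ, f (latFloor ξ) = ∑' x, f x := by
  rw [← lintegral_map (measurable_of_countable f) measurable_latFloor, lintegral_countable']
  refine tsum_congr fun x => ?_
  rw [Measure.map_apply measurable_latFloor (measurableSet_singleton x),
    volume_latFloor_preimage, mul_one]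

/-- `W` generates a normalized Hardy weight on `ℝ^d`. -/
def IsHardyWeight (W : (Fin d → ℤ) → ℝ) : Prop :=
  ∀ U : EuclideanSpace ℝ (Fin d) → ℂ,
    (∃ K : ℝ≥0, LipschitzWith K U) → HasCompactSupport U →
    (∫⁻ ξ : EuclideanSpace ℝ (Fin d),
        ENNReal.ofReal (W fun i => ⌊ξ i⌋) * ((‖U ξ‖₊ : ℝ≥0∞)) ^ 2) ≤
      ∫⁻ ξ : EuclideanSpace ℝ (Fin d), ((‖fderiv ℝ U ξ‖₊ : ℝ≥0∞)) ^ 2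

theorem IsHardyWeight.ofReal_le {W : (Fin d → ℤ) → ℝ} (hW : IsHardyWeight W) (x : Fin d → ℤ) :
    ENNReal.ofReal (W x) ≤
      volume (Metric.closedBall (0 : EuclideanSpace ℝ (Fin d)) (d + 1)) := by
  classical
  set c : EuclideanSpace ℝ (Fin d) := WithLp.toLp 2 fun i => (x i : ℝ) with hc
  set U : EuclideanSpace ℝ (Fin d) → ℂ := fun ξ => ((max 0 (d + 1 - dist ξ c) : ℝ) : ℂ) with hU
  have hlip : LipschitzWith 1 U := by
    refine LipschitzWith.of_dist_le_mul fun ξ η => ?_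
    rw [hU, dist_eq_norm, ← Complex.ofReal_sub, Complex.norm_real, Real.norm_eq_abs,
      NNReal.coe_one, one_mul]
    refine (abs_max_sub_max_le_max _ _ _ _).trans (max_le (by simp) ?_)
    rw [sub_sub_sub_cancel_left, abs_sub_comm]
    exact abs_dist_sub_le _ _ _
  have hz : ∀ ξ, ξ ∉ Metric.closedBall c (d + 1) → U ξ = 0 := by
    intro ξ hξ
    rw [Metric.mem_closedBall, not_le] at hξ
    simp only [hU]
    rw [max_eq_left (by linarith), Complex.ofReal_zero]
  have hcs : HasCompactSupport U := HasCompactSupport.intro (isCompact_closedBall c (d + 1)) hz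
  have hts : tsupport U ⊆ Metric.closedBall c (d + 1) :=
    closure_minimal (fun ξ hξ => by_contra fun h => hξ (hz ξ h)) Metric.isClosed_closedBall
  have hone : ∀ ξ, latFloor ξ = x → (1 : ℝ≥0∞) ≤ (‖U ξ‖₊ : ℝ≥0∞) ^ 2 := by
    intro ξ hξ
    refine one_le_pow₀ ?_
    have h1 : dist ξ c ≤ d := by
      rw [EuclideanSpace.dist_eq]
      refine (Real.sqrt_le_left (by positivity)).2 ?_
      calc ∑ i, dist (ξ i) (c i) ^ 2 ≤ ∑ i : Fin d, (1 : ℝ) := by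
            refine Finset.sum_le_sum fun i _ => ?_
            have h2 := Int.floor_le (ξ i)
            have h3 := Int.lt_floor_add_one (ξ i)
            have h4 : (x i : ℝ) = ⌊ξ i⌋ := by rw [← hξ]; rfl
            rw [Real.dist_eq, sq_abs]
            have h5 : c i = ⌊ξ i⌋ := h4
            rw [h5]
            nlinarith
        _ ≤ (d : ℝ) ^ 2 := by
            simp only [Finset.sum_const, Finset.card_univ, Fintype.card_fin, nsmul_eq_mul, mul_one]
            exact_mod_cast Nat.le_self_pow two_ne_zero d
    have h2 : (1 : ℝ) ≤ ‖U ξ‖ := by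
      simp only [hU]
      rw [Complex.norm_real, Real.norm_of_nonneg (le_max_left _ _)]
      exact le_max_of_le_right (by linarith)
    exact_mod_cast h2
  calc ENNReal.ofReal (W x) = ∑' y, if y = x then ENNReal.ofReal (W x) else 0 := by
        rw [tsum_ite_eq]
    _ = ∫⁻ ξ : EuclideanSpace ℝ (Fin d), if latFloor ξ = x then ENNReal.ofReal (W x) else 0 :=
        (lintegral_comp_latFloor fun y => if y = x then ENNReal.ofReal (W x) else 0).symm
    _ ≤ ∫⁻ ξ : EuclideanSpace ℝ (Fin d),
        ENNReal.ofReal (W fun i => ⌊ξ i⌋) * ((‖U ξ‖₊ : ℝ≥0∞)) ^ 2 := by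
        refine lintegral_mono fun ξ => ?_
        dsimp only
        split_ifs with h
        · change _ ≤ ENNReal.ofReal (W (latFloor ξ)) * _
          rw [h]
          exact le_mul_of_one_le_right' (hone ξ h)
        · exact zero_le
    _ ≤ ∫⁻ ξ : EuclideanSpace ℝ (Fin d), ((‖fderiv ℝ U ξ‖₊ : ℝ≥0∞)) ^ 2 := hW U ⟨1, hlip⟩ hcs
    _ ≤ ∫⁻ ξ : EuclideanSpace ℝ (Fin d),
        (Metric.closedBall c (d + 1)).indicator (fun _ => (1 : ℝ≥0∞)) ξ := by
        refine lintegral_mono fun ξ => ?_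
        by_cases h : ξ ∈ Metric.closedBall c (d + 1)
        · rw [Set.indicator_of_mem h]
          refine pow_le_one₀ zero_le ?_
          rw [← enorm_eq_nnnorm, ← ofReal_norm, ENNReal.ofReal_le_one]
          exact norm_fderiv_le_of_lipschitz ℝ hlip
        · have : fderiv ℝ U ξ = 0 := by
            by_contra h0
            exact h (hts (support_fderiv_subset ℝ h0))
          simp [this]
    _ = volume (Metric.closedBall c (d + 1)) := by
        rw [lintegral_indicator Metric.isClosed_closedBall.measurableSet, setLIntegral_const,
          one_mul]
    _ = _ := Measure.addHaar_closedBall_center _ _ _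

theorem exists_sum_hardy_le (d : ℕ) : ∃ H : ℝ, 0 < H ∧ ∀ W : (Fin d → ℤ) → ℝ,
    (∀ x, 0 < W x) → IsHardyWeight W → ∀ (a : AddMonoidAlgebra ℂ (Fin d → ℤ))
      (S : Finset (Fin d → ℤ)), ∑ x ∈ S, W x * ‖a.coeff x‖ ^ 2 ≤ H * dirForm a := by
  obtain ⟨C, hC, hosc⟩ := exists_tsum_localOsc_sq_le d
  set B : ℝ := (volume (Metric.closedBall (0 : EuclideanSpace ℝ (Fin d)) (d + 1))).toReal with hB
  have hB0 : 0 ≤ B := ENNReal.toReal_nonneg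
  have hBtop : volume (Metric.closedBall (0 : EuclideanSpace ℝ (Fin d)) (d + 1)) ≠ ∞ :=
    measure_closedBall_lt_top.ne
  refine ⟨(2 * d ^ 2 + 2 * B) * C + 1, by positivity, fun W hW0 hW a S => ?_⟩
  have hWB : ∀ x, W x ≤ B := fun x =>
    (ENNReal.ofReal_le_iff_le_toReal hBtop).1 (hW.ofReal_le x)
  have hpt : ∀ ξ : EuclideanSpace ℝ (Fin d),
      ENNReal.ofReal (W (latFloor ξ) * ‖a.coeff (latFloor ξ)‖ ^ 2) ≤
        2 * (ENNReal.ofReal (W (latFloor ξ)) * ((‖interp a ξ‖₊ : ℝ≥0∞)) ^ 2) +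
          ENNReal.ofReal (2 * B * localOsc a (latFloor ξ) ^ 2) := by
    intro ξ
    have h1 := norm_interp_sub_le a ξ
    have h2 : ‖a.coeff (latFloor ξ)‖ ≤ ‖interp a ξ‖ + localOsc a (latFloor ξ) := by
      have := norm_sub_norm_le (a.coeff (latFloor ξ)) (interp a ξ)
      rw [norm_sub_rev] at this
      linarith
    have h3 : W (latFloor ξ) * ‖a.coeff (latFloor ξ)‖ ^ 2 ≤
        2 * (W (latFloor ξ) * ‖interp a ξ‖ ^ 2) + 2 * B * localOsc a (latFloor ξ) ^ 2 := by
      have h4 : ‖a.coeff (latFloor ξ)‖ ^ 2 ≤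
          2 * ‖interp a ξ‖ ^ 2 + 2 * localOsc a (latFloor ξ) ^ 2 := by
        have := pow_le_pow_left₀ (norm_nonneg _) h2 2
        nlinarith [sq_nonneg (‖interp a ξ‖ - localOsc a (latFloor ξ))]
      have h5 := mul_le_mul_of_nonneg_left h4 (hW0 (latFloor ξ)).le
      have h6 := mul_le_mul_of_nonneg_right (hWB (latFloor ξ))
        (sq_nonneg (localOsc a (latFloor ξ)))
      linarith
    refine (ENNReal.ofReal_le_ofReal h3).trans (le_of_eq ?_)
    have hw := (hW0 (latFloor ξ)).le
    rw [ENNReal.ofReal_add (by positivity) (by positivity), ENNReal.ofReal_mul (by positivity),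
      ENNReal.ofReal_mul hw, ENNReal.ofReal_pow (norm_nonneg _), ofReal_norm, enorm_eq_nnnorm,
      ENNReal.ofReal_ofNat]
  have hmeas : Measurable fun ξ : EuclideanSpace ℝ (Fin d) =>
      ENNReal.ofReal (2 * B * localOsc a (latFloor ξ) ^ 2) :=
    (measurable_of_countable fun x => ENNReal.ofReal (2 * B * localOsc a x ^ 2)).comp
      measurable_latFloor
  have hgrad : ∫⁻ ξ : EuclideanSpace ℝ (Fin d), ((‖fderiv ℝ (interp a) ξ‖₊ : ℝ≥0∞)) ^ 2 ≤
      ∑' x, ENNReal.ofReal (d ^ 2 * localOsc a x ^ 2) := by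
    rw [← lintegral_comp_latFloor fun x => ENNReal.ofReal (d ^ 2 * localOsc a x ^ 2)]
    refine lintegral_mono fun ξ => ?_
    dsimp only
    rw [← enorm_eq_nnnorm, ← ofReal_norm, ← ENNReal.ofReal_pow (norm_nonneg _), ← mul_pow]
    exact ENNReal.ofReal_le_ofReal
      (pow_le_pow_left₀ (norm_nonneg _) (norm_fderiv_interp_le a ξ) 2)
  have hfin : ENNReal.ofReal (∑ x ∈ S, W x * ‖a.coeff x‖ ^ 2) ≤
      ENNReal.ofReal ((2 * d ^ 2 + 2 * B) * (C * dirForm a)) := by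
    calc ENNReal.ofReal (∑ x ∈ S, W x * ‖a.coeff x‖ ^ 2)
        = ∑ x ∈ S, ENNReal.ofReal (W x * ‖a.coeff x‖ ^ 2) :=
          ENNReal.ofReal_sum_of_nonneg fun x _ => mul_nonneg (hW0 x).le (sq_nonneg _)
      _ ≤ ∑' x, ENNReal.ofReal (W x * ‖a.coeff x‖ ^ 2) := ENNReal.sum_le_tsum S
      _ = ∫⁻ ξ : EuclideanSpace ℝ (Fin d),
          ENNReal.ofReal (W (latFloor ξ) * ‖a.coeff (latFloor ξ)‖ ^ 2) :=
          (lintegral_comp_latFloor fun x => ENNReal.ofReal (W x * ‖a.coeff x‖ ^ 2)).symm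
      _ ≤ ∫⁻ ξ : EuclideanSpace ℝ (Fin d),
          (2 * (ENNReal.ofReal (W (latFloor ξ)) * ((‖interp a ξ‖₊ : ℝ≥0∞)) ^ 2) +
            ENNReal.ofReal (2 * B * localOsc a (latFloor ξ) ^ 2)) := lintegral_mono hpt
      _ = 2 * (∫⁻ ξ : EuclideanSpace ℝ (Fin d),
            ENNReal.ofReal (W (latFloor ξ)) * ((‖interp a ξ‖₊ : ℝ≥0∞)) ^ 2) +
          ∑' x, ENNReal.ofReal (2 * B * localOsc a x ^ 2) := by
          rw [lintegral_add_right _ hmeas, lintegral_const_mul' _ _ (by simp),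
            lintegral_comp_latFloor fun x => ENNReal.ofReal (2 * B * localOsc a x ^ 2)]
      _ ≤ 2 * (∑' x, ENNReal.ofReal (d ^ 2 * localOsc a x ^ 2)) +
          ∑' x, ENNReal.ofReal (2 * B * localOsc a x ^ 2) := by
          gcongr
          exact (hW _ (exists_lipschitzWith_interp a) (hasCompactSupport_interp a)).trans hgrad
      _ = ENNReal.ofReal (2 * d ^ 2 + 2 * B) * ∑' x, ENNReal.ofReal (localOsc a x ^ 2) := by
          simp_rw [ENNReal.ofReal_mul (show (0 : ℝ) ≤ 2 * B by positivity),
            ENNReal.ofReal_mul (show (0 : ℝ) ≤ (d : ℝ) ^ 2 by positivity), ENNReal.tsum_mul_left]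
          rw [ENNReal.ofReal_add (by positivity) (by positivity), add_mul,
            ENNReal.ofReal_mul zero_le_two, ENNReal.ofReal_mul zero_le_two,
            ENNReal.ofReal_ofNat, mul_assoc, mul_assoc]
      _ ≤ ENNReal.ofReal (2 * d ^ 2 + 2 * B) * ENNReal.ofReal (C * dirForm a) := by
          gcongr
          exact hosc a
      _ = _ := (ENNReal.ofReal_mul (by positivity)).symm
  have hd0 := dirForm_nonneg a
  have := (ENNReal.ofReal_le_ofReal_iff (by positivity)).1 hfin
  linarith

end Hardy

section Counting

variable {d : ℕ}

/-- The coefficient function of an element of the group algebra, as a linear map. -/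
def coeffFun (d : ℕ) : AddMonoidAlgebra ℂ (Fin d → ℤ) →ₗ[ℂ] ((Fin d → ℤ) → ℂ) where
  toFun a := fun x => a.coeff x
  map_add' a b := by ext x; simp
  map_smul' c a := by ext x; simp

theorem coeffFun_injective : Function.Injective (coeffFun d) := by
  intro a b h
  refine AddMonoidAlgebra.ext (Finsupp.ext fun x => ?_)
  exact congrFun h x

theorem mem_range_coeffFun {u : (Fin d → ℤ) → ℂ} (hu : (Function.support u).Finite) :
    u ∈ LinearMap.range (coeffFun d) :=
  ⟨AddMonoidAlgebra.ofCoeff (Finsupp.ofSupportFinite u hu), rfl⟩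

/-- The dimension-dependent constant in the discrete Cwikel–Lieb–Rozenblum bound. -/
def clrConst (d : ℕ) : ℝ := (16 * 8 ^ (1 / (((d : ℝ) - 2) / 2))) ^ ((d : ℝ) / 2 - 1)

theorem clrConst_nonneg (d : ℕ) : 0 ≤ clrConst d := by
  unfold clrConst; positivity

theorem finrank_le_tsum (hd : 3 ≤ d) {H : ℝ} (hH : 0 < H) {V W : (Fin d → ℤ) → ℝ}
    (hV : ∀ x, 0 ≤ V x) (hW0 : ∀ x, 0 < W x)
    (hW : ∀ (a : AddMonoidAlgebra ℂ (Fin d → ℤ)) (S : Finset (Fin d → ℤ)),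
      ∑ x ∈ S, W x * ‖a.coeff x‖ ^ 2 ≤ H * dirForm a)
    {s : ℝ} (hs : 0 < s) (L : Submodule ℂ ((Fin d → ℤ) → ℂ))
    (hfin : ∀ u ∈ L, (Function.support u).Finite) [FiniteDimensional ℂ L]
    (hadm : ∀ u ∈ L, u ≠ 0 → ENNReal.ofReal s * Q0 u < bV V u) :
    (Module.finrank ℂ L : ℝ≥0∞) ≤ ENNReal.ofReal (clrConst d * (2 / s) ^ ((d : ℝ) / 2)) *
      ∑' x, {x | s / (2 * H) * W x < V x}.indicator
        (fun x => ENNReal.ofReal (V x ^ ((d : ℝ) / 2))) x := by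
  classical
  have hmap : (L.comap (coeffFun d)).map (coeffFun d) = L :=
    Submodule.map_comap_eq_of_le fun u hu => mem_range_coeffFun (hfin u hu)
  have e := Submodule.equivMapOfInjective (coeffFun d) coeffFun_injective (L.comap (coeffFun d))
  rw [hmap] at e
  have hfd : FiniteDimensional ℂ (L.comap (coeffFun d)) := Module.Finite.equiv e.symm
  obtain ⟨u, huL, hu⟩ := exists_orthonormal_dirForm hd (L.comap (coeffFun d))
  rw [← e.finrank_eq]
  set S : Finset (Fin d → ℤ) := Finset.univ.biUnion fun i => (u i).coeff.support with hS
  have hb : ∀ i, bV V (coeffFun d (u i)) =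
      ENNReal.ofReal (∑ x ∈ S, V x * ‖(u i).coeff x‖ ^ 2) := by
    intro i
    rw [bV, tsum_eq_sum (s := S), ENNReal.ofReal_sum_of_nonneg fun x _ =>
      mul_nonneg (hV x) (sq_nonneg _)]
    · refine Finset.sum_congr rfl fun x _ => ?_
      rw [ENNReal.ofReal_mul (hV x), ENNReal.ofReal_pow (norm_nonneg _), ofReal_norm,
        enorm_eq_nnnorm]
      rfl
    · intro x hx
      have : (u i).coeff x = 0 := by
        by_contra h
        exact hx (Finset.mem_biUnion.2 ⟨i, Finset.mem_univ i, Finsupp.mem_support_iff.2 h⟩)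
      simp [coeffFun, this]
  have hsV : ∀ i, s ≤ ∑ x ∈ S, V x * ‖(u i).coeff x‖ ^ 2 := by
    intro i
    have h1 := dirForm_eq_one hu i
    have hne : coeffFun d (u i) ≠ 0 := by
      intro h
      rw [map_eq_zero_iff _ coeffFun_injective] at h
      rw [h] at h1
      simp [dirForm, nsq] at h1
    have h2 := hadm _ (huL i) hne
    have h3 : Q0 (coeffFun d (u i)) = ENNReal.ofReal (dirForm (u i)) := Q0_eq (u i)
    rw [hb, h3, h1, ENNReal.ofReal_one, mul_one] at h2
    exact ((ENNReal.ofReal_lt_ofReal_iff_of_nonneg hs.le).1 h2).le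
  have h := card_le_of_orthonormal hd hu S hs hH hV (fun x => (hW0 x).le)
    (fun i => by simpa [dirForm_eq_one hu i] using hW (u i) S) hsV
  calc (Module.finrank ℂ (L.comap (coeffFun d)) : ℝ≥0∞)
      = ENNReal.ofReal (Module.finrank ℂ (L.comap (coeffFun d)) : ℝ) :=
        (ENNReal.ofReal_natCast _).symm
    _ ≤ _ := ENNReal.ofReal_le_ofReal h
    _ = ENNReal.ofReal (clrConst d * (2 / s) ^ ((d : ℝ) / 2)) *
        ∑ x ∈ S with s / (2 * H) * W x < V x, ENNReal.ofReal (V x ^ ((d : ℝ) / 2)) := by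
        rw [← clrConst, ENNReal.ofReal_mul (mul_nonneg (clrConst_nonneg d) (by positivity)),
          ENNReal.ofReal_sum_of_nonneg fun x _ => Real.rpow_nonneg (hV x) _]
    _ ≤ _ := by
        gcongr
        refine le_trans (le_of_eq (Finset.sum_congr rfl fun x hx => ?_)) (ENNReal.sum_le_tsum _)
        have hx' : x ∈ {x | s / (2 * H) * W x < V x} := (Finset.mem_filter.1 hx).2
        rw [Set.indicator_of_mem hx']

/-- The weighted distribution function of `V / W`. -/
def distMass (p : ℝ) (V W : (Fin d → ℤ) → ℝ) (t : ℝ) : ℝ≥0∞ :=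
  ∑' x : {x : Fin d → ℤ // t * W x < V x}, ENNReal.ofReal (W x.1 ^ p)

theorem distMass_eq (p : ℝ) (V W : (Fin d → ℤ) → ℝ) (t : ℝ) :
    distMass p V W t =
      ∑' x, {x | t * W x < V x}.indicator (fun x => ENNReal.ofReal (W x ^ p)) x :=
  tsum_subtype {x | t * W x < V x} fun x => ENNReal.ofReal (W x ^ p)

theorem distMass_anti (p : ℝ) {V W : (Fin d → ℤ) → ℝ} (hW0 : ∀ x, 0 < W x) {t t' : ℝ}
    (h : t ≤ t') : distMass p V W t' ≤ distMass p V W t := by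
  rw [distMass_eq, distMass_eq]
  refine ENNReal.tsum_le_tsum fun x =>
    Set.indicator_le_indicator_of_subset (fun y hy => ?_) (fun _ => zero_le) x
  exact (mul_le_mul_of_nonneg_right h (hW0 y).le).trans_lt hy

theorem tsum_indicator_rpow_le {p : ℝ} (hp : 0 < p) {V W : (Fin d → ℤ) → ℝ}
    (hV : ∀ x, 0 ≤ V x) (hW0 : ∀ x, 0 < W x) {τ : ℝ} (hτ : 0 < τ) :
    ∑' x, {x | τ * W x < V x}.indicator (fun x => ENNReal.ofReal (V x ^ p)) x ≤
      ∑' k : ℕ, ENNReal.ofReal ((τ * 2 ^ (k + 1)) ^ p) * distMass p V W (τ * 2 ^ k) := by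
  simp_rw [distMass_eq, ← ENNReal.tsum_mul_left]
  rw [ENNReal.tsum_comm]
  refine ENNReal.tsum_le_tsum fun x => ?_
  by_cases hx : τ * W x < V x
  swap
  · rw [Set.indicator_of_notMem (show x ∉ {x | τ * W x < V x} from hx)]; exact zero_le
  rw [Set.indicator_of_mem (show x ∈ {x | τ * W x < V x} from hx)]
  have hτW : 0 < τ * W x := mul_pos hτ (hW0 x)
  obtain ⟨k, hk, hk'⟩ : ∃ k : ℕ, τ * 2 ^ k * W x < V x ∧ V x ≤ τ * 2 ^ (k + 1) * W x := by
    classical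
    have hex : ∃ k : ℕ, V x ≤ τ * 2 ^ (k + 1) * W x := by
      obtain ⟨n, hn⟩ := pow_unbounded_of_one_lt (V x / (τ * W x)) one_lt_two
      refine ⟨n, ?_⟩
      rw [div_lt_iff₀ hτW] at hn
      have : (2 : ℝ) ^ n ≤ 2 ^ (n + 1) := pow_le_pow_right₀ one_le_two n.le_succ
      nlinarith
    refine ⟨Nat.find hex, ?_, Nat.find_spec hex⟩
    rcases Nat.eq_zero_or_pos (Nat.find hex) with h0 | h0
    · rw [h0]; simpa using hx
    · have := Nat.find_min hex (Nat.sub_lt h0 one_pos)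
      rwa [Nat.sub_add_cancel (n := Nat.find hex) (m := 1) h0, not_le] at this
  refine le_trans ?_ (ENNReal.le_tsum k)
  rw [Set.indicator_of_mem (show x ∈ {x | τ * 2 ^ k * W x < V x} from hk),
    ← ENNReal.ofReal_mul (by positivity), ← Real.mul_rpow (by positivity) (hW0 x).le]
  exact ENNReal.ofReal_le_ofReal (Real.rpow_le_rpow (hV x) hk' hp.le)

/-- The weak-type profile `t^q · Σ_{V > t W} W^{d/2}`. -/
def weakProfile (q : ℝ) (V W : (Fin d → ℤ) → ℝ) (t : ℝ) : ℝ≥0∞ :=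
  ENNReal.ofReal (t ^ q) * distMass ((d : ℝ) / 2) V W t

theorem rpow_identity {p q s τ c : ℝ} (hs : 0 < s) (hc : 0 < c) (hτ : τ = s / c) (k : ℕ) :
    (2 / s) ^ p * (τ * 2 ^ (k + 1)) ^ p =
      4 ^ p * c ^ (q - p) * s ^ (-q) * ((2 : ℝ) ^ (p - q)) ^ k * (τ * 2 ^ k) ^ q := by
  have h2 : (0 : ℝ) < 2 := two_pos
  rw [hτ, ← Real.rpow_natCast (2 ^ (p - q)), ← Real.rpow_natCast, ← Real.rpow_natCast,
    Real.mul_rpow (by positivity) (by positivity), Real.mul_rpow (by positivity) (by positivity),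
    Real.div_rpow h2.le hs.le, Real.div_rpow hs.le hc.le, Real.div_rpow hs.le hc.le,
    ← Real.rpow_mul h2.le, ← Real.rpow_mul h2.le, ← Real.rpow_mul h2.le,
    Real.rpow_neg hs.le, Real.rpow_sub hc, show (4 : ℝ) = 2 * 2 by norm_num,
    Real.mul_rpow h2.le h2.le]
  have e1 : (2 : ℝ) ^ (((k + 1 : ℕ) : ℝ) * p) = 2 ^ p * 2 ^ ((k : ℝ) * p) := by
    rw [← Real.rpow_add h2]; congr 1; push_cast; ring
  have e2 : (2 : ℝ) ^ ((p - q) * k) * 2 ^ ((k : ℝ) * q) = 2 ^ ((k : ℝ) * p) := by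
    rw [← Real.rpow_add h2]; congr 1; ring
  have hsp : s ^ p ≠ 0 := (Real.rpow_pos_of_pos hs p).ne'
  have hsq : s ^ q ≠ 0 := (Real.rpow_pos_of_pos hs q).ne'
  have hcp : c ^ p ≠ 0 := (Real.rpow_pos_of_pos hc p).ne'
  have hcq : c ^ q ≠ 0 := (Real.rpow_pos_of_pos hc q).ne'
  rw [e1, ← e2]
  field_simp

theorem nCount_le_tsum_weakProfile (hd : 3 ≤ d) (q : ℝ) {H : ℝ} (hH : 0 < H)
    {V W : (Fin d → ℤ) → ℝ} (hV : ∀ x, 0 ≤ V x) (hW0 : ∀ x, 0 < W x)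
    (hW : ∀ (a : AddMonoidAlgebra ℂ (Fin d → ℤ)) (S : Finset (Fin d → ℤ)),
      ∑ x ∈ S, W x * ‖a.coeff x‖ ^ 2 ≤ H * dirForm a)
    {s : ℝ} (hs : 0 < s) :
    (nCount d V s : ℝ≥0∞) ≤
      ENNReal.ofReal (clrConst d * (4 ^ ((d : ℝ) / 2) * (2 * H) ^ (q - (d : ℝ) / 2))) *
        ENNReal.ofReal (s ^ (-q)) *
        ∑' k : ℕ, ENNReal.ofReal ((2 : ℝ) ^ ((d : ℝ) / 2 - q)) ^ k *
          weakProfile q V W (s / (2 * H) * 2 ^ k) := by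
  have hd0 : (0 : ℝ) < d / 2 := by
    have : (3 : ℝ) ≤ d := by exact_mod_cast hd
    positivity
  have hK := clrConst_nonneg d
  rw [nCount, ENat.toENNReal_iSup]
  refine iSup_le fun ⟨L, hfin, hfd, hadm⟩ => ?_
  rw [ENat.toENNReal_coe]
  refine (finrank_le_tsum hd hH hV hW0 hW hs L hfin hadm).trans ?_
  have hτ : 0 < s / (2 * H) := by positivity
  refine (mul_le_mul_right (tsum_indicator_rpow_le hd0 hV hW0 hτ) _).trans (le_of_eq ?_)
  rw [← ENNReal.tsum_mul_left, ← ENNReal.tsum_mul_left]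
  refine tsum_congr fun k => ?_
  rw [weakProfile, ← ENNReal.ofReal_pow (by positivity), ← mul_assoc, ← mul_assoc, ← mul_assoc,
    ← ENNReal.ofReal_mul (by positivity), ← ENNReal.ofReal_mul (by positivity),
    ← ENNReal.ofReal_mul (by positivity), ← ENNReal.ofReal_mul (by positivity)]
  congr 2
  rw [mul_assoc, rpow_identity (q := q) hs (by positivity : 0 < 2 * H) rfl k]
  ring

theorem exists_weakProfile_le {q : ℝ} (hq : 0 < q) {V W : (Fin d → ℤ) → ℝ}
    (hW0 : ∀ x, 0 < W x) (h0 : Tendsto (weakProfile q V W) (𝓝[>] 0) (𝓝 0))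
    (h1 : Tendsto (weakProfile q V W) atTop (𝓝 0)) :
    ∃ M : ℝ≥0∞, M ≠ ∞ ∧ ∀ t, 0 < t → weakProfile q V W t ≤ M := by
  have h0' := h0.eventually (gt_mem_nhds one_pos)
  have h1' := h1.eventually (gt_mem_nhds one_pos)
  obtain ⟨t₀, ht₀, h₀⟩ := mem_nhdsGT_iff_exists_Ioc_subset.1 h0'
  obtain ⟨T, hT⟩ := eventually_atTop.1 h1'
  rw [Set.mem_Ioi] at ht₀
  have hfin : distMass ((d : ℝ) / 2) V W t₀ ≠ ∞ := by
    intro h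
    have h2 : weakProfile q V W t₀ < 1 := h₀ ⟨ht₀, le_rfl⟩
    rw [weakProfile, h, ENNReal.mul_top (by
      rw [Ne, ENNReal.ofReal_eq_zero, not_le]; positivity)] at h2
    simp at h2
  refine ⟨max 1 (ENNReal.ofReal (T ^ q) * distMass ((d : ℝ) / 2) V W t₀),
    max_ne_top ENNReal.one_ne_top (ENNReal.mul_ne_top ENNReal.ofReal_ne_top hfin),
    fun t ht => ?_⟩
  rcases le_or_gt t t₀ with h | h
  · exact le_max_of_le_left (le_of_lt (h₀ ⟨ht, h⟩))
  · rcases le_or_gt T t with h' | h'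
    · exact le_max_of_le_left (hT t h').le
    · refine le_max_of_le_right (mul_le_mul' (ENNReal.ofReal_le_ofReal ?_)
        (distMass_anti _ hW0 h.le))
      exact Real.rpow_le_rpow ht.le h'.le hq.le

theorem tendsto_tsum_weakProfile {r : ℝ≥0∞} (hr : r < 1) {q c : ℝ} (hc : 0 < c)
    {V W : (Fin d → ℤ) → ℝ} {M : ℝ≥0∞} (hM : M ≠ ∞)
    (hb : ∀ t, 0 < t → weakProfile q V W t ≤ M)
    (h0 : Tendsto (weakProfile q V W) (𝓝[>] 0) (𝓝 0)) :
    Tendsto (fun s : ℝ => ∑' k : ℕ, r ^ k * weakProfile q V W (s / c * 2 ^ k))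
      (𝓝[>] 0) (𝓝 0) := by
  have hlim : ∀ k : ℕ, Tendsto (fun s : ℝ => r ^ k * weakProfile q V W (s / c * 2 ^ k))
      (𝓝[>] 0) (𝓝 0) := by
    intro k
    have h1 : Tendsto (fun s : ℝ => s / c * 2 ^ k) (𝓝[>] 0) (𝓝[>] 0) := by
      refine tendsto_nhdsWithin_iff.2 ⟨?_, ?_⟩
      · have : Tendsto (fun s : ℝ => s / c * 2 ^ k) (𝓝 0) (𝓝 (0 / c * 2 ^ k)) :=
          (tendsto_id.div_const c).mul_const _
        rw [zero_div, zero_mul] at this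
        exact this.mono_left nhdsWithin_le_nhds
      · filter_upwards [self_mem_nhdsWithin] with s hs
        rw [Set.mem_Ioi] at hs ⊢
        positivity
    have h2 := ENNReal.Tendsto.const_mul (a := r ^ k) (h0.comp h1)
      (Or.inr (ENNReal.pow_ne_top hr.ne_top))
    rwa [mul_zero] at h2
  have key := tendsto_lintegral_filter_of_dominated_convergence (μ := Measure.count)
    (l := 𝓝[>] (0 : ℝ)) (F := fun s (k : ℕ) => r ^ k * weakProfile q V W (s / c * 2 ^ k))
    (f := fun _ => 0) (fun k : ℕ => r ^ k * M)
    (Eventually.of_forall fun s => measurable_of_countable _) ?_ ?_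
    (Eventually.of_forall hlim)
  · simpa only [lintegral_count, lintegral_zero] using key
  · filter_upwards [self_mem_nhdsWithin] with s hs
    rw [Set.mem_Ioi] at hs
    refine Eventually.of_forall fun k => ?_
    gcongr
    exact hb _ (by positivity)
  · rw [lintegral_count, ENNReal.tsum_mul_right, ENNReal.tsum_geometric]
    exact ENNReal.mul_ne_top (ENNReal.inv_ne_top.2 (tsub_pos_of_lt hr).ne') hM

end Counting

end

/-- eigenvalue estimates in `Σ_q`, `q > d/2`, relative to a weight `W`
whose step function `𝒥W` is a normalized Hardy weight on `ℝ^d`. -/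
theorem estimate_large_q (d : ℕ) (hd : 3 ≤ d) (q : ℝ) (hq : (d : ℝ) / 2 < q) :
    ∃ C : ℝ, 0 < C ∧
      ∀ W : (Fin d → ℤ) → ℝ, (∀ x, 0 < W x) →
      (∀ U : EuclideanSpace ℝ (Fin d) → ℂ,
        (∃ K : ℝ≥0, LipschitzWith K U) → HasCompactSupport U →
        (∫⁻ ξ : EuclideanSpace ℝ (Fin d),
            ENNReal.ofReal (W fun i => ⌊ξ i⌋) * ((‖U ξ‖₊ : ℝ≥0∞)) ^ 2) ≤
          ∫⁻ ξ : EuclideanSpace ℝ (Fin d), ((‖fderiv ℝ U ξ‖₊ : ℝ≥0∞)) ^ 2) →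
      ∀ V : (Fin d → ℤ) → ℝ, (∀ x, 0 ≤ V x) →
        (∀ s : ℝ, 0 < s →
          (nCount d V s : ℝ≥0∞) ≤
            ENNReal.ofReal C * ENNReal.ofReal s ^ (-q) *
              ⨆ t : {t : ℝ // 0 < t},
                ENNReal.ofReal (t.1 ^ q) *
                  ∑' x : {x : Fin d → ℤ // t.1 * W x < V x},
                    ENNReal.ofReal (W x.1 ^ ((d : ℝ) / 2))) ∧
        ((Filter.Tendsto (fun t : ℝ =>
              ENNReal.ofReal (t ^ q) *
                ∑' x : {x : Fin d → ℤ // t * W x < V x},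
                  ENNReal.ofReal (W x.1 ^ ((d : ℝ) / 2))) (𝓝[>] (0 : ℝ)) (𝓝 0) ∧
          Filter.Tendsto (fun t : ℝ =>
              ENNReal.ofReal (t ^ q) *
                ∑' x : {x : Fin d → ℤ // t * W x < V x},
                  ENNReal.ofReal (W x.1 ^ ((d : ℝ) / 2))) Filter.atTop (𝓝 0)) →
          Filter.Tendsto (fun s : ℝ =>
              ENNReal.ofReal (s ^ q) * (nCount d V s : ℝ≥0∞)) (𝓝[>] (0 : ℝ)) (𝓝 0)) := by
  have hd3 : (3 : ℝ) ≤ d := by exact_mod_cast hd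
  obtain ⟨H, hH, hHardy⟩ := exists_sum_hardy_le d
  have hr : ENNReal.ofReal ((2 : ℝ) ^ ((d : ℝ) / 2 - q)) < 1 := by
    rw [ENNReal.ofReal_lt_one]
    exact Real.rpow_lt_one_of_one_lt_of_neg one_lt_two (by linarith)
  set r := ENNReal.ofReal ((2 : ℝ) ^ ((d : ℝ) / 2 - q)) with hr_def
  set c₀ := ENNReal.ofReal (clrConst d * (4 ^ ((d : ℝ) / 2) * (2 * H) ^ (q - (d : ℝ) / 2)))
  have hC : c₀ * (1 - r)⁻¹ ≠ ∞ := ENNReal.mul_ne_top ENNReal.ofReal_ne_top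
    (ENNReal.inv_ne_top.2 (tsub_pos_of_lt hr).ne')
  refine ⟨(c₀ * (1 - r)⁻¹).toReal + 1, by positivity, fun W hW0 hW V hV => ?_⟩
  have hn : ∀ s : ℝ, 0 < s → (nCount d V s : ℝ≥0∞) ≤ c₀ * ENNReal.ofReal (s ^ (-q)) *
      ∑' k : ℕ, r ^ k * weakProfile q V W (s / (2 * H) * 2 ^ k) :=
    fun s hs => nCount_le_tsum_weakProfile hd q hH hV hW0 (hHardy W hW0 hW) hs
  refine ⟨fun s hs => ?_, fun ⟨h0, h1⟩ => ?_⟩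
  · change _ ≤ _ * ⨆ t : {t : ℝ // 0 < t}, weakProfile q V W t.1
    set M := ⨆ t : {t : ℝ // 0 < t}, weakProfile q V W t.1
    calc (nCount d V s : ℝ≥0∞) ≤ c₀ * ENNReal.ofReal (s ^ (-q)) * ∑' k : ℕ, r ^ k * M := by
          refine (hn s hs).trans ?_
          gcongr with k
          exact le_iSup (fun t : {t : ℝ // 0 < t} => weakProfile q V W t.1)
            ⟨s / (2 * H) * 2 ^ k, by positivity⟩
      _ = c₀ * (1 - r)⁻¹ * ENNReal.ofReal s ^ (-q) * M := by
          rw [ENNReal.tsum_mul_right, ENNReal.tsum_geometric, ENNReal.ofReal_rpow_of_pos hs]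
          ring
      _ ≤ _ := by
          gcongr
          rw [ENNReal.ofReal_add ENNReal.toReal_nonneg zero_le_one, ENNReal.ofReal_toReal hC]
          exact le_self_add
  · obtain ⟨M, hM, hb⟩ := exists_weakProfile_le (by linarith) hW0 h0 h1
    have hlim := ENNReal.Tendsto.const_mul (a := c₀)
      (tendsto_tsum_weakProfile hr (by positivity : 0 < 2 * H) hM hb h0)
      (Or.inr ENNReal.ofReal_ne_top)
    rw [mul_zero] at hlim
    refine tendsto_of_tendsto_of_tendsto_of_le_of_le' tendsto_const_nhds hlim
      (Eventually.of_forall fun _ => zero_le) ?_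
    filter_upwards [self_mem_nhdsWithin] with s hs
    rw [Set.mem_Ioi] at hs
    have hone : ENNReal.ofReal (s ^ q) * ENNReal.ofReal (s ^ (-q)) = 1 := by
      rw [← ENNReal.ofReal_mul (by positivity), ← Real.rpow_add hs, add_neg_cancel,
        Real.rpow_zero, ENNReal.ofReal_one]
    refine (mul_le_mul_right (hn s hs) _).trans (le_of_eq ?_)
    rw [mul_comm c₀, mul_assoc, ← mul_assoc, hone, one_mul]
end
end

section
/- Let d ≥ 3 and 2q > d. There exists a constant C = C(d,q) such that for every V : ℤ^d → [0,∞) and every s > 0, n(s,V) ≤ C · s^{−q} · sup_{t>0} ( t^q · Σ_{x : (|x|²+1)·V(x) > t} (|x|²+1)^{−d/2} ), the supremum taken in [0,∞]. Equivalently, N₋(H_{αV}) ≤ C(d,q) α^q sup_{t>0} ( t^q Σ_{(|x|²+1)V(x)>t} (|x|²+1)^{−d/2} ) for all α > 0. -/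
open scoped ENNReal NNReal Topology
open Filter MeasureTheory

noncomputable section

lemma znorm_sq {d : ℕ} (x : Fin d → ℤ) : znorm x ^ 2 = ∑ i, (x i : ℝ) ^ 2 :=
  Real.sq_sqrt (Finset.sum_nonneg fun _ _ => sq_nonneg _)

lemma sq_le_znorm_sq {d : ℕ} (x : Fin d → ℤ) (j : Fin d) : (x j : ℝ) ^ 2 ≤ znorm x ^ 2 := by
  rw [znorm_sq]
  exact Finset.single_le_sum (f := fun i => (x i : ℝ) ^ 2) (fun i _ => sq_nonneg _)
    (Finset.mem_univ j)

lemma znorm_sub_latUnit_sq {d : ℕ} (x : Fin d → ℤ) (j : Fin d) :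
    znorm (x - latUnit d j) ^ 2 = znorm x ^ 2 - 2 * x j + 1 := by
  have h (i : Fin d) : (((x - latUnit d j) i : ℤ) : ℝ) ^ 2
      = (x i : ℝ) ^ 2 + if i = j then -2 * (x j : ℝ) + 1 else 0 := by
    by_cases hij : i = j
    · subst hij
      simp [latUnit]
      ring
    · simp [latUnit, hij]
  rw [znorm_sq, znorm_sq, Finset.sum_congr rfl fun i _ => h i, Finset.sum_add_distrib]
  simp
  ring

/-- A ground state type lower bound for the Dirichlet form on one edge. -/
lemma edge_lower_bound (a b : ℂ) {F : ℝ} (hF : F ≤ 1 / 2) :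
    F * ‖a‖ ^ 2 - (F + 2 * F ^ 2) * ‖b‖ ^ 2 ≤ ‖b - a‖ ^ 2 := by
  have h1 : (‖b‖ - ‖a‖) ^ 2 ≤ ‖b - a‖ ^ 2 := by
    rw [← sq_abs (‖b‖ - ‖a‖)]
    exact pow_le_pow_left₀ (abs_nonneg _) (abs_norm_sub_norm_le b a) 2
  have h2 : F * ‖a‖ ^ 2 - (F + 2 * F ^ 2) * ‖b‖ ^ 2 ≤ (‖b‖ - ‖a‖) ^ 2 := by
    have h3 : 0 ≤ (1 - F) * ((1 - F) * ‖a‖ ^ 2 - 2 * ‖a‖ * ‖b‖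
        + (1 + F + 2 * F ^ 2) * ‖b‖ ^ 2) := by
      have : 0 ≤ F ^ 2 * (1 - 2 * F) * ‖b‖ ^ 2 := by
        have : 0 ≤ 1 - 2 * F := by linarith
        positivity
      nlinarith [sq_nonneg ((1 - F) * ‖a‖ - ‖b‖)]
    nlinarith [nonneg_of_mul_nonneg_right h3 (by linarith)]
  exact h2.trans h1

lemma divergence_term_lower_bound {D X t : ℝ} (hD : 1 ≤ D) (ht : X ^ 2 + 1000 * D ^ 2 ≤ t) :
    (t - 2 * X ^ 2) / t ^ 2 - 1 / (4 * D) / t ≤ X / t - (X - 1) / (t - 2 * X + 1) := by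
  have hD2 : 1 ≤ D ^ 2 := by nlinarith
  have ht0 : 0 < t := by nlinarith [sq_nonneg X]
  have hs : t / 2 ≤ t - 2 * X + 1 := by nlinarith [sq_nonneg (X - 2)]
  have hs0 : 0 < t - 2 * X + 1 := by linarith
  have key : -(3 * t * X - t + 2 * X ^ 2 - 4 * X ^ 3) ≤ 1 / (4 * D) * t * (t - 2 * X + 1) := by
    have h1 : -(3 * t * X - t + 2 * X ^ 2 - 4 * X ^ 3) ≤ t * (7 * |X| + 3) := by
      have ha := neg_abs_le X
      have hb := le_abs_self X
      have h3 : X ^ 3 ≤ t * |X| := by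
        calc X ^ 3 = X ^ 2 * X := by ring
          _ ≤ X ^ 2 * |X| := by gcongr
          _ ≤ t * |X| := by gcongr; nlinarith
      nlinarith [sq_nonneg X]
    have h2 : 7 * |X| + 3 ≤ 1 / (4 * D) * (t / 2) := by
      rw [div_mul_eq_mul_div, le_div_iff₀ (by positivity)]
      nlinarith [sq_nonneg (|X| - 28 * D), sq_abs X]
    calc _ ≤ t * (7 * |X| + 3) := h1
      _ ≤ t * (1 / (4 * D) * (t / 2)) := by gcongr
      _ ≤ t * (1 / (4 * D) * (t - 2 * X + 1)) := by gcongr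
      _ = _ := by ring
  have e1 : X / t - (X - 1) / (t - 2 * X + 1) - ((t - 2 * X ^ 2) / t ^ 2 - 1 / (4 * D) / t)
      = (3 * t * X - t + 2 * X ^ 2 - 4 * X ^ 3 + 1 / (4 * D) * t * (t - 2 * X + 1))
        / (t ^ 2 * (t - 2 * X + 1)) := by
    obtain ⟨r, hr⟩ : ∃ r, r = t - 2 * X + 1 := ⟨_, rfl⟩
    rw [← hr] at hs0 ⊢
    field_simp
    rw [hr]
    ring
  have : 0 ≤ X / t - (X - 1) / (t - 2 * X + 1)
      - ((t - 2 * X ^ 2) / t ^ 2 - 1 / (4 * D) / t) := by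
    rw [e1]
    apply div_nonneg <;> [linarith; positivity]
  linarith

/-- The vector field whose discrete divergence dominates the Hardy weight. -/
def hardyField (d : ℕ) (j : Fin d) (x : Fin d → ℤ) : ℝ :=
  1 / (16 * d) * (x j / (znorm x ^ 2 + 1000 * d ^ 2))

lemma hardyField_le_half {d : ℕ} (j : Fin d) (x : Fin d → ℤ) : hardyField d j x ≤ 1 / 2 := by
  have hd : (1 : ℝ) ≤ d := by exact_mod_cast Fin.pos j
  have h1 := sq_le_znorm_sq x j
  have h2 : (x j : ℝ) / (znorm x ^ 2 + 1000 * d ^ 2) ≤ 1 := by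
    rw [div_le_one (by positivity)]
    nlinarith [sq_nonneg ((x j : ℝ) - 1)]
  have h3 : 1 / (16 * (d : ℝ)) ≤ 1 / 2 := by
    apply one_div_le_one_div_of_le <;> linarith
  calc hardyField d j x ≤ 1 / (16 * d) * 1 := by unfold hardyField; gcongr
    _ ≤ _ := by linarith

lemma hardyField_divergence {d : ℕ} (hd : 3 ≤ d) (x : Fin d → ℤ) :
    1 / (32 * d) / (znorm x ^ 2 + 1000 * d ^ 2) ≤
      ∑ j, (hardyField d j x - (hardyField d j (x - latUnit d j)
        + 2 * hardyField d j (x - latUnit d j) ^ 2)) := by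
  have hd' : (3 : ℝ) ≤ d := by exact_mod_cast hd
  set t : ℝ := znorm x ^ 2 + 1000 * d ^ 2 with ht
  have ht0 : 0 < t := by positivity
  have hterm (j : Fin d) : 1 / (16 * d) * ((t - 2 * (x j : ℝ) ^ 2) / t ^ 2 - 1 / (4 * d) / t)
      - 4 * (1 / (16 * d)) ^ 2 / t ≤ hardyField d j x - (hardyField d j (x - latUnit d j)
        + 2 * hardyField d j (x - latUnit d j) ^ 2) := by
    obtain ⟨X, hX⟩ : ∃ X : ℝ, X = x j := ⟨_, rfl⟩
    rw [← hX]
    have hXt : X ^ 2 + 1000 * (d : ℝ) ^ 2 ≤ t := by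
      have := sq_le_znorm_sq x j
      rw [← hX] at this
      linarith
    have h1 := divergence_term_lower_bound (D := d) (by linarith) hXt
    have hs : znorm (x - latUnit d j) ^ 2 + 1000 * d ^ 2 = t - 2 * X + 1 := by
      rw [znorm_sub_latUnit_sq, hX]
      ring
    have hxj : (((x - latUnit d j) j : ℤ) : ℝ) = X - 1 := by simp [latUnit, hX]
    have hst : t / 2 ≤ t - 2 * X + 1 := by nlinarith [sq_nonneg (X - 2)]
    have hs0 : 0 < t - 2 * X + 1 := by linarith
    have h2 : ((X - 1) / (t - 2 * X + 1)) ^ 2 ≤ 2 / t := by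
      rw [div_pow, div_le_div_iff₀ (by positivity) ht0]
      calc (X - 1) ^ 2 * t ≤ (t - 2 * X + 1) * (2 * (t - 2 * X + 1)) := by
            gcongr
            · nlinarith
            · linarith
        _ = _ := by ring
    unfold hardyField
    rw [hs, hxj, ← hX]
    have h3 := mul_le_mul_of_nonneg_left h1 (show 0 ≤ 1 / (16 * (d : ℝ)) by positivity)
    have h4 := mul_le_mul_of_nonneg_left h2 (show 0 ≤ 2 * (1 / (16 * (d : ℝ))) ^ 2 by positivity)
    have h5 : 4 * (1 / (16 * (d : ℝ))) ^ 2 / t = 2 * (1 / (16 * (d : ℝ))) ^ 2 * (2 / t) := by ring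
    rw [h5]
    nlinarith
  refine le_trans ?_ (Finset.sum_le_sum fun j _ => hterm j)
  have hsum : ∑ j : Fin d, (1 / (16 * (d : ℝ)) * ((t - 2 * (x j : ℝ) ^ 2) / t ^ 2
      - 1 / (4 * d) / t) - 4 * (1 / (16 * d)) ^ 2 / t)
      = 1 / (16 * d) * ((d * t - 2 * znorm x ^ 2) / t ^ 2 - 1 / 4 / t) - 1 / (64 * d) / t := by
    rw [Finset.sum_sub_distrib, ← Finset.mul_sum, Finset.sum_sub_distrib, ← Finset.sum_div,
      Finset.sum_sub_distrib, ← Finset.mul_sum, ← znorm_sq]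
    simp
    field_simp
    ring
  rw [hsum]
  have h6 : 1 / t ≤ (d * t - 2 * znorm x ^ 2) / t ^ 2 := by
    rw [div_le_div_iff₀ ht0 (by positivity)]
    have : znorm x ^ 2 ≤ t := by rw [ht]; nlinarith
    nlinarith
  have h7 := mul_le_mul_of_nonneg_left h6 (show 0 ≤ 1 / (16 * (d : ℝ)) by positivity)
  have h8 : 1 / (16 * (d : ℝ)) * (1 / t) - 1 / (16 * d) * (1 / 4 / t) - 1 / (64 * d) / t
      = 1 / (32 * d) / t := by
    field_simp
    ring
  nlinarith

lemma Q0_eq_ofReal {d : ℕ} {u : (Fin d → ℤ) → ℂ} (hu : (Function.support u).Finite) :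
    Summable (fun x => ∑ j : Fin d, ‖u (x + latUnit d j) - u x‖ ^ 2) ∧
    Q0 u = ENNReal.ofReal (∑' x, ∑ j : Fin d, ‖u (x + latUnit d j) - u x‖ ^ 2) := by
  have hs (j : Fin d) : Summable (fun x => ‖u (x + latUnit d j) - u x‖ ^ 2) := by
    refine summable_of_hasFiniteSupport (((hu.preimage
      (add_left_injective (latUnit d j)).injOn).union hu).subset fun x hx => ?_)
    by_contra hc
    simp only [Set.mem_union, Set.mem_preimage, Function.mem_support, not_or, not_not] at hc
    simp [hc.1, hc.2] at hx
  have hs' : Summable (fun x => ∑ j : Fin d, ‖u (x + latUnit d j) - u x‖ ^ 2) :=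
    summable_sum fun j _ => hs j
  refine ⟨hs', ?_⟩
  rw [ENNReal.ofReal_tsum_of_nonneg (fun x => Finset.sum_nonneg fun j _ => sq_nonneg _) hs']
  refine tsum_congr fun x => ?_
  rw [ENNReal.ofReal_sum_of_nonneg fun j _ => sq_nonneg _]
  refine Finset.sum_congr rfl fun j _ => ?_
  rw [ENNReal.ofReal_pow (norm_nonneg _), ofReal_norm]
  rfl

/-- The discrete Hardy inequality. -/
lemma hardy_inequality {d : ℕ} (hd : 3 ≤ d) {u : (Fin d → ℤ) → ℂ}
    (hu : (Function.support u).Finite) :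
    ∑' x, ENNReal.ofReal ((znorm x ^ 2 + 1)⁻¹) * (‖u x‖₊ : ℝ≥0∞) ^ 2
      ≤ ENNReal.ofReal (32000 * d ^ 3) * Q0 u := by
  have hd' : (3 : ℝ) ≤ d := by exact_mod_cast hd
  obtain ⟨hQs, hQ⟩ := Q0_eq_ofReal hu
  have hfs (g : (Fin d → ℤ) → ℝ) : Summable (fun x => g x * ‖u x‖ ^ 2) :=
    summable_of_hasFiniteSupport (hu.subset fun x hx hc => hx (by simp [hc]))
  have hfs' (g : (Fin d → ℤ) → ℝ) (j : Fin d) :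
      Summable (fun x => g x * ‖u (x + latUnit d j)‖ ^ 2) := by
    refine summable_of_hasFiniteSupport ((hu.preimage
      (add_left_injective (latUnit d j)).injOn).subset fun x hx hc => hx ?_)
    simp only at hc
    simp [hc]
  have hshift (g : (Fin d → ℤ) → ℝ) (j : Fin d) :
      ∑' x, g x * ‖u (x + latUnit d j)‖ ^ 2 = ∑' x, g (x - latUnit d j) * ‖u x‖ ^ 2 := by
    rw [← (Equiv.addRight (latUnit d j)).tsum_eq (fun x => g (x - latUnit d j) * ‖u x‖ ^ 2)]
    simp
  set G : Fin d → (Fin d → ℤ) → ℝ := fun j x => hardyField d j x + 2 * hardyField d j x ^ 2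
    with hG
  have key : ∑' x, 1 / (32 * d) / (znorm x ^ 2 + 1000 * d ^ 2) * ‖u x‖ ^ 2
      ≤ ∑' x, ∑ j : Fin d, ‖u (x + latUnit d j) - u x‖ ^ 2 := by
    calc ∑' x, 1 / (32 * d) / (znorm x ^ 2 + 1000 * d ^ 2) * ‖u x‖ ^ 2
        ≤ ∑' x, (∑ j, (hardyField d j x - G j (x - latUnit d j))) * ‖u x‖ ^ 2 :=
          (hfs _).tsum_le_tsum (fun x => mul_le_mul_of_nonneg_right
            (hardyField_divergence hd x) (sq_nonneg _)) (hfs _)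
      _ = ∑ j, ∑' x, (hardyField d j x * ‖u x‖ ^ 2 - G j (x - latUnit d j) * ‖u x‖ ^ 2) := by
          rw [← Summable.tsum_finsetSum fun j _ => (hfs _).sub (hfs fun x => G j (x - latUnit d j))]
          refine tsum_congr fun x => ?_
          rw [Finset.sum_mul]
          exact Finset.sum_congr rfl fun j _ => sub_mul _ _ _
      _ = ∑ j, ∑' x, (hardyField d j x * ‖u x‖ ^ 2 - G j x * ‖u (x + latUnit d j)‖ ^ 2) := by
          refine Finset.sum_congr rfl fun j _ => ?_
          rw [(hfs _).tsum_sub (hfs fun x => G j (x - latUnit d j)),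
            (hfs _).tsum_sub (hfs' _ _), hshift]
      _ = ∑' x, ∑ j, (hardyField d j x * ‖u x‖ ^ 2 - G j x * ‖u (x + latUnit d j)‖ ^ 2) :=
          (Summable.tsum_finsetSum fun j _ => (hfs _).sub (hfs' _ _)).symm
      _ ≤ _ := Summable.tsum_le_tsum (fun x => Finset.sum_le_sum fun j _ =>
          edge_lower_bound _ _ (hardyField_le_half j x))
          (summable_sum fun j _ => (hfs _).sub (hfs' _ _)) hQs
  have hterm (x : Fin d → ℤ) : ENNReal.ofReal ((znorm x ^ 2 + 1)⁻¹) * (‖u x‖₊ : ℝ≥0∞) ^ 2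
      ≤ ENNReal.ofReal (32000 * d ^ 3) *
        ENNReal.ofReal (1 / (32 * d) / (znorm x ^ 2 + 1000 * d ^ 2) * ‖u x‖ ^ 2) := by
    have h1 : ((‖u x‖₊ : ℝ≥0∞)) ^ 2 = ENNReal.ofReal (‖u x‖ ^ 2) := by
      rw [ENNReal.ofReal_pow (norm_nonneg _), ofReal_norm]
      rfl
    rw [h1, ← ENNReal.ofReal_mul (by positivity), ← ENNReal.ofReal_mul (by positivity)]
    apply ENNReal.ofReal_le_ofReal
    rw [← mul_assoc]
    gcongr
    have h2 : 32000 * (d : ℝ) ^ 3 * (1 / (32 * d) / (znorm x ^ 2 + 1000 * d ^ 2))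
        = 1000 * d ^ 2 / (znorm x ^ 2 + 1000 * d ^ 2) := by
      field_simp
      ring
    rw [h2, inv_eq_one_div, div_le_div_iff₀ (by positivity) (by positivity)]
    have : 1 ≤ (d : ℝ) ^ 2 := by nlinarith
    nlinarith [sq_nonneg (znorm x)]
  calc _ ≤ _ := ENNReal.tsum_le_tsum hterm
    _ = ENNReal.ofReal (32000 * d ^ 3) * ENNReal.ofReal
          (∑' x, 1 / (32 * d) / (znorm x ^ 2 + 1000 * d ^ 2) * ‖u x‖ ^ 2) := by
        rw [ENNReal.tsum_mul_left, ENNReal.ofReal_tsum_of_nonneg (fun x => by positivity) (hfs _)]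
    _ ≤ _ := by
        rw [hQ]
        gcongr

/-- The Dirichlet form is invariant under translations. -/
lemma Q0_translate {d : ℕ} (u : (Fin d → ℤ) → ℂ) (y : Fin d → ℤ) :
    Q0 (fun h => u (y + h)) = Q0 u := by
  unfold Q0
  rw [← (Equiv.addLeft y).tsum_eq (fun x => ∑ j : Fin d,
    ((‖u (x + latUnit d j) - u x‖₊ : ℝ≥0∞)) ^ 2)]
  simp [add_assoc]

lemma nnnorm_sum_sq_le {ι : Type*} [Fintype ι] (f : ι → ℂ) :
    (‖∑ i, f i‖₊ : ℝ≥0∞) ^ 2 ≤ Fintype.card ι * ∑ i, (‖f i‖₊ : ℝ≥0∞) ^ 2 := by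
  have h : ‖∑ i, f i‖₊ ^ 2 ≤ Fintype.card ι * ∑ i, ‖f i‖₊ ^ 2 :=
    (pow_le_pow_left₀ zero_le (nnnorm_sum_le _ _) 2).trans
      (sq_sum_le_card_mul_sum_sq (s := Finset.univ) (f := fun i => ‖f i‖₊))
  exact_mod_cast h

lemma nnnorm_smul_sum_sq_le {ι : Type*} [Fintype ι] [Nonempty ι] (f : ι → ℂ) :
    (‖(Fintype.card ι : ℂ)⁻¹ * ∑ i, f i‖₊ : ℝ≥0∞) ^ 2
      ≤ (Fintype.card ι : ℝ≥0∞)⁻¹ * ∑ i, (‖f i‖₊ : ℝ≥0∞) ^ 2 := by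
  have h0 : (Fintype.card ι : ℝ≥0∞) ≠ 0 := by simp
  have ht : (Fintype.card ι : ℝ≥0∞) ≠ ∞ := by simp
  have h1 : (‖(Fintype.card ι : ℂ)⁻¹‖₊ : ℝ≥0∞) = (Fintype.card ι : ℝ≥0∞)⁻¹ := by
    rw [nnnorm_inv, ENNReal.coe_inv (by simp)]
    simp
  rw [nnnorm_mul, ENNReal.coe_mul, mul_pow, h1]
  calc _ ≤ (Fintype.card ι : ℝ≥0∞)⁻¹ ^ 2 * (Fintype.card ι * ∑ i, (‖f i‖₊ : ℝ≥0∞) ^ 2) := by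
        gcongr
        exact nnnorm_sum_sq_le f
    _ = (Fintype.card ι : ℝ≥0∞)⁻¹ * ((Fintype.card ι : ℝ≥0∞)⁻¹ * Fintype.card ι) *
          ∑ i, (‖f i‖₊ : ℝ≥0∞) ^ 2 := by ring
    _ = _ := by rw [ENNReal.inv_mul_cancel h0 ht, mul_one]

/-- The lattice point of a box of side `n` with the given coordinates. -/
def boxPoint {d n : ℕ} (h : Fin d → Fin n) : Fin d → ℤ := fun i => ((h i : ℕ) : ℤ)

/-- The average of `u` over the box of side `n` with lowest corner `x`. -/
def boxAvg {d : ℕ} (n : ℕ) (u : (Fin d → ℤ) → ℂ) (x : Fin d → ℤ) : ℂ :=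
  (Fintype.card (Fin d → Fin n) : ℂ)⁻¹ * ∑ h : Fin d → Fin n, u (x + boxPoint h)

lemma boxPoint_injective {d n : ℕ} :
    Function.Injective (boxPoint : (Fin d → Fin n) → (Fin d → ℤ)) := by
  intro g h hgh
  ext i
  have := congrFun hgh i
  simpa [boxPoint] using this

lemma znorm_boxPoint_sq_le {d n : ℕ} {r : ℝ} (hn : ∀ k : ℕ, k < n → (k : ℝ) ≤ r)
    (h : Fin d → Fin n) : znorm (boxPoint h) ^ 2 ≤ d * r ^ 2 := by
  rw [znorm_sq]
  calc ∑ i, ((boxPoint h i : ℤ) : ℝ) ^ 2 ≤ ∑ _i : Fin d, r ^ 2 := by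
        refine Finset.sum_le_sum fun i _ => ?_
        have := hn (h i) (h i).2
        simp only [boxPoint, Int.cast_natCast]
        gcongr
    _ = d * r ^ 2 := by simp

/-- Box averages are controlled pointwise by the Dirichlet form. -/
lemma boxAvg_sq_le {d : ℕ} (hd : 3 ≤ d) {n : ℕ} (hn : 1 ≤ n) {u : (Fin d → ℤ) → ℂ}
    (hu : (Function.support u).Finite) (x : Fin d → ℤ) :
    (‖boxAvg n u x‖₊ : ℝ≥0∞) ^ 2
      ≤ ENNReal.ofReal (64000 * d ^ 4 * ((n : ℝ) ^ (d - 2))⁻¹) * Q0 u := by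
  have : NeZero n := ⟨by omega⟩
  have hn' : (1 : ℝ) ≤ n := by exact_mod_cast hn
  have hd' : (3 : ℝ) ≤ d := by exact_mod_cast hd
  have hv : (Function.support fun h => u (x + h)).Finite :=
    hu.preimage (add_right_injective x).injOn
  have hH := hardy_inequality hd hv
  rw [Q0_translate] at hH
  have hterm (h : Fin d → Fin n) : (‖u (x + boxPoint h)‖₊ : ℝ≥0∞) ^ 2 ≤
      ENNReal.ofReal (2 * d * n ^ 2) * (ENNReal.ofReal ((znorm (boxPoint h) ^ 2 + 1)⁻¹)
        * (‖u (x + boxPoint h)‖₊ : ℝ≥0∞) ^ 2) := by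
    rw [← mul_assoc, ← ENNReal.ofReal_mul (by positivity)]
    have : 1 ≤ 2 * d * (n : ℝ) ^ 2 * (znorm (boxPoint h) ^ 2 + 1)⁻¹ := by
      rw [← div_eq_mul_inv, one_le_div (by positivity)]
      have h1 := znorm_boxPoint_sq_le (r := n) (fun k hk => by exact_mod_cast hk.le) h
      nlinarith
    calc _ = 1 * (‖u (x + boxPoint h)‖₊ : ℝ≥0∞) ^ 2 := (one_mul _).symm
      _ ≤ _ := by
        gcongr
        exact ENNReal.one_le_ofReal.2 this
  calc _ ≤ _ := nnnorm_smul_sum_sq_le fun h : Fin d → Fin n => u (x + boxPoint h)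
    _ ≤ (Fintype.card (Fin d → Fin n) : ℝ≥0∞)⁻¹ * ∑ h : Fin d → Fin n,
        ENNReal.ofReal (2 * d * n ^ 2) * (ENNReal.ofReal ((znorm (boxPoint h) ^ 2 + 1)⁻¹)
        * (‖u (x + boxPoint h)‖₊ : ℝ≥0∞) ^ 2) := by
        gcongr with h
        exact hterm h
    _ = (Fintype.card (Fin d → Fin n) : ℝ≥0∞)⁻¹ * (ENNReal.ofReal (2 * d * n ^ 2) *
        ∑' h : Fin d → Fin n, (ENNReal.ofReal ((znorm (boxPoint h) ^ 2 + 1)⁻¹)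
        * (‖u (x + boxPoint h)‖₊ : ℝ≥0∞) ^ 2)) := by
        rw [← Finset.mul_sum, tsum_fintype]
    _ ≤ (Fintype.card (Fin d → Fin n) : ℝ≥0∞)⁻¹ * (ENNReal.ofReal (2 * d * n ^ 2) *
        (ENNReal.ofReal (32000 * d ^ 3) * Q0 u)) := by
        gcongr
        exact (ENNReal.tsum_comp_le_tsum_of_injective boxPoint_injective _).trans hH
    _ = _ := by
        rw [← mul_assoc, ← mul_assoc]
        congr 1
        have hc : (Fintype.card (Fin d → Fin n) : ℝ≥0∞)⁻¹ = ENNReal.ofReal (((n : ℝ) ^ d)⁻¹) := by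
          rw [ENNReal.ofReal_inv_of_pos (by positivity), ENNReal.ofReal_pow (by positivity)]
          simp
        rw [hc, ← ENNReal.ofReal_mul (by positivity), ← ENNReal.ofReal_mul (by positivity)]
        congr 1
        have : (n : ℝ) ^ d = n ^ (d - 2) * n ^ 2 := by
          rw [← pow_add]
          congr 1
          omega
        rw [this]
        field_simp
        ring

/-- The energy density of `u` at `x`. -/
def gradSq {d : ℕ} (u : (Fin d → ℤ) → ℂ) (x : Fin d → ℤ) : ℝ≥0∞ :=
  ∑ j : Fin d, ((‖u (x + latUnit d j) - u x‖₊ : ℝ≥0∞)) ^ 2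

lemma nnnorm_add_sq_le (a b : ℂ) (k : ℕ) :
    (k : ℝ≥0∞) * (‖a + b‖₊ : ℝ≥0∞) ^ 2
      ≤ (k + 1) * (‖a‖₊ : ℝ≥0∞) ^ 2 + k * (k + 1) * (‖b‖₊ : ℝ≥0∞) ^ 2 := by
  have h : (k : ℝ) * ‖a + b‖ ^ 2 ≤ (k + 1) * ‖a‖ ^ 2 + k * (k + 1) * ‖b‖ ^ 2 := by
    calc (k : ℝ) * ‖a + b‖ ^ 2 ≤ k * (‖a‖ + ‖b‖) ^ 2 := by
          gcongr
          exact norm_add_le a b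
      _ ≤ _ := by nlinarith [sq_nonneg (‖a‖ - k * ‖b‖)]
  exact_mod_cast h

/-- Translation by a vector with nonnegative coordinates is controlled, on a set `A`, by the energy
on any set containing all the paths that start in `A`. -/
lemma tsum_translate_sub_sq_le {d : ℕ} (u : (Fin d → ℤ) → ℂ) (A B : Set (Fin d → ℤ)) (k : ℕ) :
    ∀ h : Fin d → ℕ, ∑ i, h i = k →
      (∀ g : Fin d → ℕ, g ≤ h → ∀ x ∈ A, (x + fun i => (g i : ℤ)) ∈ B) →
      ∑' x, A.indicator (fun x => (‖u (x + fun i => (h i : ℤ)) - u x‖₊ : ℝ≥0∞) ^ 2) x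
        ≤ (k : ℝ≥0∞) ^ 2 * ∑' y, B.indicator (gradSq u) y := by
  induction k with
  | zero =>
    intro h hk _
    have h0 : (fun i => (h i : ℤ)) = 0 := by
      ext i
      simpa using (Finset.sum_eq_zero_iff.1 hk) i (Finset.mem_univ i)
    simp [h0]
  | succ k ih =>
    intro h hk hAB
    obtain ⟨j, hj⟩ : ∃ j, h j ≠ 0 := by
      by_contra! hc
      simp [hc] at hk
    set h' : Fin d → ℕ := Function.update h j (h j - 1) with hh'
    have hle : h' ≤ h := by
      intro i
      by_cases hij : i = j
      · subst hij
        simp [hh']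
      · simp [hh', hij]
    have hk' : ∑ i, h' i = k := by
      have h1 : h = h' + Pi.single j 1 := by
        ext i
        by_cases hij : i = j
        · subst hij
          simp [hh']
          omega
        · simp [hh', hij]
      have h2 : ∑ i, h i = ∑ i, h' i + 1 := by
        conv_lhs => rw [h1]
        simp [Finset.sum_add_distrib]
      omega
    have hstep : (fun i => (h i : ℤ)) = (fun i => (h' i : ℤ)) + latUnit d j := by
      ext i
      by_cases hij : i = j
      · subst hij
        simp [hh', latUnit]
        omega
      · simp [hh', latUnit, hij]
    have hlast : ∑' x, A.indicator (fun x => (‖u (x + fun i => (h i : ℤ))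
          - u (x + fun i => (h' i : ℤ))‖₊ : ℝ≥0∞) ^ 2) x ≤ ∑' y, B.indicator (gradSq u) y := by
      rw [← (Equiv.addRight (fun i => (h' i : ℤ))).tsum_eq (B.indicator (gradSq u))]
      refine ENNReal.tsum_le_tsum fun x => ?_
      by_cases hx : x ∈ A
      · have hxB := hAB h' hle x hx
        simp only [Equiv.coe_addRight, Set.indicator_of_mem hx, Set.indicator_of_mem hxB]
        rw [hstep, ← add_assoc]
        exact Finset.single_le_sum (f := fun j => ((‖u (x + (fun i => (h' i : ℤ)) + latUnit d j)
          - u (x + fun i => (h' i : ℤ))‖₊ : ℝ≥0∞)) ^ 2) (fun _ _ => zero_le) (Finset.mem_univ j)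
      · simp [hx]
    rcases Nat.eq_zero_or_pos k with rfl | hkpos
    · have h0 : (fun i => (h' i : ℤ)) = 0 := by
        ext i
        simpa using (Finset.sum_eq_zero_iff.1 hk') i (Finset.mem_univ i)
      simpa [h0] using hlast
    have hprev := ih h' hk' fun g hg => hAB g (hg.trans hle)
    set D := ∑' y, B.indicator (gradSq u) y
    have hk0 : (k : ℝ≥0∞) ≠ 0 := by exact_mod_cast hkpos.ne'
    refine (ENNReal.mul_le_mul_iff_right hk0 (ENNReal.natCast_ne_top k)).1 ?_
    rw [← ENNReal.tsum_mul_left]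
    calc _ ≤ ∑' x, ((k + 1 : ℝ≥0∞) * A.indicator (fun x => (‖u (x + fun i => (h' i : ℤ))
              - u x‖₊ : ℝ≥0∞) ^ 2) x + k * (k + 1) * A.indicator (fun x =>
              (‖u (x + fun i => (h i : ℤ)) - u (x + fun i => (h' i : ℤ))‖₊ : ℝ≥0∞) ^ 2) x) := by
          refine ENNReal.tsum_le_tsum fun x => ?_
          by_cases hx : x ∈ A
          · simp only [Set.indicator_of_mem hx]
            refine le_trans (le_of_eq ?_) (nnnorm_add_sq_le _ _ k)
            congr 4
            ring
          · simp [hx]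
      _ ≤ (k + 1) * (k ^ 2 * D) + k * (k + 1) * D := by
          rw [ENNReal.tsum_add, ENNReal.tsum_mul_left, ENNReal.tsum_mul_left]
          gcongr
      _ = k * (((k + 1 : ℕ) : ℝ≥0∞) ^ 2 * D) := by
          push_cast
          ring

/-- The index of the dyadic shell containing `x`. -/
def shell {d : ℕ} (x : Fin d → ℤ) : ℕ := Nat.log 4 (∑ i, (x i).natAbs ^ 2 + 1)

lemma cast_natAbs_sum {d : ℕ} (x : Fin d → ℤ) :
    ((∑ i, (x i).natAbs ^ 2 + 1 : ℕ) : ℝ) = znorm x ^ 2 + 1 := by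
  rw [znorm_sq]
  push_cast
  simp [Nat.cast_natAbs]

lemma four_pow_shell_le {d : ℕ} (x : Fin d → ℤ) : (4 : ℝ) ^ shell x ≤ znorm x ^ 2 + 1 := by
  rw [← cast_natAbs_sum]
  exact_mod_cast Nat.pow_log_le_self 4 (Nat.succ_ne_zero _)

lemma lt_four_pow_shell {d : ℕ} (x : Fin d → ℤ) : znorm x ^ 2 + 1 < (4 : ℝ) ^ (shell x + 1) := by
  rw [← cast_natAbs_sum]
  exact_mod_cast Nat.lt_pow_succ_log_self (by norm_num) _

lemma znorm_add_sq_le {d : ℕ} (x y : Fin d → ℤ) :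
    znorm (x + y) ^ 2 ≤ 2 * znorm x ^ 2 + 2 * znorm y ^ 2 := by
  simp only [znorm_sq, Finset.mul_sum, ← Finset.sum_add_distrib]
  refine Finset.sum_le_sum fun i _ => ?_
  simp only [Pi.add_apply, Int.cast_add]
  nlinarith [sq_nonneg ((x i : ℝ) - y i)]

lemma znorm_neg {d : ℕ} (x : Fin d → ℤ) : znorm (-x) = znorm x := by simp [znorm]

lemma shell_add_le {d : ℕ} {x y : Fin d → ℤ} (h : 4 * znorm y ^ 2 ≤ 4 ^ shell x) :
    shell (x + y) ≤ shell x + 1 ∧ shell x ≤ shell (x + y) + 1 := by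
  have h1 := four_pow_shell_le x
  have h2 := lt_four_pow_shell x
  have h3 := four_pow_shell_le (x + y)
  have h4 := lt_four_pow_shell (x + y)
  have h5 := znorm_add_sq_le x y
  have h6 := znorm_add_sq_le (x + y) (-y)
  rw [add_neg_cancel_right, znorm_neg] at h6
  have h40 : (1 : ℝ) ≤ 4 ^ shell x := one_le_pow₀ (by norm_num)
  have hm : (1 : ℝ) < 4 := by norm_num
  rw [pow_succ (4 : ℝ)] at h2
  constructor
  · have : (4 : ℝ) ^ shell (x + y) < 4 ^ (shell x + 1 + 1) := by
      rw [pow_succ, pow_succ]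
      linarith
    have := (pow_lt_pow_iff_right₀ hm).1 this
    omega
  · have : (4 : ℝ) ^ shell x < 4 ^ (shell (x + y) + 1 + 1) := by
      rw [pow_succ]
      linarith
    have := (pow_lt_pow_iff_right₀ hm).1 this
    omega

/-- The side of the averaging box at `x`, comparable with `η (|x| + 1)`. -/
def boxScale {d : ℕ} (η : ℝ) (x : Fin d → ℤ) : ℕ := ⌈η * 2 ^ shell x⌉₊

lemma tsum_indicator_shell_le {d : ℕ} (f : (Fin d → ℤ) → ℝ≥0∞) :
    ∑' m : ℕ, ∑' y, {y : Fin d → ℤ | shell y ≤ m + 1 ∧ m ≤ shell y + 1}.indicator f y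
      ≤ 3 * ∑' y, f y := by
  rw [ENNReal.tsum_comm, ← ENNReal.tsum_mul_left]
  refine ENNReal.tsum_le_tsum fun y => ?_
  have hsupp : ∀ m ∉ Finset.Icc (shell y - 1) (shell y + 1),
      {y : Fin d → ℤ | shell y ≤ m + 1 ∧ m ≤ shell y + 1}.indicator f y = 0 := by
    intro m hm
    refine Set.indicator_of_notMem (fun hc => hm ?_) f
    simp only [Set.mem_ofPred_eq] at hc
    simp only [Finset.mem_Icc]
    omega
  rw [tsum_eq_sum hsupp]
  calc _ ≤ ∑ _m ∈ Finset.Icc (shell y - 1) (shell y + 1), f y :=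
        Finset.sum_le_sum fun m _ => Set.indicator_le_self _ _ _
    _ = ((shell y + 1 + 1 - (shell y - 1) : ℕ) : ℝ≥0∞) * f y := by simp
    _ ≤ 3 * f y := by
        gcongr
        have : shell y + 1 + 1 - (shell y - 1) ≤ 3 := by omega
        exact_mod_cast this

lemma tsum_shell {d : ℕ} (f : (Fin d → ℤ) → ℝ≥0∞) :
    ∑' x, f x = ∑' m : ℕ, ∑' x, {x : Fin d → ℤ | shell x = m}.indicator f x := by
  rw [ENNReal.tsum_comm]
  refine tsum_congr fun x => ?_
  rw [tsum_eq_single (shell x)]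
  · simp
  · intro m hm
    simp [hm.symm]

/-- A Poincaré type inequality for averages over boxes of size proportional to `η (|x| + 1)`. -/
lemma poincare_boxAvg {d : ℕ} {η : ℝ} (hη : 0 < η) (hηd : 2 * d * η ≤ 1)
    (u : (Fin d → ℤ) → ℂ) :
    ∑' x, ENNReal.ofReal ((znorm x ^ 2 + 1)⁻¹) *
        (‖u x - boxAvg (boxScale η x) u x‖₊ : ℝ≥0∞) ^ 2
      ≤ ENNReal.ofReal (3 * d ^ 2 * η ^ 2) * Q0 u := by
  have hshell (m : ℕ) : ∑' x, {x : Fin d → ℤ | shell x = m}.indicator (fun x =>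
      ENNReal.ofReal ((znorm x ^ 2 + 1)⁻¹) *
        (‖u x - boxAvg (boxScale η x) u x‖₊ : ℝ≥0∞) ^ 2) x ≤ ENNReal.ofReal (d ^ 2 * η ^ 2) *
      ∑' y, {y : Fin d → ℤ | shell y ≤ m + 1 ∧ m ≤ shell y + 1}.indicator (gradSq u) y := by
    set n : ℕ := ⌈η * 2 ^ m⌉₊ with hn
    set A : Set (Fin d → ℤ) := {x | shell x = m} with hA
    set B : Set (Fin d → ℤ) := {y | shell y ≤ m + 1 ∧ m ≤ shell y + 1} with hB
    set D := ∑' y, B.indicator (gradSq u) y with hD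
    have hn1 : 0 < n := Nat.ceil_pos.2 (by positivity)
    have : NeZero n := ⟨hn1.ne'⟩
    have hlt (k : ℕ) (hk : k < n) : (k : ℝ) ≤ η * 2 ^ m := (Nat.lt_ceil.1 hk).le
    have hshift (h : Fin d → Fin n) : ∑' x, A.indicator (fun x =>
        (‖u (x + boxPoint h) - u x‖₊ : ℝ≥0∞) ^ 2) x
        ≤ ENNReal.ofReal ((d * (η * 2 ^ m)) ^ 2) * D := by
      refine (tsum_translate_sub_sq_le u A B _ (fun i => (h i : ℕ)) rfl ?_).trans ?_
      · intro g hg x hx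
        have hgn (i : Fin d) : g i < n := (hg i).trans_lt (h i).2
        have hy := znorm_boxPoint_sq_le hlt fun i => (⟨g i, hgn i⟩ : Fin n)
        simp only [hA, Set.mem_ofPred_eq] at hx
        have := shell_add_le (x := x) (y := fun i => (g i : ℤ)) (by
          rw [hx]
          have e : (4 : ℝ) ^ m = (2 ^ m) ^ 2 := by
            rw [← pow_mul, mul_comm, pow_mul]
            norm_num
          have h2 : (0 : ℝ) < 2 ^ m := by positivity
          have h3 : 4 * (d : ℝ) * η ^ 2 ≤ 1 := by
            rcases Nat.eq_zero_or_pos d with rfl | hd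
            · simp
            · have : (1 : ℝ) ≤ d := by exact_mod_cast hd
              have : (d : ℝ) ≤ d ^ 2 := by nlinarith
              calc 4 * (d : ℝ) * η ^ 2 ≤ 4 * d ^ 2 * η ^ 2 := by gcongr
                _ = (2 * d * η) ^ 2 := by ring
                _ ≤ 1 := pow_le_one₀ (by positivity) hηd
          calc 4 * znorm (fun i => (g i : ℤ)) ^ 2 ≤ 4 * (d * (η * 2 ^ m) ^ 2) := by
                gcongr
                exact hy
            _ = 4 * d * η ^ 2 * (2 ^ m) ^ 2 := by ring
            _ ≤ 1 * (2 ^ m) ^ 2 := by gcongr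
            _ = 4 ^ m := by rw [e, one_mul])
        rw [hx] at this
        exact this
      · gcongr
        have h1 : ((∑ i, (h i : ℕ) : ℕ) : ℝ) ≤ d * (η * 2 ^ m) := by
          push_cast
          calc ∑ i, ((h i : ℕ) : ℝ) ≤ ∑ _i : Fin d, η * 2 ^ m :=
                Finset.sum_le_sum fun i _ => hlt _ (h i).2
            _ = _ := by simp
        rw [ENNReal.ofReal_pow (by positivity)]
        gcongr
        rw [← ENNReal.ofReal_natCast]
        exact ENNReal.ofReal_le_ofReal h1
    have hpt (x : Fin d → ℤ) : A.indicator (fun x => ENNReal.ofReal ((znorm x ^ 2 + 1)⁻¹) *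
        (‖u x - boxAvg (boxScale η x) u x‖₊ : ℝ≥0∞) ^ 2) x
        ≤ ENNReal.ofReal ((4 ^ m)⁻¹) * ((Fintype.card (Fin d → Fin n) : ℝ≥0∞)⁻¹ *
          ∑ h : Fin d → Fin n, A.indicator (fun x =>
            (‖u (x + boxPoint h) - u x‖₊ : ℝ≥0∞) ^ 2) x) := by
      by_cases hx : x ∈ A
      · simp only [Set.indicator_of_mem hx]
        have hxm : shell x = m := hx
        have hw := four_pow_shell_le x
        rw [hxm] at hw
        have hscale : boxScale η x = n := by rw [boxScale, hxm]
        rw [hscale]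
        gcongr
        have hc : (Fintype.card (Fin d → Fin n) : ℂ) ≠ 0 := by
          exact_mod_cast Fintype.card_ne_zero
        have e : u x - boxAvg n u x = -((Fintype.card (Fin d → Fin n) : ℂ)⁻¹ *
            ∑ h : Fin d → Fin n, (u (x + boxPoint h) - u x)) := by
          rw [Finset.sum_sub_distrib, mul_sub, boxAvg, Finset.sum_const, Finset.card_univ,
            nsmul_eq_mul, inv_mul_cancel_left₀ hc]
          ring
        rw [e, nnnorm_neg]
        exact nnnorm_smul_sum_sq_le _
      · simp [hx]
    calc _ ≤ _ := ENNReal.tsum_le_tsum hpt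
      _ = ENNReal.ofReal ((4 ^ m)⁻¹) * ((Fintype.card (Fin d → Fin n) : ℝ≥0∞)⁻¹ *
          ∑ h : Fin d → Fin n, ∑' x, A.indicator (fun x =>
            (‖u (x + boxPoint h) - u x‖₊ : ℝ≥0∞) ^ 2) x) := by
          rw [ENNReal.tsum_mul_left, ENNReal.tsum_mul_left,
            Summable.tsum_finsetSum fun _ _ => ENNReal.summable]
      _ ≤ ENNReal.ofReal ((4 ^ m)⁻¹) * ((Fintype.card (Fin d → Fin n) : ℝ≥0∞)⁻¹ *
          ∑ _h : Fin d → Fin n, ENNReal.ofReal ((d * (η * 2 ^ m)) ^ 2) * D) := by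
          gcongr with h
          exact hshift h
      _ = ENNReal.ofReal ((4 ^ m)⁻¹) * (ENNReal.ofReal ((d * (η * 2 ^ m)) ^ 2) * D) := by
          rw [Finset.sum_const, Finset.card_univ, nsmul_eq_mul, ← mul_assoc (_)⁻¹,
            ENNReal.inv_mul_cancel (by simp [hn1.ne']) (by simp), one_mul]
      _ = _ := by
          rw [← mul_assoc, ← ENNReal.ofReal_mul (by positivity)]
          congr 2
          have e : (4 : ℝ) ^ m = (2 ^ m) ^ 2 := by
            rw [← pow_mul, mul_comm, pow_mul]
            norm_num
          rw [e]
          field_simp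
  rw [tsum_shell]
  calc _ ≤ _ := ENNReal.tsum_le_tsum hshell
    _ ≤ ENNReal.ofReal (d ^ 2 * η ^ 2) * (3 * ∑' y, gradSq u y) := by
        rw [ENNReal.tsum_mul_left]
        gcongr
        exact tsum_indicator_shell_le _
    _ = _ := by
        have e : ENNReal.ofReal (3 * d ^ 2 * η ^ 2) = ENNReal.ofReal (d ^ 2 * η ^ 2) * 3 := by
          rw [mul_assoc, mul_comm, ENNReal.ofReal_mul (by positivity)]
          simp
        rw [e, mul_assoc]
        rfl

lemma eq_zero_of_Q0_eq_zero {d : ℕ} (hd : 3 ≤ d) {u : (Fin d → ℤ) → ℂ}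
    (hu : (Function.support u).Finite) (h : Q0 u = 0) : u = 0 := by
  have hH := hardy_inequality hd hu
  rw [h, mul_zero, nonpos_iff_eq_zero, ENNReal.tsum_eq_zero] at hH
  ext x
  have hw : ENNReal.ofReal ((znorm x ^ 2 + 1)⁻¹) ≠ 0 := by
    rw [ne_eq, ENNReal.ofReal_eq_zero, not_le]
    positivity
  have := (mul_eq_zero.1 (hH x)).resolve_left hw
  simpa using this

/-- The discrete gradient, on a space of finitely supported functions. -/
def gradLp {d : ℕ} (L : Submodule ℂ ((Fin d → ℤ) → ℂ))
    (hL : ∀ u ∈ L, (Function.support u).Finite) :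
    L →ₗ[ℂ] lp (fun _ : (Fin d → ℤ) × Fin d => ℂ) 2 where
  toFun u := ⟨fun p => (u : (Fin d → ℤ) → ℂ) (p.1 + latUnit d p.2) - (u : (Fin d → ℤ) → ℂ) p.1, by
    refine Memℓp.of_exponent_ge (memℓp_zero ?_) (zero_le (a := (2 : ℝ≥0∞)))
    have h1 (j : Fin d) := ((hL u u.2).preimage (add_left_injective (latUnit d j)).injOn).union
      (hL u u.2)
    refine ((Set.finite_iUnion fun j => (h1 j).prod (Set.finite_singleton j))).subset ?_
    rintro ⟨x, j⟩ hx
    refine Set.mem_iUnion.2 ⟨j, ?_, rfl⟩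
    by_contra hc
    simp only [Set.mem_union, Set.mem_preimage, Function.mem_support, not_or, not_not] at hc
    exact hx (by simp [hc.1, hc.2])⟩
  map_add' u v := by
    ext p
    exact add_sub_add_comm _ _ _ _
  map_smul' c u := by
    ext p
    simp
    ring

lemma Q0_eq_norm_gradLp {d : ℕ} {L : Submodule ℂ ((Fin d → ℤ) → ℂ)}
    (hL : ∀ u ∈ L, (Function.support u).Finite) (u : L) :
    Q0 (u : (Fin d → ℤ) → ℂ) = (‖gradLp L hL u‖₊ : ℝ≥0∞) ^ 2 := by
  have hs := lp.hasSum_norm (p := 2) (by norm_num) (gradLp L hL u)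
  have h2 : (‖gradLp L hL u‖₊ : ℝ≥0∞) ^ 2
      = ENNReal.ofReal (∑' p, ‖(gradLp L hL u) p‖ ^ (2 : ℝ≥0∞).toReal) := by
    rw [hs.tsum_eq]
    simp only [ENNReal.toReal_ofNat, Real.rpow_ofNat]
    rw [ENNReal.ofReal_pow (norm_nonneg _), ofReal_norm]
    rfl
  rw [h2, ENNReal.ofReal_tsum_of_nonneg (fun p => by positivity) hs.summable,
    ENNReal.tsum_prod']
  refine tsum_congr fun x => ?_
  rw [tsum_fintype]
  refine Finset.sum_congr rfl fun j _ => ?_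
  simp only [ENNReal.toReal_ofNat, Real.rpow_ofNat]
  rw [ENNReal.ofReal_pow (norm_nonneg _), ofReal_norm]
  rfl

/-- Every finite-dimensional space of finitely supported functions has a basis that is orthonormal
for the Dirichlet form. -/
lemma exists_Q0_orthonormal {d : ℕ} (hd : 3 ≤ d) (L : Submodule ℂ ((Fin d → ℤ) → ℂ))
    (hL : ∀ u ∈ L, (Function.support u).Finite) [FiniteDimensional ℂ L] :
    ∃ v : Fin (Module.finrank ℂ L) → L, ∀ c : Fin (Module.finrank ℂ L) → ℂ,
      Q0 ((∑ i, c i • v i : L) : (Fin d → ℤ) → ℂ) = ∑ i, (‖c i‖₊ : ℝ≥0∞) ^ 2 := by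
  have hinj : Function.Injective (gradLp L hL) := by
    rw [injective_iff_map_eq_zero]
    intro u hu
    have h0 : Q0 (u : (Fin d → ℤ) → ℂ) = 0 := by
      rw [Q0_eq_norm_gradLp hL, hu]
      simp
    exact Subtype.ext (eq_zero_of_Q0_eq_zero hd (hL u u.2) h0)
  have hrank : Module.finrank ℂ (LinearMap.range (gradLp L hL)) = Module.finrank ℂ L :=
    LinearMap.finrank_range_of_inj hinj
  let b := (stdOrthonormalBasis ℂ (LinearMap.range (gradLp L hL))).reindex (finCongr hrank)
  choose v hv using fun i => (b i).2
  refine ⟨v, fun c => ?_⟩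
  have hsum : gradLp L hL (∑ i, c i • v i) = ((∑ i, c i • b i : LinearMap.range (gradLp L hL)) :
      lp (fun _ : (Fin d → ℤ) × Fin d => ℂ) 2) := by
    simp [map_sum, hv]
  rw [Q0_eq_norm_gradLp hL, hsum]
  have h1 : ‖∑ i, c i • b i‖ ^ 2 = ∑ i, ‖c i‖ ^ 2 := by
    rw [← b.sum_sq_norm_inner_right]
    refine Finset.sum_congr rfl fun i _ => ?_
    rw [b.orthonormal.inner_right_fintype]
  have h2 : ‖∑ i, c i • b i‖₊ ^ 2 = ∑ i, ‖c i‖₊ ^ 2 := by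
    ext
    push_cast
    exact h1
  rw [show ‖((∑ i, c i • b i : LinearMap.range (gradLp L hL)) :
      lp (fun _ : (Fin d → ℤ) × Fin d => ℂ) 2)‖₊ = ‖∑ i, c i • b i‖₊ from rfl]
  exact_mod_cast h2

/-- Bessel's inequality for the Dirichlet form. -/
lemma bessel_Q0 {d N : ℕ} {L : Submodule ℂ ((Fin d → ℤ) → ℂ)} {v : Fin N → L}
    (hv : ∀ c : Fin N → ℂ, Q0 ((∑ i, c i • v i : L) : (Fin d → ℤ) → ℂ)
      = ∑ i, (‖c i‖₊ : ℝ≥0∞) ^ 2)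
    (φ : ((Fin d → ℤ) → ℂ) →ₗ[ℂ] ℂ) (K : ℝ≥0∞)
    (hK : ∀ u ∈ L, (‖φ u‖₊ : ℝ≥0∞) ^ 2 ≤ K * Q0 u) :
    ∑ i, (‖φ (v i)‖₊ : ℝ≥0∞) ^ 2 ≤ K := by
  set S := ∑ i, (‖φ (v i)‖₊ : ℝ≥0∞) ^ 2 with hS
  rcases eq_or_ne S 0 with h0 | h0
  · rw [h0]
    exact zero_le
  have htop : S ≠ ∞ := by
    rw [hS]
    exact ENNReal.sum_ne_top.2 fun i _ => by simp
  set w : L := ∑ i, (starRingEnd ℂ) (φ (v i)) • v i with hw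
  have hQ : Q0 (w : (Fin d → ℤ) → ℂ) = S := by
    rw [hw, hv]
    simp [hS]
  have hφ : φ w = ((∑ i, ‖φ (v i)‖₊ ^ 2 : ℝ≥0) : ℂ) := by
    simp only [hw, Submodule.coe_sum, Submodule.coe_smul, map_sum, map_smul, smul_eq_mul]
    push_cast
    refine Finset.sum_congr rfl fun i _ => ?_
    rw [Complex.conj_mul']
  have hφS : (‖φ w‖₊ : ℝ≥0∞) = S := by
    rw [hφ, hS]
    have : ‖((∑ i, ‖φ (v i)‖₊ ^ 2 : ℝ≥0) : ℂ)‖₊ = ∑ i, ‖φ (v i)‖₊ ^ 2 := by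
      ext
      rw [coe_nnnorm, Complex.norm_real, Real.norm_of_nonneg (NNReal.coe_nonneg _)]
    rw [this]
    push_cast
    rfl
  have := hK w w.2
  rw [hφS, hQ, sq] at this
  exact (ENNReal.mul_le_mul_iff_left h0 htop).1 this

/-- Box averaging at a point, as a linear functional. -/
def boxAvgLinear {d : ℕ} (n : ℕ) (x : Fin d → ℤ) : ((Fin d → ℤ) → ℂ) →ₗ[ℂ] ℂ where
  toFun u := boxAvg n u x
  map_add' u v := by simp [boxAvg, Finset.sum_add_distrib, mul_add]
  map_smul' c u := by
    simp only [boxAvg, Pi.smul_apply, smul_eq_mul, ← Finset.mul_sum, RingHom.id_apply]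
    ring

/-- The set on which `(|x|² + 1) V(x)` lies between `2 ^ k * τ` and `2 ^ (k + 1) * τ`. -/
def levelSet {d : ℕ} (V : (Fin d → ℤ) → ℝ) (τ : ℝ) (k : ℕ) : Set (Fin d → ℤ) :=
  {x | 2 ^ k * τ < (znorm x ^ 2 + 1) * V x ∧ (znorm x ^ 2 + 1) * V x ≤ 2 ^ (k + 1) * τ}

lemma le_or_exists_mem_levelSet {d : ℕ} (V : (Fin d → ℤ) → ℝ) {τ : ℝ} (hτ : 0 < τ)
    (x : Fin d → ℤ) :
    (znorm x ^ 2 + 1) * V x ≤ τ ∨ ∃ k, x ∈ levelSet V τ k := by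
  rcases le_or_gt ((znorm x ^ 2 + 1) * V x) τ with h | h
  · exact Or.inl h
  · right
    have hex : ∃ k : ℕ, (znorm x ^ 2 + 1) * V x ≤ 2 ^ (k + 1) * τ := by
      obtain ⟨k, hk⟩ := pow_unbounded_of_one_lt ((znorm x ^ 2 + 1) * V x / τ)
        (one_lt_two (α := ℝ))
      refine ⟨k, ((div_lt_iff₀ hτ).1 hk).le.trans ?_⟩
      gcongr
      · norm_num
      · omega
    classical
    refine ⟨Nat.find hex, ?_, Nat.find_spec hex⟩
    rcases hk : Nat.find hex with _ | k
    · simpa using h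
    · exact not_le.1 (Nat.find_min hex (hk ▸ k.lt_succ_self))

/-- Splitting of `b_V` into a part dominated by the Hardy weight, box averages and oscillations. -/
lemma bV_le {d : ℕ} (hd : 3 ≤ d) {V : (Fin d → ℤ) → ℝ} {τ : ℝ} (hτ : 0 < τ)
    {η : ℕ → ℝ} (hη : ∀ k, 0 < η k) (hηd : ∀ k, 2 * d * η k ≤ 1)
    {u : (Fin d → ℤ) → ℂ} (hu : (Function.support u).Finite) :
    bV V u ≤ ENNReal.ofReal (32000 * d ^ 3 * τ) * Q0 u +
      ∑' k : ℕ, (ENNReal.ofReal (2 ^ (k + 2) * τ) * ∑' x, (levelSet V τ k).indicator (fun x =>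
          ENNReal.ofReal ((znorm x ^ 2 + 1)⁻¹) *
            (‖boxAvg (boxScale (η k) x) u x‖₊ : ℝ≥0∞) ^ 2) x
        + ENNReal.ofReal (2 ^ (k + 2) * τ * (3 * d ^ 2 * η k ^ 2)) * Q0 u) := by
  set A : ℕ → (Fin d → ℤ) → ℝ≥0∞ := fun k x => (levelSet V τ k).indicator (fun x =>
    ENNReal.ofReal ((znorm x ^ 2 + 1)⁻¹) * (‖boxAvg (boxScale (η k) x) u x‖₊ : ℝ≥0∞) ^ 2) x
    with hA
  set B : ℕ → (Fin d → ℤ) → ℝ≥0∞ := fun k x => ENNReal.ofReal ((znorm x ^ 2 + 1)⁻¹) *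
    (‖u x - boxAvg (boxScale (η k) x) u x‖₊ : ℝ≥0∞) ^ 2 with hB
  have hpt (x : Fin d → ℤ) : ENNReal.ofReal (V x) * (‖u x‖₊ : ℝ≥0∞) ^ 2 ≤
      ENNReal.ofReal τ * (ENNReal.ofReal ((znorm x ^ 2 + 1)⁻¹) * (‖u x‖₊ : ℝ≥0∞) ^ 2) +
      ∑' k : ℕ, (ENNReal.ofReal (2 ^ (k + 2) * τ) * A k x
        + ENNReal.ofReal (2 ^ (k + 2) * τ) * B k x) := by
    have hR : 0 < znorm x ^ 2 + 1 := by positivity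
    have hbound {r : ℝ} (hr : 0 ≤ r) (h : (znorm x ^ 2 + 1) * V x ≤ r) :
        ENNReal.ofReal (V x) * (‖u x‖₊ : ℝ≥0∞) ^ 2 ≤ ENNReal.ofReal r *
          (ENNReal.ofReal ((znorm x ^ 2 + 1)⁻¹) * (‖u x‖₊ : ℝ≥0∞) ^ 2) := by
      rw [← mul_assoc, ← ENNReal.ofReal_mul hr]
      gcongr
      rw [← div_eq_mul_inv, le_div_iff₀ hR]
      linarith
    rcases le_or_exists_mem_levelSet V hτ x with h | ⟨k, hk⟩
    · exact (hbound hτ.le h).trans le_self_add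
    · refine le_trans ?_ (le_add_left (ENNReal.le_tsum k))
      refine (hbound (by positivity) hk.2).trans ?_
      have e1 : ENNReal.ofReal (2 ^ (k + 2) * τ) = ENNReal.ofReal (2 ^ (k + 1) * τ) * 2 := by
        rw [pow_succ, show (2 : ℝ) ^ (k + 1) * 2 * τ = 2 ^ (k + 1) * τ * 2 by ring,
          ENNReal.ofReal_mul (by positivity)]
        simp
      have e2 := nnnorm_add_sq_le (boxAvg (boxScale (η k) x) u x)
        (u x - boxAvg (boxScale (η k) x) u x) 1
      rw [add_sub_cancel] at e2
      simp only [Nat.cast_one, one_mul, one_add_one_eq_two] at e2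
      rw [e1, mul_assoc, mul_assoc, ← mul_add]
      gcongr
      simp only [hA, hB, Set.indicator_of_mem hk]
      calc _ ≤ ENNReal.ofReal ((znorm x ^ 2 + 1)⁻¹) *
            (2 * (‖boxAvg (boxScale (η k) x) u x‖₊ : ℝ≥0∞) ^ 2 +
              2 * (‖u x - boxAvg (boxScale (η k) x) u x‖₊ : ℝ≥0∞) ^ 2) := by
            gcongr
        _ = _ := by ring
  calc bV V u ≤ _ := ENNReal.tsum_le_tsum hpt
    _ = ENNReal.ofReal τ * ∑' x, (ENNReal.ofReal ((znorm x ^ 2 + 1)⁻¹) * (‖u x‖₊ : ℝ≥0∞) ^ 2) +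
      ∑' k : ℕ, (ENNReal.ofReal (2 ^ (k + 2) * τ) * ∑' x, A k x
        + ENNReal.ofReal (2 ^ (k + 2) * τ) * ∑' x, B k x) := by
        rw [ENNReal.tsum_add, ENNReal.tsum_mul_left, ENNReal.tsum_comm]
        simp only [ENNReal.tsum_add, ENNReal.tsum_mul_left]
    _ ≤ _ := by
        refine add_le_add ?_ (ENNReal.tsum_le_tsum fun k => add_le_add le_rfl ?_)
        · rw [mul_comm (_ * _) τ, ENNReal.ofReal_mul hτ.le, mul_assoc]
          gcongr
          exact hardy_inequality hd hu
        · rw [ENNReal.ofReal_mul (p := 2 ^ (k + 2) * τ) (by positivity), mul_assoc]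
          gcongr
          exact poincare_boxAvg (hη k) (hηd k) u

lemma boxScale_weight_le {d : ℕ} (hd : 3 ≤ d) {η : ℝ} (hη : 0 < η) (x : Fin d → ℤ) :
    (znorm x ^ 2 + 1)⁻¹ * ((boxScale η x : ℝ) ^ (d - 2))⁻¹
      ≤ (2 / η) ^ (d - 2) * (znorm x ^ 2 + 1) ^ (-(d : ℝ) / 2) := by
  set R : ℝ := √(znorm x ^ 2 + 1) with hR
  have hpos : 0 < znorm x ^ 2 + 1 := by positivity
  have hR0 : 0 < R := Real.sqrt_pos.2 hpos
  have hR2 : znorm x ^ 2 + 1 = R ^ 2 := (Real.sq_sqrt hpos.le).symm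
  have hpow : (znorm x ^ 2 + 1) ^ (-(d : ℝ) / 2) = (R ^ d)⁻¹ := by
    rw [hR2, ← Real.rpow_natCast R 2, ← Real.rpow_mul hR0.le, ← Real.rpow_natCast R d,
      ← Real.rpow_neg hR0.le]
    congr 1
    push_cast
    ring
  have hRshell : R ≤ 2 ^ (shell x + 1) := by
    rw [hR, Real.sqrt_le_left (by positivity), ← pow_mul, mul_comm, pow_mul]
    norm_num
    exact (lt_four_pow_shell x).le
  have hsc : η / 2 * R ≤ boxScale η x := by
    refine le_trans ?_ (Nat.le_ceil _)
    calc η / 2 * R ≤ η / 2 * 2 ^ (shell x + 1) := by gcongr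
      _ = _ := by ring
  have hRd : R ^ d = R ^ (d - 2) * R ^ 2 := by
    rw [← pow_add]
    congr 1
    omega
  rw [hpow, hR2, hRd]
  calc (R ^ 2)⁻¹ * ((boxScale η x : ℝ) ^ (d - 2))⁻¹
      ≤ (R ^ 2)⁻¹ * ((η / 2 * R) ^ (d - 2))⁻¹ := by gcongr
    _ = _ := by
        rw [mul_pow, mul_inv, mul_inv, ← inv_pow (η / 2), inv_div]
        ring

/-- Summation of box averages of an orthonormal family over a set. -/
lemma sum_boxAvg_le {d N : ℕ} (hd : 3 ≤ d) {L : Submodule ℂ ((Fin d → ℤ) → ℂ)}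
    (hL : ∀ u ∈ L, (Function.support u).Finite) {v : Fin N → L}
    (hv : ∀ c : Fin N → ℂ, Q0 ((∑ i, c i • v i : L) : (Fin d → ℤ) → ℂ)
      = ∑ i, (‖c i‖₊ : ℝ≥0∞) ^ 2) {η : ℝ} (hη : 0 < η) (A : Set (Fin d → ℤ)) :
    ∑ i, ∑' x, A.indicator (fun x => ENNReal.ofReal ((znorm x ^ 2 + 1)⁻¹) *
        (‖boxAvg (boxScale η x) (v i : (Fin d → ℤ) → ℂ) x‖₊ : ℝ≥0∞) ^ 2) x
      ≤ ENNReal.ofReal (64000 * d ^ 4 * (2 / η) ^ (d - 2)) *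
        ∑' x, A.indicator (fun x => ENNReal.ofReal ((znorm x ^ 2 + 1) ^ (-(d : ℝ) / 2))) x := by
  rw [← Summable.tsum_finsetSum fun _ _ => ENNReal.summable, ← ENNReal.tsum_mul_left]
  refine ENNReal.tsum_le_tsum fun x => ?_
  by_cases hx : x ∈ A
  · simp only [Set.indicator_of_mem hx]
    have hn : 1 ≤ boxScale η x := Nat.ceil_pos.2 (by positivity)
    have hn0 : (0 : ℝ) < boxScale η x := by exact_mod_cast hn
    rw [← Finset.mul_sum]
    calc _ ≤ ENNReal.ofReal ((znorm x ^ 2 + 1)⁻¹) *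
          ENNReal.ofReal (64000 * d ^ 4 * ((boxScale η x : ℝ) ^ (d - 2))⁻¹) := by
          gcongr
          exact bessel_Q0 hv (boxAvgLinear (boxScale η x) x) _
            fun u hu => boxAvg_sq_le hd hn (hL u hu) x
      _ ≤ _ := by
          rw [← ENNReal.ofReal_mul (by positivity), ← ENNReal.ofReal_mul (by positivity)]
          apply ENNReal.ofReal_le_ofReal
          have := boxScale_weight_le hd hη x
          calc _ = 64000 * (d : ℝ) ^ 4 *
                ((znorm x ^ 2 + 1)⁻¹ * ((boxScale η x : ℝ) ^ (d - 2))⁻¹) := by ring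
            _ ≤ 64000 * (d : ℝ) ^ 4 *
                ((2 / η) ^ (d - 2) * (znorm x ^ 2 + 1) ^ (-(d : ℝ) / 2)) := by gcongr
            _ = _ := by ring
  · simp [hx]

lemma tsum_levelSet_le {d : ℕ} (V : (Fin d → ℤ) → ℝ) {τ : ℝ} (hτ : 0 < τ) (q : ℝ) (k : ℕ) :
    ∑' x, (levelSet V τ k).indicator
        (fun x => ENNReal.ofReal ((znorm x ^ 2 + 1) ^ (-(d : ℝ) / 2))) x
      ≤ ENNReal.ofReal ((2 ^ k * τ) ^ (-q)) *
        ⨆ t : {t : ℝ // 0 < t}, ENNReal.ofReal (t.1 ^ q) *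
          ∑' x : {x : Fin d → ℤ // t.1 < (znorm x ^ 2 + 1) * V x},
            ENNReal.ofReal ((znorm x.1 ^ 2 + 1) ^ (-(d : ℝ) / 2)) := by
  set t : ℝ := 2 ^ k * τ with ht
  have ht0 : 0 < t := by positivity
  have h1 := le_iSup (fun t : {t : ℝ // 0 < t} => ENNReal.ofReal (t.1 ^ q) *
          ∑' x : {x : Fin d → ℤ // t.1 < (znorm x ^ 2 + 1) * V x},
            ENNReal.ofReal ((znorm x.1 ^ 2 + 1) ^ (-(d : ℝ) / 2))) ⟨t, ht0⟩
  calc _ ≤ ∑' x, {x : Fin d → ℤ | t < (znorm x ^ 2 + 1) * V x}.indicator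
        (fun x => ENNReal.ofReal ((znorm x ^ 2 + 1) ^ (-(d : ℝ) / 2))) x := by
        refine ENNReal.tsum_le_tsum fun x => ?_
        exact Set.indicator_le_indicator_of_subset (fun x hx => hx.1) (fun _ => zero_le) x
    _ = ENNReal.ofReal (t ^ (-q)) * (ENNReal.ofReal (t ^ q) *
          ∑' x : {x : Fin d → ℤ // t < (znorm x ^ 2 + 1) * V x},
            ENNReal.ofReal ((znorm x.1 ^ 2 + 1) ^ (-(d : ℝ) / 2))) := by
        rw [← mul_assoc, ← ENNReal.ofReal_mul (by positivity), ← Real.rpow_add ht0]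
        simp only [neg_add_cancel, Real.rpow_zero, ENNReal.ofReal_one, one_mul]
        exact (tsum_subtype {x : Fin d → ℤ | t < (znorm x ^ 2 + 1) * V x} _).symm
    _ ≤ _ := by gcongr

lemma tsum_ofReal_mul_pow {a r : ℝ} (ha : 0 ≤ a) (hr : 0 ≤ r) (hr1 : r < 1) :
    ∑' k : ℕ, ENNReal.ofReal (a * r ^ k) = ENNReal.ofReal (a * (1 - r)⁻¹) := by
  rw [← ENNReal.ofReal_tsum_of_nonneg (fun k => by positivity)
    ((summable_geometric_of_lt_one hr hr1).mul_left a), tsum_mul_left,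
    tsum_geometric_of_lt_one hr hr1]

lemma exists_scale_ratio {d : ℕ} (hd : 3 ≤ d) {q : ℝ} (hq : (d : ℝ) < 2 * q) :
    ∃ b : ℝ, 0 < b ∧ b < 1 ∧ 2 * b ^ 2 < 1 ∧ 2 * (b⁻¹) ^ (d - 2) * 2 ^ (-q) < 1 := by
  have hd' : (3 : ℝ) ≤ d := by exact_mod_cast hd
  have hm : (0 : ℝ) < d - 2 := by linarith
  obtain ⟨β, h1, h2⟩ := exists_between (a₁ := (1 / 2 : ℝ)) (a₂ := (q - 1) / (d - 2)) (by
    rw [lt_div_iff₀ hm]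
    linarith)
  rw [lt_div_iff₀ hm] at h2
  have h20 : (0 : ℝ) < 2 := two_pos
  refine ⟨2 ^ (-β), by positivity, Real.rpow_lt_one_of_one_lt_of_neg one_lt_two (by linarith),
    ?_, ?_⟩
  · rw [← Real.rpow_natCast, ← Real.rpow_mul h20.le]
    nth_rewrite 1 [← Real.rpow_one 2]
    rw [← Real.rpow_add h20]
    apply Real.rpow_lt_one_of_one_lt_of_neg one_lt_two
    push_cast
    linarith
  · rw [← Real.rpow_neg h20.le, ← Real.rpow_natCast, ← Real.rpow_mul h20.le]
    nth_rewrite 1 [← Real.rpow_one 2]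
    rw [← Real.rpow_add h20, ← Real.rpow_add h20]
    apply Real.rpow_lt_one_of_one_lt_of_neg one_lt_two
    rw [Nat.cast_sub (by omega)]
    push_cast
    linarith

/-- Choice of the scales at which averages are taken on the successive level sets. -/
lemma exists_scales {d : ℕ} (hd : 3 ≤ d) {q : ℝ} (hq : (d : ℝ) < 2 * q) :
    ∃ (η : ℕ → ℝ) (A : ℝ), 0 < A ∧ (∀ k, 0 < η k) ∧ (∀ k, 2 * d * η k ≤ 1) ∧
      (∀ τ : ℝ, 0 < τ → ∑' k, ENNReal.ofReal (2 ^ (k + 2) * τ * (3 * d ^ 2 * η k ^ 2))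
        ≤ ENNReal.ofReal τ) ∧
      ∀ τ : ℝ, 0 < τ → ∑' k : ℕ, ENNReal.ofReal (2 ^ (k + 2) * τ *
        (64000 * d ^ 4 * (2 / η k) ^ (d - 2)) * (2 ^ k * τ) ^ (-q))
        ≤ ENNReal.ofReal (A * τ ^ (1 - q)) := by
  obtain ⟨b, hb0, hb1, hb, hρ⟩ := exists_scale_ratio hd hq
  have hd' : (3 : ℝ) ≤ d := by exact_mod_cast hd
  set δ : ℝ := 1 - 2 * b ^ 2 with hδ
  have hδ0 : 0 < δ := by linarith
  have hδ1 : δ ≤ 1 := by nlinarith [sq_nonneg b]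
  set ρ : ℝ := 2 * (b⁻¹) ^ (d - 2) * 2 ^ (-q) with hρdef
  have hρ0 : 0 < ρ := by positivity
  have hρ1 : 0 < 1 - ρ := by linarith
  set η₀ : ℝ := δ / (48 * d) with hη₀
  have hη0 : 0 < η₀ := by positivity
  refine ⟨fun k => η₀ * b ^ k, 4 * (64000 * d ^ 4 * (2 / η₀) ^ (d - 2)) * (1 - ρ)⁻¹,
    by positivity, fun k => by positivity, fun k => ?_, fun τ hτ => ?_, fun τ hτ => ?_⟩
  · have hbk : b ^ k ≤ 1 := pow_le_one₀ hb0.le hb1.le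
    calc 2 * d * (η₀ * b ^ k) ≤ 2 * d * (η₀ * 1) := by gcongr
      _ = δ / 24 := by
          rw [hη₀]
          field_simp
          norm_num
      _ ≤ 1 := by linarith
  · have e (k : ℕ) : (2 : ℝ) ^ (k + 2) * τ * (3 * d ^ 2 * (η₀ * b ^ k) ^ 2)
        = 12 * τ * d ^ 2 * η₀ ^ 2 * (2 * b ^ 2) ^ k := by
      rw [mul_pow η₀, mul_pow 2, ← pow_mul, ← pow_mul, mul_comm k 2]
      ring
    simp only [e]
    rw [tsum_ofReal_mul_pow (by positivity) (by positivity) hb]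
    apply ENNReal.ofReal_le_ofReal
    rw [← hδ, hη₀]
    have : 12 * τ * d ^ 2 * (δ / (48 * d)) ^ 2 * δ⁻¹ = τ * (δ / 192) := by
      field_simp
      norm_num
    rw [this]
    nlinarith
  · have e (k : ℕ) : (2 : ℝ) ^ (k + 2) * τ * (64000 * d ^ 4 * (2 / (η₀ * b ^ k)) ^ (d - 2)) *
        (2 ^ k * τ) ^ (-q)
        = 4 * (64000 * d ^ 4 * (2 / η₀) ^ (d - 2)) * τ ^ (1 - q) * ρ ^ k := by
      have e1 : ((2 : ℝ) ^ k * τ) ^ (-q) = (2 ^ (-q)) ^ k * τ ^ (-q) := by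
        rw [Real.mul_rpow (by positivity) hτ.le, Real.rpow_pow_comm two_pos.le]
      have e2 : τ ^ (1 - q) = τ * τ ^ (-q) := by
        rw [sub_eq_add_neg, Real.rpow_add hτ, Real.rpow_one]
      have e3 : (2 / (η₀ * b ^ k)) ^ (d - 2) = (2 / η₀) ^ (d - 2) * ((b⁻¹) ^ (d - 2)) ^ k := by
        rw [← div_div, div_eq_mul_inv _ (b ^ k), mul_pow, ← inv_pow b k, ← pow_mul, ← pow_mul,
          mul_comm k]
      rw [e1, e2, e3, hρdef, mul_pow, mul_pow]
      ring
    simp only [e]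
    rw [tsum_ofReal_mul_pow (by positivity) hρ0.le hρ]
    apply ENNReal.ofReal_le_ofReal
    apply le_of_eq
    ring

/-- The bound for the dimension of a single admissible subspace, before absorption. -/
lemma mul_finrank_le {d : ℕ} (hd : 3 ≤ d) {V : (Fin d → ℤ) → ℝ} {s τ q : ℝ} (hτ : 0 < τ)
    {η : ℕ → ℝ} (hη : ∀ k, 0 < η k) (hηd : ∀ k, 2 * d * η k ≤ 1)
    (L : Submodule ℂ ((Fin d → ℤ) → ℂ)) (hL : ∀ u ∈ L, (Function.support u).Finite)
    [FiniteDimensional ℂ L] (hs : ∀ u ∈ L, u ≠ 0 → ENNReal.ofReal s * Q0 u < bV V u) :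
    ENNReal.ofReal s * Module.finrank ℂ L ≤
      ENNReal.ofReal (32000 * d ^ 3 * τ) * Module.finrank ℂ L +
      ((∑' k : ℕ, ENNReal.ofReal (2 ^ (k + 2) * τ *
        (64000 * d ^ 4 * (2 / η k) ^ (d - 2)) * (2 ^ k * τ) ^ (-q))) *
        (⨆ t : {t : ℝ // 0 < t}, ENNReal.ofReal (t.1 ^ q) *
          ∑' x : {x : Fin d → ℤ // t.1 < (znorm x ^ 2 + 1) * V x},
            ENNReal.ofReal ((znorm x.1 ^ 2 + 1) ^ (-(d : ℝ) / 2))) +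
      (∑' k, ENNReal.ofReal (2 ^ (k + 2) * τ * (3 * d ^ 2 * η k ^ 2))) *
        Module.finrank ℂ L) := by
  obtain ⟨v, hv⟩ := exists_Q0_orthonormal hd L hL
  set M := ⨆ t : {t : ℝ // 0 < t}, ENNReal.ofReal (t.1 ^ q) *
          ∑' x : {x : Fin d → ℤ // t.1 < (znorm x ^ 2 + 1) * V x},
            ENNReal.ofReal ((znorm x.1 ^ 2 + 1) ^ (-(d : ℝ) / 2)) with hM
  have hQ (i) : Q0 (v i : (Fin d → ℤ) → ℂ) = 1 := by
    have h := hv (Pi.single i 1)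
    rw [Finset.sum_eq_single i (fun j _ hj => by simp [hj]) (by simp),
      Finset.sum_eq_single i (fun j _ hj => by simp [hj]) (by simp)] at h
    simpa using h
  have hle (i) : ENNReal.ofReal s ≤ bV V (v i : (Fin d → ℤ) → ℂ) := by
    have h0 : (v i : (Fin d → ℤ) → ℂ) ≠ 0 := by
      intro h0
      have := hQ i
      rw [h0] at this
      simp [Q0] at this
    simpa [hQ i] using (hs _ (v i).2 h0).le
  calc ENNReal.ofReal s * Module.finrank ℂ L
      = ∑ _i : Fin (Module.finrank ℂ L), ENNReal.ofReal s := by simp [mul_comm]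
    _ ≤ ∑ i, _ := Finset.sum_le_sum fun i _ => (hle i).trans (bV_le hd hτ hη hηd (hL _ (v i).2))
    _ = ENNReal.ofReal (32000 * d ^ 3 * τ) * Module.finrank ℂ L +
        ∑' k : ℕ, (ENNReal.ofReal (2 ^ (k + 2) * τ) * (∑ i, ∑' x,
          (levelSet V τ k).indicator (fun x => ENNReal.ofReal ((znorm x ^ 2 + 1)⁻¹) *
            (‖boxAvg (boxScale (η k) x) (v i : (Fin d → ℤ) → ℂ) x‖₊ : ℝ≥0∞) ^ 2) x) +
          ENNReal.ofReal (2 ^ (k + 2) * τ * (3 * d ^ 2 * η k ^ 2)) * Module.finrank ℂ L) := by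
        simp only [hQ, mul_one]
        rw [Finset.sum_add_distrib, ← Summable.tsum_finsetSum fun _ _ => ENNReal.summable]
        simp only [Finset.sum_add_distrib, Finset.mul_sum, Finset.sum_const, Finset.card_univ,
          Fintype.card_fin, nsmul_eq_mul, mul_comm]
    _ ≤ _ := by
        rw [← ENNReal.tsum_mul_right, ← ENNReal.tsum_mul_right, ← ENNReal.tsum_add]
        refine add_le_add le_rfl (ENNReal.tsum_le_tsum fun k => add_le_add ?_ le_rfl)
        have hηk := hη k
        calc _ ≤ ENNReal.ofReal (2 ^ (k + 2) * τ) *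
              (ENNReal.ofReal (64000 * d ^ 4 * (2 / η k) ^ (d - 2)) *
                (ENNReal.ofReal ((2 ^ k * τ) ^ (-q)) * M)) := by
              gcongr
              refine (sum_boxAvg_le hd hL hv hηk _).trans ?_
              gcongr
              exact tsum_levelSet_le V hτ q k
          _ = _ := by
              rw [← mul_assoc, ← mul_assoc, ← ENNReal.ofReal_mul (by positivity),
                ← ENNReal.ofReal_mul (by positivity)]

/-- the estimate of Corollary 5.3 with the standard Hardy weight
`(|x|²+1)^{−1}`: `n(s,V) ≤ C s^{−q} sup_{t>0} t^q Σ_{(|x|²+1)V(x)>t} (|x|²+1)^{−d/2}`. -/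
theorem estimate_standard_weight (d : ℕ) (hd : 3 ≤ d) (q : ℝ) (hq : (d : ℝ) < 2 * q) :
    ∃ C : ℝ, 0 < C ∧
      ∀ V : (Fin d → ℤ) → ℝ, (∀ x, 0 ≤ V x) →
      ∀ s : ℝ, 0 < s →
        (nCount d V s : ℝ≥0∞) ≤
          ENNReal.ofReal C * ENNReal.ofReal s ^ (-q) *
            ⨆ t : {t : ℝ // 0 < t},
              ENNReal.ofReal (t.1 ^ q) *
                ∑' x : {x : Fin d → ℤ // t.1 < (znorm x ^ 2 + 1) * V x},
                  ENNReal.ofReal ((znorm x.1 ^ 2 + 1) ^ (-(d : ℝ) / 2)) := by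
  obtain ⟨η, A, hA, hη, hηd, h1, h2⟩ := exists_scales hd hq
  have hd' : (3 : ℝ) ≤ d := by exact_mod_cast hd
  set c : ℝ := (4 * (32000 * d ^ 3))⁻¹ with hc
  have hc0 : 0 < c := by positivity
  have hc1 : c ≤ 1 / 4 := by
    have : (1 : ℝ) ≤ d ^ 3 := one_le_pow₀ (by linarith)
    rw [hc, one_div]
    gcongr
    linarith
  refine ⟨2 * (A * c ^ (1 - q)), by positivity, fun V _ s hs => ?_⟩
  rw [nCount, ENat.toENNReal_iSup]
  refine iSup_le fun ⟨L, hL, hfin, hadm⟩ => ?_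
  have hτ : 0 < c * s := by positivity
  have key := mul_finrank_le (q := q) hd hτ hη hηd L hL hadm
  simp only [ENat.toENNReal_coe]
  set N : ℝ≥0∞ := (Module.finrank ℂ L : ℝ≥0∞) with hN
  have hN' : N ≠ ∞ := ENNReal.natCast_ne_top _
  set M := ⨆ t : {t : ℝ // 0 < t}, ENNReal.ofReal (t.1 ^ q) *
          ∑' x : {x : Fin d → ℤ // t.1 < (znorm x ^ 2 + 1) * V x},
            ENNReal.ofReal ((znorm x.1 ^ 2 + 1) ^ (-(d : ℝ) / 2)) with hM
  have e0 : 32000 * (d : ℝ) ^ 3 * (c * s) = s / 4 := by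
    rw [hc]
    field_simp
  have e1 : ENNReal.ofReal (c * s) ≤ ENNReal.ofReal (s / 4) :=
    ENNReal.ofReal_le_ofReal (by nlinarith)
  have hsplit : ENNReal.ofReal s = ENNReal.ofReal (s / 2) +
      (ENNReal.ofReal (s / 4) + ENNReal.ofReal (s / 4)) := by
    rw [← ENNReal.ofReal_add (by positivity) (by positivity),
      ← ENNReal.ofReal_add (by positivity) (by positivity)]
    congr 1
    ring
  have habs : ENNReal.ofReal (s / 2) * N ≤ ENNReal.ofReal (A * (c * s) ^ (1 - q)) * M := by
    have hfin' : (ENNReal.ofReal (s / 4) + ENNReal.ofReal (s / 4)) * N ≠ ∞ :=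
      ENNReal.mul_ne_top (by simp) hN'
    refine (ENNReal.add_le_add_iff_right hfin').1 ?_
    rw [← add_mul, ← hsplit]
    refine key.trans ?_
    rw [e0]
    calc _ ≤ ENNReal.ofReal (s / 4) * N + (ENNReal.ofReal (A * (c * s) ^ (1 - q)) * M +
          ENNReal.ofReal (s / 4) * N) := by
          gcongr
          · exact h2 _ hτ
          · exact (h1 _ hτ).trans e1
      _ = _ := by ring
  calc N = ENNReal.ofReal (2 / s) * (ENNReal.ofReal (s / 2) * N) := by
        rw [← mul_assoc, ← ENNReal.ofReal_mul (by positivity)]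
        rw [show 2 / s * (s / 2) = 1 by field_simp]
        simp
    _ ≤ ENNReal.ofReal (2 / s) * (ENNReal.ofReal (A * (c * s) ^ (1 - q)) * M) := by gcongr
    _ = _ := by
        rw [ENNReal.ofReal_rpow_of_pos hs, ← mul_assoc, ← ENNReal.ofReal_mul (by positivity),
          ← ENNReal.ofReal_mul (by positivity)]
        congr 2
        rw [Real.mul_rpow hc0.le hs.le, sub_eq_add_neg, Real.rpow_add hs, Real.rpow_one]
        field_simp
end
end
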